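/- Let n = 2 and let F : [0,∞) → ℝ be C² satisfying the structural conditions, with λ² = 2F'(1) − F(1) > 0. Let u : ℝ² → ℝ be a nonnegative, locally Lipschitz global minimizer of J_F whose free boundary Γ = ∂{u>0} is nonempty and is a smooth (C^∞) embedded curve, with u smooth up to Γ from the positive side and |∇u| = 1 on Γ. Then Γ is a straight line; more precisely, there exist a unit vector e ∈ ℝ² and c ∈ ℝ such that u(x) = max(⟨x, e⟩ − c, 0) for all x. -/

import Mathlib

open MeasureTheory Metric Set
open scoped RealInnerProductSpace

namespace OnePhase

/-- The Euclidean plane. -/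
abbrev Plane := EuclideanSpace ℝ (Fin 2)

/-- The `i`-th partial derivative of a function on the plane. -/
noncomputable def pd (i : Fin 2) (f : Plane → ℝ) (x : Plane) : ℝ :=
  fderiv ℝ f x (EuclideanSpace.single i 1)

theorem eq_smul_single_add (v : Plane) :
    v = v 0 • EuclideanSpace.single 0 (1 : ℝ) + v 1 • EuclideanSpace.single 1 (1 : ℝ) := by
  ext i
  fin_cases i <;> simp

theorem clm_apply_eq (L : Plane →L[ℝ] ℝ) (v : Plane) :
    L v = v 0 * L (EuclideanSpace.single 0 1) + v 1 * L (EuclideanSpace.single 1 1) := by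
  conv_lhs => rw [eq_smul_single_add v]
  simp

theorem fderiv_apply_eq (f : Plane → ℝ) (x v : Plane) :
    fderiv ℝ f x v = v 0 * pd 0 f x + v 1 * pd 1 f x :=
  clm_apply_eq _ v

theorem norm_sq_eq (x : Plane) : ‖x‖ ^ 2 = x 0 ^ 2 + x 1 ^ 2 := by
  simp [EuclideanSpace.norm_sq_eq, Fin.sum_univ_two]

theorem inner_eq (x y : Plane) : ⟪x, y⟫ = x 0 * y 0 + x 1 * y 1 := by
  simp [PiLp.inner_apply, Fin.sum_univ_two, mul_comm]

theorem gradient_apply (f : Plane → ℝ) (x : Plane) (i : Fin 2) : gradient f x i = pd i f x := by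
  have : ⟪gradient f x, EuclideanSpace.single i (1 : ℝ)⟫ = pd i f x := by
    simp [gradient, pd]
  rw [← this, EuclideanSpace.inner_single_right]
  simp

theorem norm_gradient_sq (f : Plane → ℝ) (x : Plane) :
    ‖gradient f x‖ ^ 2 = pd 0 f x ^ 2 + pd 1 f x ^ 2 := by
  rw [norm_sq_eq, gradient_apply, gradient_apply]

theorem pd_congr {f g : Plane → ℝ} {x : Plane} (h : f =ᶠ[nhds x] g) (i : Fin 2) :
    pd i f x = pd i g x := by
  rw [pd, pd, h.fderiv_eq]

theorem contDiff_pd {f : Plane → ℝ} (hf : ContDiff ℝ (⊤ : ℕ∞) f) (i : Fin 2) :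
    ContDiff ℝ (⊤ : ℕ∞) (pd i f) := by
  have h : ContDiff ℝ (⊤ : ℕ∞) (fderiv ℝ f) := hf.fderiv_right (by simp)
  exact h.clm_apply contDiff_const

theorem continuous_pd {f : Plane → ℝ} (hf : ContDiff ℝ 1 f) (i : Fin 2) :
    Continuous (pd i f) :=
  (hf.continuous_fderiv (by simp)).clm_apply continuous_const

theorem smooth_of_le {f : Plane → ℝ} (hf : ContDiff ℝ (⊤ : ℕ∞) f) : ContDiff ℝ 1 f :=
  hf.of_le (by exact_mod_cast le_top)

theorem pd_mul {f g : Plane → ℝ} {x : Plane} (hf : DifferentiableAt ℝ f x)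
    (hg : DifferentiableAt ℝ g x) (i : Fin 2) :
    pd i (fun y => f y * g y) x = pd i f x * g x + f x * pd i g x := by
  simp only [pd]
  rw [fderiv_fun_mul hf hg]
  simp
  ring

theorem pd_add {f g : Plane → ℝ} {x : Plane} (hf : DifferentiableAt ℝ f x)
    (hg : DifferentiableAt ℝ g x) (i : Fin 2) :
    pd i (fun y => f y + g y) x = pd i f x + pd i g x := by
  simp only [pd]
  rw [fderiv_fun_add hf hg]
  simp

theorem pd_sub {f g : Plane → ℝ} {x : Plane} (hf : DifferentiableAt ℝ f x)
    (hg : DifferentiableAt ℝ g x) (i : Fin 2) :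
    pd i (fun y => f y - g y) x = pd i f x - pd i g x := by
  simp only [pd]
  rw [fderiv_fun_sub hf hg]
  simp

theorem pd_neg {f : Plane → ℝ} {x : Plane} (i : Fin 2) :
    pd i (fun y => - f y) x = - pd i f x := by
  simp only [pd]
  rw [fderiv_fun_neg]
  simp

theorem pd_const (c : ℝ) (i : Fin 2) (x : Plane) : pd i (fun _ => c) x = 0 := by
  simp [pd]

theorem pd_const_mul {f : Plane → ℝ} {x : Plane} (c : ℝ) (hf : DifferentiableAt ℝ f x)
    (i : Fin 2) : pd i (fun y => c * f y) x = c * pd i f x := by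
  rw [pd_mul (differentiableAt_const c) hf, pd_const]
  ring

theorem pd_comp {g : ℝ → ℝ} {g' : ℝ} {f : Plane → ℝ} {x : Plane}
    (hg : HasDerivAt g g' (f x)) (hf : DifferentiableAt ℝ f x) (i : Fin 2) :
    pd i (fun y => g (f y)) x = g' * pd i f x := by
  have := (hg.comp_hasFDerivAt x hf.hasFDerivAt).fderiv
  simp only [pd]
  rw [show (fun y => g (f y)) = g ∘ f from rfl, this]
  simp

theorem pd_sq {f : Plane → ℝ} {x : Plane} (hf : DifferentiableAt ℝ f x) (i : Fin 2) :
    pd i (fun y => f y ^ 2) x = 2 * f x * pd i f x := by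
  have := pd_comp (g := fun t => t ^ 2) (hasDerivAt_pow 2 (f x)) hf i
  simpa using this

theorem pd_coord (i j : Fin 2) (x : Plane) :
    pd i (fun y : Plane => y j) x = if i = j then 1 else 0 := by
  have h : HasFDerivAt (fun y : Plane => y j) (EuclideanSpace.proj j : Plane →L[ℝ] ℝ) x :=
    (EuclideanSpace.proj j : Plane →L[ℝ] ℝ).hasFDerivAt
  rw [pd, h.fderiv]
  simp [eq_comm]

theorem pd_comm {f : Plane → ℝ} (hf : ContDiff ℝ (⊤ : ℕ∞) f) (x : Plane) :
    pd 1 (pd 0 f) x = pd 0 (pd 1 f) x := by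
  have hs := (hf.contDiffAt (x := x)).isSymmSndFDerivAt
    (by simp only [minSmoothness_of_isRCLikeNormedField]; exact WithTop.coe_le_coe.2 le_top)
  have hd : DifferentiableAt ℝ (fderiv ℝ f) x :=
    ((hf.fderiv_right (m := (⊤ : ℕ∞)) (by simp)).differentiable (by simp)) x
  have key : ∀ i j : Fin 2, pd i (pd j f) x
      = fderiv ℝ (fderiv ℝ f) x (EuclideanSpace.single i 1) (EuclideanSpace.single j 1) := by
    intro i j
    rw [pd, show pd j f
      = fun y => (fderiv ℝ f y) ((fun _ => EuclideanSpace.single j (1:ℝ)) y) from rfl,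
      fderiv_clm_apply hd (differentiableAt_const _)]
    simp
  rw [key, key]
  exact hs _ _

theorem integrable_of_cs {f : Plane → ℝ} (hf : Continuous f) (hc : HasCompactSupport f) :
    Integrable f := hf.integrable_of_hasCompactSupport hc

theorem hasCompactSupport_pd {f : Plane → ℝ} (hc : HasCompactSupport f) (i : Fin 2) :
    HasCompactSupport (pd i f) :=
  hc.fderiv_apply ℝ _

theorem integral_pd {f : Plane → ℝ} (hf : ContDiff ℝ 1 f) (hc : HasCompactSupport f)
    (i : Fin 2) : ∫ x, pd i f x = 0 := by
  have h := integral_mul_fderiv_eq_neg_fderiv_mul_of_integrable (μ := (volume : Measure Plane))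
    (f := fun _ => (1 : ℝ)) (g := f) (v := EuclideanSpace.single i 1) (by simp)
    (by
      simp only [one_mul]
      exact integrable_of_cs (continuous_pd hf i) (hasCompactSupport_pd hc i))
    (by simpa using integrable_of_cs hf.continuous hc)
    (fun _ _ => differentiableAt_const _)
    (fun x _ => hf.differentiable (by simp) x)
  simpa [pd] using h

/-- Differentiation under the integral sign over a measurable subset of a compact set. -/
theorem hasDerivAt_setIntegral {S K : Set Plane} (hS : MeasurableSet S) (hK : IsCompact K)
    (hSK : S ⊆ K) {f f₁ : ℝ → Plane → ℝ} {t₀ : ℝ}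
    (hf : ContinuousOn (fun q : ℝ × Plane => f q.1 q.2) (Icc (-t₀) t₀ ×ˢ K))
    (hf₁ : ContinuousOn (fun q : ℝ × Plane => f₁ q.1 q.2) (Icc (-t₀) t₀ ×ˢ K))
    (hd : ∀ t ∈ Icc (-t₀) t₀, ∀ x ∈ K, HasDerivAt (fun τ => f τ x) (f₁ t x) t)
    {t : ℝ} (ht : t ∈ Ioo (-t₀) t₀) :
    HasDerivAt (fun τ => ∫ x in S, f τ x) (∫ x in S, f₁ t x) t := by
  obtain ⟨C, hC⟩ := (isCompact_Icc.prod hK).exists_bound_of_continuousOn hf₁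
  have hSf : volume S ≠ ⊤ := ((measure_mono hSK).trans_lt hK.measure_lt_top).ne
  have hcont : ∀ g : ℝ → Plane → ℝ,
      ContinuousOn (fun q : ℝ × Plane => g q.1 q.2) (Icc (-t₀) t₀ ×ˢ K) →
      ∀ τ ∈ Icc (-t₀) t₀, ContinuousOn (g τ) K := by
    intro g hg τ hτ
    exact hg.comp (f := fun x => (τ, x)) (by fun_prop) (fun x hx => ⟨hτ, hx⟩)
  have hmem : Ioo (-t₀) t₀ ∈ nhds t := isOpen_Ioo.mem_nhds ht
  refine (hasDerivAt_integral_of_dominated_loc_of_deriv_le (μ := volume.restrict S)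
    (F := f) (F' := f₁) (bound := fun _ => C) (s := Ioo (-t₀) t₀) hmem ?_ ?_ ?_ ?_ ?_ ?_).2
  · filter_upwards [hmem] with τ hτ
    exact ((hcont f hf τ (Ioo_subset_Icc_self hτ)).mono hSK).aestronglyMeasurable hS
  · exact ((hcont f hf t (Ioo_subset_Icc_self ht)).integrableOn_compact hK).mono_set hSK
  · exact ((hcont f₁ hf₁ t (Ioo_subset_Icc_self ht)).mono hSK).aestronglyMeasurable hS
  · filter_upwards [ae_restrict_mem hS] with x hx τ hτ
    exact hC (τ, x) ⟨Ioo_subset_Icc_self hτ, hSK hx⟩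
  · exact integrableOn_const hSf
  · filter_upwards [ae_restrict_mem hS] with x hx τ hτ
    exact hd τ (Ioo_subset_Icc_self hτ) x (hSK hx)

/-- First and second order necessary conditions at an interior minimum. -/
theorem second_order_necessary {Φ Φ₁ : ℝ → ℝ} {Φ₂ t₀ : ℝ} (ht₀ : 0 < t₀)
    (h₁ : ∀ t ∈ Ioo (-t₀) t₀, HasDerivAt Φ (Φ₁ t) t) (h₂ : HasDerivAt Φ₁ Φ₂ 0)
    (hmin : ∀ t ∈ Ioo (-t₀) t₀, Φ 0 ≤ Φ t) : Φ₁ 0 = 0 ∧ 0 ≤ Φ₂ := by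
  have h0 : (0 : ℝ) ∈ Ioo (-t₀) t₀ := ⟨by linarith, ht₀⟩
  have hnhds : Ioo (-t₀) t₀ ∈ nhds (0 : ℝ) := isOpen_Ioo.mem_nhds h0
  have hloc : IsLocalMin Φ 0 := by
    filter_upwards [hnhds] with t ht using hmin t ht
  have hz : Φ₁ 0 = 0 := hloc.hasDerivAt_eq_zero (h₁ 0 h0)
  refine ⟨hz, ?_⟩
  by_contra hneg
  push Not at hneg
  have hdd : deriv Φ =ᶠ[nhds 0] Φ₁ := by
    filter_upwards [hnhds] with t ht using (h₁ t ht).deriv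
  have hmax : IsLocalMax Φ 0 := by
    refine isLocalMax_of_deriv_deriv_neg ?_ ?_ (h₁ 0 h0).continuousAt
    · rw [hdd.deriv_eq, h₂.deriv]; exact hneg
    · rw [(h₁ 0 h0).deriv, hz]
  have hconst : Φ =ᶠ[nhds 0] fun _ => Φ 0 := by
    filter_upwards [hloc, hmax] with t h h' using le_antisymm h' h
  have h3 : deriv Φ =ᶠ[nhds 0] fun _ => 0 := by
    filter_upwards [hconst.eventuallyEq_nhds] with t ht
    rw [ht.deriv_eq]; simp
  have h4 : Φ₁ =ᶠ[nhds 0] fun _ => 0 := hdd.symm.trans h3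
  have := h4.deriv_eq
  rw [h₂.deriv] at this
  simp at this
  linarith

theorem setIntegral_split {B O : Set Plane} (hB : MeasurableSet B) (hO : MeasurableSet O)
    {g f k : Plane → ℝ} (hf : IntegrableOn f (B ∩ O)) (hk : IntegrableOn k (B \ O))
    (h₁ : ∀ x ∈ B ∩ O, g x = f x) (h₂ : ∀ x ∈ B \ O, g x = k x) :
    ∫ x in B, g x = (∫ x in B ∩ O, f x) + ∫ x in B \ O, k x := by
  have hg1 : IntegrableOn g (B ∩ O) := hf.congr_fun (fun x hx => (h₁ x hx).symm) (hB.inter hO)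
  have hg2 : IntegrableOn g (B \ O) := hk.congr_fun (fun x hx => (h₂ x hx).symm) (hB.diff hO)
  have hg : IntegrableOn g B := by
    have := hg1.union hg2
    rwa [inter_union_sdiff] at this
  rw [← integral_inter_add_sdiff hO hg, setIntegral_congr_fun (hB.inter hO) h₁,
    setIntegral_congr_fun (hB.diff hO) h₂]

/-- The squared length of the gradient. -/
noncomputable def sq (W : Plane → ℝ) (x : Plane) : ℝ := pd 0 W x ^ 2 + pd 1 W x ^ 2

theorem sq_nonneg (W : Plane → ℝ) (x : Plane) : 0 ≤ sq W x := by
  unfold sq; positivity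

/-- A global minimizer `u` of the one-phase energy, coinciding on its positivity set with a smooth
function `W` whose gradient has unit length on the free boundary. -/
structure Minimizer (F F' F'' : ℝ → ℝ) (c₀ C₀ lam : ℝ) (u W : Plane → ℝ) : Prop where
  c₀_pos : 0 < c₀
  hasDerivAt : ∀ t, HasDerivAt F (F' t) t
  hasDerivAt' : ∀ t, HasDerivAt F' (F'' t) t
  continuous'' : Continuous F''
  le_deriv : ∀ t, 0 ≤ t → c₀ ≤ F' t
  deriv_le : ∀ t, 0 ≤ t → F' t ≤ C₀
  deriv2_nonneg : ∀ t, 0 ≤ t → 0 ≤ F'' t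
  deriv2_le : ∀ t, 0 ≤ t → F'' t ≤ C₀ / (1 + t)
  lam_sq : lam ^ 2 = 2 * F' 1 - F 1
  nonneg : ∀ x, 0 ≤ u x
  lip : LocallyLipschitz u
  minimal : ∀ R > (0 : ℝ), ∀ v : Plane → ℝ, LocallyLipschitz v →
    (∀ x ∉ ball (0 : Plane) R, v x = u x) →
    (∫ x in ball (0 : Plane) R,
      (F (‖gradient u x‖ ^ 2) + lam ^ 2 * Set.indicator {y | 0 < u y} (fun _ => (1:ℝ)) x)) ≤
    (∫ x in ball (0 : Plane) R,
      (F (‖gradient v x‖ ^ 2) + lam ^ 2 * Set.indicator {y | 0 < v y} (fun _ => (1:ℝ)) x))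
  smooth : ContDiff ℝ (⊤ : ℕ∞) W
  eq_on : ∀ x, 0 < u x → W x = u x
  sq_eq_one : ∀ z ∈ frontier {y | 0 < u y}, sq W z = 1

theorem pd_eq_zero_of_nonneg {v : Plane → ℝ} (hv : ∀ x, 0 ≤ v x) {x : Plane} (hx : v x = 0)
    (i : Fin 2) : pd i v x = 0 := by
  have h : IsLocalMin v x := Filter.Eventually.of_forall fun y => by rw [hx]; exact hv y
  rw [pd, h.fderiv_eq_zero]
  simp

theorem density_of_pos (F : ℝ → ℝ) (lam : ℝ) {v : Plane → ℝ} {x : Plane} (hx : 0 < v x) :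
    F (‖gradient v x‖ ^ 2) + lam ^ 2 * Set.indicator {y | 0 < v y} (fun _ => (1:ℝ)) x
      = F (pd 0 v x ^ 2 + pd 1 v x ^ 2) + lam ^ 2 := by
  rw [norm_gradient_sq, indicator_of_mem (by exact hx), mul_one]

theorem density_of_zero (F : ℝ → ℝ) (lam : ℝ) {v : Plane → ℝ} (hv : ∀ x, 0 ≤ v x) {x : Plane}
    (hx : v x = 0) :
    F (‖gradient v x‖ ^ 2) + lam ^ 2 * Set.indicator {y | 0 < v y} (fun _ => (1:ℝ)) x = F 0 := by
  rw [norm_gradient_sq, pd_eq_zero_of_nonneg hv hx, pd_eq_zero_of_nonneg hv hx,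
    indicator_of_notMem (by simp [hx])]
  simp

theorem exists_ball_of_cs {f : Plane → ℝ} (hf : HasCompactSupport f) :
    ∃ R > (0 : ℝ), tsupport f ⊆ ball 0 R := by
  obtain ⟨R, hR⟩ := (hf.isCompact.isBounded).subset_ball (0 : Plane)
  exact ⟨max R 1, by positivity, hR.trans (ball_subset_ball (le_max_left _ _))⟩

theorem pd_eq_zero_of_notMem_tsupport {f : Plane → ℝ} {x : Plane} (hx : x ∉ tsupport f)
    (i : Fin 2) : pd i f x = 0 := by
  rw [pd, fderiv_of_notMem_tsupport ℝ hx]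
  simp

theorem locallyLipschitz_mul {f g : Plane → ℝ} (hf : LocallyLipschitz f)
    (hg : LocallyLipschitz g) : LocallyLipschitz fun x => f x * g x := by
  have h : LocallyLipschitz fun q : ℝ × ℝ => q.1 * q.2 :=
    (contDiff_fst.mul contDiff_snd : ContDiff ℝ 1 fun q : ℝ × ℝ => q.1 * q.2).locallyLipschitz
  exact h.comp (hf.prodMk hg)

namespace Minimizer

variable {F F' F'' : ℝ → ℝ} {c₀ C₀ lam : ℝ} {u W : Plane → ℝ}

theorem isOpen (h : Minimizer F F' F'' c₀ C₀ lam u W) : IsOpen {y | 0 < u y} :=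
  isOpen_lt continuous_const h.lip.continuous

theorem eventually_eq (h : Minimizer F F' F'' c₀ C₀ lam u W) {x : Plane} (hx : 0 < u x) :
    u =ᶠ[nhds x] W := by
  filter_upwards [h.isOpen.mem_nhds hx] with y hy using (h.eq_on y hy).symm

theorem continuous_F (h : Minimizer F F' F'' c₀ C₀ lam u W) : Continuous F :=
  continuous_iff_continuousAt.2 fun t => (h.hasDerivAt t).continuousAt

theorem continuous_F' (h : Minimizer F F' F'' c₀ C₀ lam u W) : Continuous F' :=
  continuous_iff_continuousAt.2 fun t => (h.hasDerivAt' t).continuousAt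

theorem contDiff_F' (h : Minimizer F F' F'' c₀ C₀ lam u W) : ContDiff ℝ 1 F' := by
  rw [contDiff_one_iff_deriv]
  refine ⟨fun t => (h.hasDerivAt' t).differentiableAt, ?_⟩
  rw [show deriv F' = F'' from funext fun t => (h.hasDerivAt' t).deriv]
  exact h.continuous''

theorem contDiff_F (h : Minimizer F F' F'' c₀ C₀ lam u W) : ContDiff ℝ 1 F := by
  rw [contDiff_one_iff_deriv]
  refine ⟨fun t => (h.hasDerivAt t).differentiableAt, ?_⟩
  rw [show deriv F = F' from funext fun t => (h.hasDerivAt t).deriv]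
  exact h.continuous_F'

theorem W_differentiable (h : Minimizer F F' F'' c₀ C₀ lam u W) : Differentiable ℝ W :=
  h.smooth.differentiable (by simp)

theorem contDiff_p (h : Minimizer F F' F'' c₀ C₀ lam u W) (i : Fin 2) :
    ContDiff ℝ (⊤ : ℕ∞) (pd i W) := contDiff_pd h.smooth i

theorem continuous_p (h : Minimizer F F' F'' c₀ C₀ lam u W) (i : Fin 2) :
    Continuous (pd i W) := (h.contDiff_p i).continuous

theorem contDiff_sq (h : Minimizer F F' F'' c₀ C₀ lam u W) : ContDiff ℝ (⊤ : ℕ∞) (sq W) :=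
  ((h.contDiff_p 0).pow 2).add ((h.contDiff_p 1).pow 2)

theorem continuous_sq (h : Minimizer F F' F'' c₀ C₀ lam u W) : Continuous (sq W) :=
  h.contDiff_sq.continuous

/-- The energy of `u` in a ball. -/
theorem energy_eq (h : Minimizer F F' F'' c₀ C₀ lam u W) (R : ℝ) :
    (∫ x in ball (0 : Plane) R,
      (F (‖gradient u x‖ ^ 2) + lam ^ 2 * Set.indicator {y | 0 < u y} (fun _ => (1:ℝ)) x))
    = (∫ x in ball (0 : Plane) R ∩ {y | 0 < u y}, (F (sq W x) + lam ^ 2))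
      + ∫ _ in ball (0 : Plane) R \ {y | 0 < u y}, F 0 := by
  refine setIntegral_split measurableSet_ball h.isOpen.measurableSet ?_ ?_ ?_ ?_
  · have : Continuous fun x => F (sq W x) + lam ^ 2 :=
      (h.continuous_F.comp h.continuous_sq).add continuous_const
    exact (this.continuousOn.integrableOn_compact (isCompact_closedBall 0 R)).mono_set
      (inter_subset_left.trans ball_subset_closedBall)
  · exact integrableOn_const ((measure_mono sdiff_subset).trans_lt measure_ball_lt_top).ne
  · rintro x ⟨-, hx⟩
    rw [density_of_pos F lam hx, pd_congr (h.eventually_eq hx), pd_congr (h.eventually_eq hx), sq]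
  · rintro x ⟨-, hx⟩
    exact density_of_zero F lam h.nonneg (le_antisymm (not_lt.1 hx) (h.nonneg x))

/-- First outer variation, in the direction `u * η`. -/
theorem outer_variation (h : Minimizer F F' F'' c₀ C₀ lam u W) {η : Plane → ℝ}
    (hη : ContDiff ℝ 1 η) (hc : HasCompactSupport η) :
    ∫ x in {y | 0 < u y}, F' (sq W x) *
      (η x * sq W x + W x * (pd 0 W x * pd 0 η x + pd 1 W x * pd 1 η x)) = 0 := by
  obtain ⟨R, hR, hsupp⟩ := exists_ball_of_cs hc
  obtain ⟨M, hM⟩ := hη.continuous.bounded_above_of_compact_support hc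
  have hM0 : 0 ≤ M := (norm_nonneg _).trans (hM 0)
  have hout : ∀ x ∉ ball (0 : Plane) R, x ∉ tsupport η := fun x hx hx' => hx (hsupp hx')
  set t₀ : ℝ := 1 / (M + 1) with ht₀
  have ht₀pos : 0 < t₀ := by positivity
  have hpos : ∀ t ∈ Ioo (-t₀) t₀, ∀ x, 0 < 1 + t * η x := by
    intro t ht x
    have h1 : |t * η x| < 1 := by
      rw [abs_mul]
      have h2 : |t| < t₀ := abs_lt.2 ht
      have h3 : |η x| ≤ M := hM x
      calc |t| * |η x| ≤ |t| * M := by gcongr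
        _ ≤ t₀ * M := by gcongr
        _ < 1 := by rw [ht₀, div_mul_eq_mul_div, div_lt_one (by positivity)]; linarith
    linarith [(abs_lt.1 h1).1]
  set A : Fin 2 → ℝ → Plane → ℝ :=
    fun i t x => (1 + t * η x) * pd i W x + t * (W x * pd i η x) with hA
  set A' : Fin 2 → Plane → ℝ := fun i x => η x * pd i W x + W x * pd i η x with hA'
  set f : ℝ → Plane → ℝ := fun t x => F (A 0 t x ^ 2 + A 1 t x ^ 2) + lam ^ 2 with hf
  set f₁ : ℝ → Plane → ℝ := fun t x =>
    F' (A 0 t x ^ 2 + A 1 t x ^ 2) * (2 * A 0 t x * A' 0 x + 2 * A 1 t x * A' 1 x) with hf₁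
  have hWc : Continuous W := h.smooth.continuous
  have hηc := hη.continuous
  have hpc := h.continuous_p
  have hηpc := continuous_pd hη
  have hFc := h.continuous_F
  have hF'c := h.continuous_F'
  have hAc : ∀ i, Continuous fun q : ℝ × Plane => A i q.1 q.2 := by
    intro i
    have := hpc i
    have := hηpc i
    fun_prop
  have hA'c : ∀ i, Continuous fun q : ℝ × Plane => A' i q.2 := by
    intro i
    have := hpc i
    have := hηpc i
    fun_prop
  have hfc : Continuous fun q : ℝ × Plane => f q.1 q.2 := by
    have := hAc 0
    have := hAc 1
    fun_prop
  have hf₁c : Continuous fun q : ℝ × Plane => f₁ q.1 q.2 := by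
    have := hAc 0
    have := hAc 1
    have := hA'c 0
    have := hA'c 1
    fun_prop
  have hAd : ∀ i t x, HasDerivAt (fun τ => A i τ x) (A' i x) t := by
    intro i t x
    have h1 : HasDerivAt (fun τ : ℝ => (1 + τ * η x) * pd i W x + τ * (W x * pd i η x))
        ((1 * η x) * pd i W x + 1 * (W x * pd i η x)) t :=
      ((((hasDerivAt_id t).mul_const (η x)).const_add 1).mul_const _).add
        ((hasDerivAt_id t).mul_const _)
    simpa [hA, hA'] using h1
  have hfd : ∀ t x, HasDerivAt (fun τ => f τ x) (f₁ t x) t := by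
    intro t x
    have h1 := (((hAd 0 t x).pow 2).add ((hAd 1 t x).pow 2))
    have h2 := ((h.hasDerivAt _).comp t h1).add_const (lam ^ 2)
    simpa [hf, hf₁, Function.comp_def] using h2
  have hΦ := hasDerivAt_setIntegral
    (measurableSet_ball.inter h.isOpen.measurableSet) (isCompact_closedBall (0 : Plane) R)
    (inter_subset_left.trans ball_subset_closedBall) (t₀ := t₀)
    hfc.continuousOn hf₁c.continuousOn (fun t _ x _ => hfd t x) (t := 0) ⟨by linarith, ht₀pos⟩
  have henergy : ∀ t ∈ Ioo (-t₀) t₀,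
      (∫ x in ball (0 : Plane) R ∩ {y | 0 < u y}, f 0 x)
        ≤ ∫ x in ball (0 : Plane) R ∩ {y | 0 < u y}, f t x := by
    intro t ht
    have hmin := h.minimal R hR (fun x => u x * (1 + t * η x)) ?_ ?_
    · rw [h.energy_eq R, setIntegral_split (O := {y | 0 < u y}) (f := f t) (k := fun _ => F 0)
        measurableSet_ball h.isOpen.measurableSet] at hmin
      · have h0 : ∀ x, f 0 x = F (sq W x) + lam ^ 2 := by
          intro x; simp [hf, hA, sq]
        simp_rw [h0]
        linarith
      · have : Continuous (f t) := hfc.comp (by fun_prop : Continuous fun x : Plane => (t, x))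
        exact (this.continuousOn.integrableOn_compact (isCompact_closedBall 0 R)).mono_set
          (inter_subset_left.trans ball_subset_closedBall)
      · exact integrableOn_const ((measure_mono sdiff_subset).trans_lt measure_ball_lt_top).ne
      · rintro x ⟨-, hx⟩
        have hx' : 0 < u x := hx
        rw [density_of_pos F lam (mul_pos hx' (hpos t ht x))]
        have hev : (fun x => u x * (1 + t * η x)) =ᶠ[nhds x] fun x => W x * (1 + t * η x) := by
          filter_upwards [h.eventually_eq hx'] with y hy
          rw [hy]
        have hηd : DifferentiableAt ℝ η x := hη.differentiable (by simp) x
        have hp : ∀ i, pd i (fun x => u x * (1 + t * η x)) x = A i t x := by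
          intro i
          rw [pd_congr hev, pd_mul (h.W_differentiable x) ((hηd.const_mul t).const_add 1),
            pd_add (differentiableAt_const _) (hηd.const_mul t), pd_const, pd_const_mul t hηd]
          simp only [hA]
          ring
        rw [hp, hp]
      · rintro x ⟨-, hx⟩
        have hx' : u x = 0 := le_antisymm (not_lt.1 hx) (h.nonneg x)
        exact density_of_zero F lam
          (fun y => mul_nonneg (h.nonneg y) (hpos t ht y).le) (by simp [hx'])
    · exact locallyLipschitz_mul h.lip
        (ContDiff.locallyLipschitz
          (contDiff_const.add (contDiff_const.mul hη) : ContDiff ℝ 1 fun x => 1 + t * η x))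
    · intro x hx
      rw [image_eq_zero_of_notMem_tsupport (hout x hx)]
      simp
  have hzero : ∫ x in ball (0 : Plane) R ∩ {y | 0 < u y}, f₁ 0 x = 0 := by
    refine IsLocalMin.hasDerivAt_eq_zero ?_ hΦ
    filter_upwards [Ioo_mem_nhds (by linarith : -t₀ < 0) ht₀pos] with t ht using henergy t ht
  have heq : ∀ x, F' (sq W x) *
      (η x * sq W x + W x * (pd 0 W x * pd 0 η x + pd 1 W x * pd 1 η x)) = 2⁻¹ * f₁ 0 x := by
    intro x
    simp only [hf₁, hA, hA', sq]
    ring_nf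
  rw [setIntegral_eq_of_subset_of_forall_sdiff_eq_zero (s := ball (0 : Plane) R ∩ {y | 0 < u y})
    h.isOpen.measurableSet inter_subset_right]
  · simp_rw [heq]
    rw [integral_const_mul, hzero, mul_zero]
  · rintro x ⟨hx1, hx2⟩
    have : x ∉ ball (0 : Plane) R := fun hx => hx2 ⟨hx, hx1⟩
    rw [image_eq_zero_of_notMem_tsupport (hout x this), pd_eq_zero_of_notMem_tsupport (hout x this),
      pd_eq_zero_of_notMem_tsupport (hout x this)]
    simp

end Minimizer
/-- A function that is smooth on an open set, multiplied by a cut-off supported there. -/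
theorem contDiff_mul_of_tsupport {φ g : Plane → ℝ} {n : WithTop ℕ∞} (hφ : ContDiff ℝ n φ)
    (hg : ∀ x ∈ tsupport φ, ContDiffAt ℝ n g x) : ContDiff ℝ n fun x => φ x * g x := by
  rw [contDiff_iff_contDiffAt]
  intro x
  by_cases hx : x ∈ tsupport φ
  · exact hφ.contDiffAt.mul (hg x hx)
  · refine (contDiffAt_const (c := (0 : ℝ))).congr_of_eventuallyEq ?_
    filter_upwards [notMem_tsupport_iff_eventuallyEq.1 hx] with y hy
    simp [hy]

/-- A continuous function on an open set that integrates to zero against all test functions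
vanishes. -/
theorem eq_zero_of_integral_smooth_mul_eq_zero {O : Set Plane} (hO : IsOpen O) {L : Plane → ℝ}
    (hL : Continuous L)
    (h : ∀ φ : Plane → ℝ, ContDiff ℝ (⊤ : ℕ∞) φ → HasCompactSupport φ → tsupport φ ⊆ O →
      ∫ x, φ x * L x = 0) {x : Plane} (hx : x ∈ O) : L x = 0 := by
  have h1 : ∀ᵐ y ∂(volume : Measure Plane), y ∈ O → L y = 0 :=
    hO.ae_eq_zero_of_integral_contDiff_smul_eq_zero
      (hL.locallyIntegrable.locallyIntegrableOn O) fun g hg hc hs => by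
        simpa using h g hg hc hs
  have h2 : L =ᵐ[volume.restrict O] fun _ => 0 :=
    (ae_restrict_iff' hO.measurableSet).2 h1
  exact Measure.eqOn_open_of_ae_eq h2 hO hL.continuousOn continuousOn_const hx

namespace Minimizer

variable {F F' F'' : ℝ → ℝ} {c₀ C₀ lam : ℝ} {u W : Plane → ℝ}

theorem W_pos (h : Minimizer F F' F'' c₀ C₀ lam u W) {x : Plane} (hx : 0 < u x) : 0 < W x := by
  rw [h.eq_on x hx]; exact hx

theorem contDiff_F'_sq (h : Minimizer F F' F'' c₀ C₀ lam u W) :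
    ContDiff ℝ 1 fun x => F' (sq W x) := h.contDiff_F'.comp (smooth_of_le h.contDiff_sq)

/-- Weak form of the Euler–Lagrange equation in the positivity set. -/
theorem weak_euler_lagrange (h : Minimizer F F' F'' c₀ C₀ lam u W) {φ : Plane → ℝ}
    (hφ : ContDiff ℝ 1 φ) (hc : HasCompactSupport φ) (hs : tsupport φ ⊆ {y | 0 < u y}) :
    ∫ x, F' (sq W x) * (pd 0 W x * pd 0 φ x + pd 1 W x * pd 1 φ x) = 0 := by
  set η : Plane → ℝ := fun x => φ x * (W x)⁻¹ with hηdef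
  have hη : ContDiff ℝ 1 η := contDiff_mul_of_tsupport hφ fun x hx =>
    (smooth_of_le h.smooth).contDiffAt.inv (h.W_pos (hs hx)).ne'
  have hηc : HasCompactSupport η := hc.mul_right
  have key := h.outer_variation hη hηc
  rw [← setIntegral_eq_integral_of_forall_compl_eq_zero (s := {y | 0 < u y})]
  · refine (setIntegral_congr_fun h.isOpen.measurableSet fun x hx => ?_).trans key
    have hx' : 0 < u x := hx
    have hev : φ =ᶠ[nhds x] fun y => W y * η y := by
      filter_upwards [h.isOpen.mem_nhds hx] with y hy
      have := (h.W_pos hy).ne'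
      simp only [hηdef]; field_simp
    have hηd : DifferentiableAt ℝ η x := hη.differentiable (by simp) x
    simp only [pd_congr hev, pd_mul (h.W_differentiable x) hηd, sq]
    ring
  · intro x hx
    have : x ∉ tsupport φ := fun h' => hx (hs h')
    rw [pd_eq_zero_of_notMem_tsupport this, pd_eq_zero_of_notMem_tsupport this]
    simp

theorem pd_sq_grad (h : Minimizer F F' F'' c₀ C₀ lam u W) (i : Fin 2) (x : Plane) :
    pd i (sq W) x = 2 * (pd 0 W x * pd i (pd 0 W) x + pd 1 W x * pd i (pd 1 W) x) := by
  have hd : ∀ j, DifferentiableAt ℝ (pd j W) x := fun j =>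
    (h.contDiff_p j).differentiable (by simp) x
  have : sq W = fun x => pd 0 W x ^ 2 + pd 1 W x ^ 2 := rfl
  rw [this, pd_add ((hd 0).fun_pow 2) ((hd 1).fun_pow 2), pd_sq (hd 0), pd_sq (hd 1)]
  ring

theorem pd_F'_sq (h : Minimizer F F' F'' c₀ C₀ lam u W) (i : Fin 2) (x : Plane) :
    pd i (fun x => F' (sq W x)) x = F'' (sq W x) * pd i (sq W) x :=
  pd_comp (h.hasDerivAt' _) (h.contDiff_sq.differentiable (by simp) x) i

/-- The Euler–Lagrange equation in the positivity set. -/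
theorem euler_lagrange (h : Minimizer F F' F'' c₀ C₀ lam u W) {x : Plane} (hx : 0 < u x) :
    F' (sq W x) * (pd 0 (pd 0 W) x + pd 1 (pd 1 W) x) + 2 * F'' (sq W x) *
      (pd 0 W x ^ 2 * pd 0 (pd 0 W) x + 2 * pd 0 W x * pd 1 W x * pd 0 (pd 1 W) x
        + pd 1 W x ^ 2 * pd 1 (pd 1 W) x) = 0 := by
  set L : Plane → ℝ := fun x =>
    F' (sq W x) * (pd 0 (pd 0 W) x + pd 1 (pd 1 W) x) + 2 * F'' (sq W x) *
      (pd 0 W x ^ 2 * pd 0 (pd 0 W) x + 2 * pd 0 W x * pd 1 W x * pd 0 (pd 1 W) x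
        + pd 1 W x ^ 2 * pd 1 (pd 1 W) x) with hL
  have hLc : Continuous L := by
    have h1 := h.continuous_F'
    have h2 := h.continuous''
    have h3 := h.continuous_sq
    have h4 := h.continuous_p
    have h5 : ∀ i j, Continuous (pd i (pd j W)) := fun i j =>
      (contDiff_pd (h.contDiff_p j) i).continuous
    fun_prop
  refine eq_zero_of_integral_smooth_mul_eq_zero h.isOpen hLc (fun φ hφ hc hs => ?_) hx
  have hφ1 : ContDiff ℝ 1 φ := smooth_of_le hφ
  have hweak := h.weak_euler_lagrange hφ1 hc hs
  set A : Plane → ℝ := fun x => F' (sq W x) with hA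
  have hA1 : ContDiff ℝ 1 A := h.contDiff_F'_sq
  set g : Fin 2 → Plane → ℝ := fun i x => φ x * (A x * pd i W x) with hg
  have hg1 : ∀ i, ContDiff ℝ 1 (g i) := fun i =>
    hφ1.mul (hA1.mul (smooth_of_le (h.contDiff_p i)))
  have hgc : ∀ i, HasCompactSupport (g i) := fun i => hc.mul_right
  have hinteg : ∀ i, Integrable (pd i (g i)) := fun i =>
    integrable_of_cs (continuous_pd (hg1 i) i) (hasCompactSupport_pd (hgc i) i)
  have hsum : ∫ x, (pd 0 (g 0) x + pd 1 (g 1) x) = 0 := by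
    rw [integral_add (hinteg 0) (hinteg 1), integral_pd (hg1 0) (hgc 0), integral_pd (hg1 1) (hgc 1),
      add_zero]
  have hpt : ∀ x, φ x * L x = (pd 0 (g 0) x + pd 1 (g 1) x)
      - A x * (pd 0 W x * pd 0 φ x + pd 1 W x * pd 1 φ x) := by
    intro x
    have hφd : DifferentiableAt ℝ φ x := hφ1.differentiable (by simp) x
    have hAd : DifferentiableAt ℝ A x := hA1.differentiable (by simp) x
    have hpd : ∀ i, DifferentiableAt ℝ (pd i W) x := fun i =>
      (h.contDiff_p i).differentiable (by simp) x
    simp only [hg]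
    rw [pd_mul hφd (hAd.fun_mul (hpd 0)), pd_mul hφd (hAd.fun_mul (hpd 1)), pd_mul hAd (hpd 0),
      pd_mul hAd (hpd 1), h.pd_F'_sq, h.pd_F'_sq, h.pd_sq_grad, h.pd_sq_grad, pd_comm h.smooth]
    simp only [hL, hA]
    ring
  have hi2 : Integrable fun x => A x * (pd 0 W x * pd 0 φ x + pd 1 W x * pd 1 φ x) := by
    refine integrable_of_cs ?_ ?_
    · have h1 := hA1.continuous
      have h2 := h.continuous_p
      have h3 := continuous_pd hφ1
      fun_prop
    · exact (((hasCompactSupport_pd hc 0).mul_left).add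
        ((hasCompactSupport_pd hc 1).mul_left)).mul_left
  simp_rw [hpt]
  rw [integral_sub (f := fun x => pd 0 (g 0) x + pd 1 (g 1) x) ((hinteg 0).add (hinteg 1)) hi2,
    hsum, hweak, sub_zero]

end Minimizer
/-- A perturbation of the identity by a contraction is invertible with Lipschitz inverse. -/
theorem exists_lipschitz_inverse {Y : Plane → Plane}
    (hY : ∀ x y, ‖Y x - Y y‖ ≤ 1 / 2 * ‖x - y‖) :
    ∃ g : Plane → Plane, LipschitzWith 2 g ∧ (∀ x, g (x + Y x) = x) ∧ ∀ y, g y + Y (g y) = y := by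
  have hap : ApproximatesLinearOn (fun x => x + Y x)
      ((ContinuousLinearEquiv.refl ℝ Plane : Plane ≃L[ℝ] Plane) : Plane →L[ℝ] Plane) univ
      (1 / 2) := by
    intro x _ y _
    have : x + Y x - (y + Y y) - (x - y) = Y x - Y y := by abel
    simpa [this] using hY x y
  have hsurj := hap.surjective (Or.inr (by
    have : ‖((ContinuousLinearEquiv.refl ℝ Plane).symm : Plane →L[ℝ] Plane)‖₊ = 1 := by
      ext
      simp only [ContinuousLinearEquiv.refl_symm, ContinuousLinearEquiv.coe_refl, coe_nnnorm]
      exact ContinuousLinearMap.norm_id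
    rw [this]
    rw [inv_one, ← NNReal.coe_lt_coe]
    norm_num))
  have hlow : ∀ x y, ‖x - y‖ ≤ 2 * ‖(x + Y x) - (y + Y y)‖ := by
    intro x y
    have h1 : x - y = ((x + Y x) - (y + Y y)) - (Y x - Y y) := by abel
    have h2 : ‖x - y‖ ≤ ‖(x + Y x) - (y + Y y)‖ + ‖Y x - Y y‖ := by
      conv_lhs => rw [h1]
      exact norm_sub_le _ _
    linarith [hY x y]
  obtain ⟨g, hg⟩ := hsurj.hasRightInverse
  have hg' : ∀ y, g y + Y (g y) = y := hg
  refine ⟨g, LipschitzWith.of_dist_le_mul fun y z => ?_, fun x => ?_, hg'⟩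
  · rw [dist_eq_norm, dist_eq_norm]
    have := hlow (g y) (g z)
    rwa [hg', hg'] at this
  · have := hlow (g (x + Y x)) x
    rw [hg', sub_self, norm_zero, mul_zero] at this
    exact sub_eq_zero.1 (norm_le_zero_iff.1 this)

theorem det_clm (L : Plane →L[ℝ] Plane) :
    L.det = L (EuclideanSpace.single 0 1) 0 * L (EuclideanSpace.single 1 1) 1
      - L (EuclideanSpace.single 1 1) 0 * L (EuclideanSpace.single 0 1) 1 := by
  rw [ContinuousLinearMap.det, ← LinearMap.det_toMatrix (EuclideanSpace.basisFun (Fin 2) ℝ).toBasis,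
    Matrix.det_fin_two]
  simp [LinearMap.toMatrix_apply]

/-- The vector field with given components. -/
noncomputable def field (X : Fin 2 → Plane → ℝ) (x : Plane) : Plane := WithLp.toLp 2 fun i => X i x

theorem contDiff_field {X : Fin 2 → Plane → ℝ} (hX : ∀ i, ContDiff ℝ 1 (X i)) :
    ContDiff ℝ 1 (field X) := by
  rw [contDiff_euclidean]
  exact hX

theorem hasCompactSupport_field {X : Fin 2 → Plane → ℝ} (hc : ∀ i, HasCompactSupport (X i)) :
    HasCompactSupport (field X) := by
  refine HasCompactSupport.intro ((hc 0).isCompact.union (hc 1).isCompact) fun x hx => ?_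
  rw [mem_union, not_or] at hx
  ext i
  fin_cases i
  · exact image_eq_zero_of_notMem_tsupport (f := X 0) hx.1
  · exact image_eq_zero_of_notMem_tsupport (f := X 1) hx.2

theorem fderiv_field_apply {X : Fin 2 → Plane → ℝ} (hX : ∀ i, ContDiff ℝ 1 (X i)) (x v : Plane)
    (i : Fin 2) : fderiv ℝ (field X) x v i = fderiv ℝ (X i) x v := by
  have h1 : HasFDerivAt (field X) (fderiv ℝ (field X) x) x :=
    ((contDiff_field hX).differentiable (by simp) x).hasFDerivAt
  have h3 : HasFDerivAt (X i) ((EuclideanSpace.proj i : Plane →L[ℝ] ℝ) ∘L fderiv ℝ (field X) x) x :=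
    (EuclideanSpace.proj i : Plane →L[ℝ] ℝ).hasFDerivAt.comp x h1
  rw [h3.fderiv]
  rfl

/-- The divergence of a planar field. -/
noncomputable def divg (X : Fin 2 → Plane → ℝ) (x : Plane) : ℝ := pd 0 (X 0) x + pd 1 (X 1) x

/-- The Jacobian determinant of a planar field. -/
noncomputable def jac (X : Fin 2 → Plane → ℝ) (x : Plane) : ℝ :=
  pd 0 (X 0) x * pd 1 (X 1) x - pd 1 (X 0) x * pd 0 (X 1) x

/-- The quadratic form of the differential of `X` evaluated at the gradient of `W`. -/
noncomputable def qform (W : Plane → ℝ) (X : Fin 2 → Plane → ℝ) (x : Plane) : ℝ :=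
  pd 0 W x * (pd 0 (X 0) x * pd 0 W x + pd 1 (X 0) x * pd 1 W x)
    + pd 1 W x * (pd 0 (X 1) x * pd 0 W x + pd 1 (X 1) x * pd 1 W x)

/-- The squared length of the transposed differential of `X` applied to the gradient of `W`. -/
noncomputable def tsq (W : Plane → ℝ) (X : Fin 2 → Plane → ℝ) (x : Plane) : ℝ :=
  (pd 0 (X 0) x * pd 0 W x + pd 0 (X 1) x * pd 1 W x) ^ 2
    + (pd 1 (X 0) x * pd 0 W x + pd 1 (X 1) x * pd 1 W x) ^ 2

/-- The Jacobian of the flow. -/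
def trJ (T d t : ℝ) : ℝ := 1 + T * t + d * t ^ 2

/-- The numerator of the transported squared gradient. -/
def trS (T s a b t : ℝ) : ℝ := s + 2 * (T * s - a) * t + (T ^ 2 * s - 2 * T * a + b) * t ^ 2

/-- The transported squared gradient. -/
noncomputable def trQ (T d s a b t : ℝ) : ℝ := trS T s a b t / trJ T d t ^ 2

/-- The derivative of the transported squared gradient, multiplied by the Jacobian. -/
noncomputable def trP (T d s a b t : ℝ) : ℝ :=
  ((2 * (T * s - a) + 2 * (T ^ 2 * s - 2 * T * a + b) * t) * trJ T d t
    - 2 * trS T s a b t * (T + 2 * d * t)) / trJ T d t ^ 2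

/-- The derivative of `trP`. -/
noncomputable def trP' (T d s a b t : ℝ) : ℝ :=
  (2 * (T ^ 2 * s - 2 * T * a + b) * trJ T d t
    - (2 * (T * s - a) + 2 * (T ^ 2 * s - 2 * T * a + b) * t) * (T + 2 * d * t)
    - 4 * d * trS T s a b t) / trJ T d t ^ 2
    - 2 * (T + 2 * d * t) * trP T d s a b t / trJ T d t

theorem hasDerivAt_quadratic (c A B t : ℝ) :
    HasDerivAt (fun t : ℝ => c + A * t + B * t ^ 2) (A + 2 * B * t) t := by
  have := (((hasDerivAt_id t).const_mul A).const_add c).add (((hasDerivAt_id t).pow 2).const_mul B)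
  refine this.congr_deriv ?_
  simp; ring

theorem hasDerivAt_trJ (T d t : ℝ) : HasDerivAt (trJ T d) (T + 2 * d * t) t :=
  hasDerivAt_quadratic 1 T d t

theorem hasDerivAt_trS (T s a b t : ℝ) : HasDerivAt (trS T s a b)
    (2 * (T * s - a) + 2 * (T ^ 2 * s - 2 * T * a + b) * t) t :=
  hasDerivAt_quadratic s _ _ t

theorem hasDerivAt_trQ {T d t : ℝ} (s a b : ℝ) (hJ : trJ T d t ≠ 0) :
    HasDerivAt (trQ T d s a b) (trP T d s a b t / trJ T d t) t := by
  refine ((hasDerivAt_trS T s a b t).div ((hasDerivAt_trJ T d t).pow 2)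
    (pow_ne_zero 2 hJ)).congr_deriv ?_
  simp only [trP, Pi.pow_apply]
  field_simp
  ring

theorem hasDerivAt_trP {T d t : ℝ} (s a b : ℝ) (hJ : trJ T d t ≠ 0) :
    HasDerivAt (trP T d s a b) (trP' T d s a b t) t := by
  have h1 : HasDerivAt (fun t : ℝ => 2 * (T * s - a) + 2 * (T ^ 2 * s - 2 * T * a + b) * t)
      (2 * (T ^ 2 * s - 2 * T * a + b)) t := by
    simpa using ((hasDerivAt_id t).const_mul (2 * (T ^ 2 * s - 2 * T * a + b))).const_add
      (2 * (T * s - a))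
  have h2 : HasDerivAt (fun t : ℝ => T + 2 * d * t) (2 * d) t := by
    simpa using ((hasDerivAt_id t).const_mul (2 * d)).const_add T
  refine (((h1.mul (hasDerivAt_trJ T d t)).sub
    (((hasDerivAt_trS T s a b t).const_mul 2).mul h2)).div ((hasDerivAt_trJ T d t).pow 2)
    (pow_ne_zero 2 hJ)).congr_deriv ?_
  simp only [trP', trP, Pi.mul_apply, Pi.sub_apply, Pi.pow_apply]
  field_simp
  ring

/-- First derivative of the transported energy density. -/
theorem hasDerivAt_transported {F F' : ℝ → ℝ} (hF : ∀ t, HasDerivAt F (F' t) t) (l : ℝ)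
    {T d t : ℝ} (s a b : ℝ) (hJ : trJ T d t ≠ 0) :
    HasDerivAt (fun t => trJ T d t * (F (trQ T d s a b t) + l))
      ((T + 2 * d * t) * (F (trQ T d s a b t) + l) + F' (trQ T d s a b t) * trP T d s a b t) t := by
  refine ((hasDerivAt_trJ T d t).mul
    (((hF _).comp t (hasDerivAt_trQ s a b hJ)).add_const l)).congr_deriv ?_
  simp only [Function.comp]
  field_simp

/-- Second derivative of the transported energy density. -/
theorem hasDerivAt_transported_deriv {F F' F'' : ℝ → ℝ} (hF : ∀ t, HasDerivAt F (F' t) t)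
    (hF' : ∀ t, HasDerivAt F' (F'' t) t) (l : ℝ) {T d t : ℝ} (s a b : ℝ) (hJ : trJ T d t ≠ 0) :
    HasDerivAt (fun t => (T + 2 * d * t) * (F (trQ T d s a b t) + l)
        + F' (trQ T d s a b t) * trP T d s a b t)
      (2 * d * (F (trQ T d s a b t) + l)
        + (T + 2 * d * t) * (F' (trQ T d s a b t) * (trP T d s a b t / trJ T d t))
        + (F'' (trQ T d s a b t) * (trP T d s a b t / trJ T d t) * trP T d s a b t
        + F' (trQ T d s a b t) * trP' T d s a b t)) t := by
  have h2 : HasDerivAt (fun t : ℝ => T + 2 * d * t) (2 * d) t := by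
    simpa using ((hasDerivAt_id t).const_mul (2 * d)).const_add T
  exact (h2.mul (((hF _).comp t (hasDerivAt_trQ s a b hJ)).add_const l)).add
    (((hF' _).comp t (hasDerivAt_trQ s a b hJ)).mul (hasDerivAt_trP s a b hJ))

namespace Minimizer

variable {F F' F'' : ℝ → ℝ} {c₀ C₀ lam : ℝ} {u W : Plane → ℝ}

/-- Comparison of `u` with its transport by the flow `x ↦ x + t X x`. -/
theorem transported_energy (h : Minimizer F F' F'' c₀ C₀ lam u W) {X : Fin 2 → Plane → ℝ}
    (hX : ∀ i, ContDiff ℝ 1 (X i)) {R : ℝ} (hR : 0 < R)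
    (hout : ∀ x ∉ ball (0 : Plane) R, ∀ i, X i x = 0) {t : ℝ}
    (hLip : ∀ x y, ‖t • field X x - t • field X y‖ ≤ 1 / 2 * ‖x - y‖)
    (hJ : ∀ x, 0 < trJ (divg X x) (jac X x) t) :
    (∫ x in ball (0 : Plane) R ∩ {y | 0 < u y}, (F (sq W x) + lam ^ 2))
      + ∫ _ in ball (0 : Plane) R \ {y | 0 < u y}, F 0
    ≤ (∫ x in ball (0 : Plane) R ∩ {y | 0 < u y}, trJ (divg X x) (jac X x) t *
        (F (trQ (divg X x) (jac X x) (sq W x) (qform W X x) (tsq W X x) t) + lam ^ 2))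
      + ∫ x in ball (0 : Plane) R \ {y | 0 < u y}, trJ (divg X x) (jac X x) t * F 0 := by
  obtain ⟨g, hg, hgl, hgr⟩ := exists_lipschitz_inverse hLip
  set Ψ : Plane → Plane := fun x => x + t • field X x with hΨ
  set D : Plane → Plane →L[ℝ] Plane :=
    fun x => ContinuousLinearMap.id ℝ Plane + t • fderiv ℝ (field X) x with hD
  have hΨd : ∀ x, HasFDerivAt Ψ (D x) x := fun x => (hasFDerivAt_id x).add
    (((contDiff_field hX).differentiable (by simp) x).hasFDerivAt.const_smul t)
  have hDap : ∀ x v i, D x v i = v i + t * fderiv ℝ (X i) x v := by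
    intro x v i
    simp [hD, fderiv_field_apply hX]
  have hdet : ∀ x, (D x).det = trJ (divg X x) (jac X x) t := by
    intro x
    rw [det_clm, hDap, hDap, hDap, hDap]
    simp only [trJ, divg, jac, pd]
    simp
    ring
  have hfix : ∀ x ∉ ball (0 : Plane) R, field X x = 0 := by
    intro x hx
    ext i
    exact hout x hx i
  have hΨfix : ∀ x ∉ ball (0 : Plane) R, Ψ x = x := by
    intro x hx
    simp [hΨ, hfix x hx]
  have hgfix : ∀ x ∉ ball (0 : Plane) R, g x = x := by
    intro x hx
    have := hgl x
    rwa [hfix x hx, smul_zero, add_zero] at this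
  have himage : Ψ '' ball (0 : Plane) R = ball 0 R := by
    ext y
    constructor
    · rintro ⟨x, hx, rfl⟩
      by_contra hy
      have h1 : g (Ψ x) = Ψ x := hgfix _ hy
      rw [hgl x] at h1
      exact hy (h1 ▸ hx)
    · intro hy
      refine ⟨g y, ?_, hgr y⟩
      by_contra hx
      have h1 := hΨfix _ hx
      have h2 : Ψ (g y) = y := hgr y
      have h3 : y = g y := h2.symm.trans h1
      exact hx (by rw [← h3]; exact hy)
  have hinj : InjOn Ψ (ball (0 : Plane) R) := fun x _ y _ hxy => by
    rw [← hgl x, ← hgl y]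
    exact congrArg g hxy
  set v : Plane → ℝ := fun x => u (g x) with hv
  have hvΨ : ∀ x, v (Ψ x) = u x := fun x => by simp only [hv, hΨ]; rw [hgl]
  have hmin := h.minimal R hR v (h.lip.comp hg.locallyLipschitz)
    (fun x hx => by simp only [hv]; rw [hgfix x hx])
  rw [h.energy_eq R] at hmin
  refine hmin.trans (le_of_eq ?_)
  conv_lhs => rw [← himage]
  rw [integral_image_eq_integral_abs_det_fderiv_smul volume measurableSet_ball
    (fun x _ => (hΨd x).hasFDerivWithinAt) hinj]
  have hTc : Continuous (divg X) := (continuous_pd (hX 0) 0).add (continuous_pd (hX 1) 1)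
  have hdc : Continuous (jac X) := ((continuous_pd (hX 0) 0).mul (continuous_pd (hX 1) 1)).sub
    ((continuous_pd (hX 0) 1).mul (continuous_pd (hX 1) 0))
  have hJc : Continuous fun x => trJ (divg X x) (jac X x) t := by
    unfold trJ; fun_prop
  have hQc : Continuous fun x =>
      trQ (divg X x) (jac X x) (sq W x) (qform W X x) (tsq W X x) t := by
    unfold trQ
    refine Continuous.div ?_ (hJc.pow 2) fun x => (pow_pos (hJ x) 2).ne'
    have h0 := continuous_pd (hX 0)
    have h1 := continuous_pd (hX 1)
    have h2 := h.continuous_p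
    have h3 := h.continuous_sq
    unfold trS qform tsq
    fun_prop
  refine setIntegral_split measurableSet_ball h.isOpen.measurableSet ?_ ?_ ?_ ?_
  · have : Continuous fun x => trJ (divg X x) (jac X x) t *
        (F (trQ (divg X x) (jac X x) (sq W x) (qform W X x) (tsq W X x) t) + lam ^ 2) :=
      hJc.mul ((h.continuous_F.comp hQc).add continuous_const)
    exact (this.continuousOn.integrableOn_compact (isCompact_closedBall 0 R)).mono_set
      (inter_subset_left.trans ball_subset_closedBall)
  · exact ((hJc.mul continuous_const).continuousOn.integrableOn_compact
      (isCompact_closedBall 0 R)).mono_set (sdiff_subset.trans ball_subset_closedBall)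
  · rintro x ⟨-, hx⟩
    have hx' : 0 < u x := hx
    have hvx : 0 < v (Ψ x) := by rw [hvΨ]; exact hx'
    rw [density_of_pos F lam hvx, hdet, abs_of_pos (hJ x), smul_eq_mul]
    have hdet0 : (D x).det ≠ 0 := by rw [hdet]; exact (hJ x).ne'
    set e := (D x).toContinuousLinearEquivOfDetNeZero hdet0 with he
    have hgd : HasFDerivAt g (e.symm : Plane →L[ℝ] Plane) (Ψ x) := by
      refine HasFDerivAt.of_local_left_inverse (f := Ψ) hg.continuous.continuousAt ?_
        (Filter.Eventually.of_forall hgr)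
      rw [show g (Ψ x) = x from hgl x, he,
        ContinuousLinearMap.coe_toContinuousLinearEquivOfDetNeZero]
      exact hΨd x
    have hud : DifferentiableAt ℝ u x :=
      (h.W_differentiable x).congr_of_eventuallyEq (h.eventually_eq hx')
    have hvd : DifferentiableAt ℝ v (Ψ x) := by
      refine DifferentiableAt.comp (g := u) (Ψ x) ?_ hgd.differentiableAt
      rw [show g (Ψ x) = x from hgl x]
      exact hud
    have hcomp : HasFDerivAt (fun y => v (Ψ y)) ((fderiv ℝ v (Ψ x)).comp (D x)) x :=
      hvd.hasFDerivAt.comp x (hΨd x)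
    have hvu : (fun y => v (Ψ y)) = u := funext hvΨ
    rw [hvu] at hcomp
    have hrel : ∀ j, pd j W x = pd 0 v (Ψ x) * (D x (EuclideanSpace.single j 1) 0)
        + pd 1 v (Ψ x) * (D x (EuclideanSpace.single j 1) 1) := by
      intro j
      rw [← pd_congr (h.eventually_eq hx') j, pd, hcomp.fderiv, ContinuousLinearMap.comp_apply,
        fderiv_apply_eq]
      ring
    have h0 := hrel 0
    have h1 := hrel 1
    rw [hDap, hDap] at h0 h1
    have e0 : ∀ i, fderiv ℝ (X i) x (EuclideanSpace.single 0 1) = pd 0 (X i) x := fun _ => rfl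
    have e1 : ∀ i, fderiv ℝ (X i) x (EuclideanSpace.single 1 1) = pd 1 (X i) x := fun _ => rfl
    rw [e0, e0] at h0
    rw [e1, e1] at h1
    simp at h0 h1
    congr 3
    rw [trQ, eq_div_iff (pow_pos (hJ x) 2).ne']
    simp only [trS, trJ, sq, qform, tsq, divg, jac]
    rw [h0, h1]
    ring
  · rintro x ⟨-, hx⟩
    have hx' : v (Ψ x) = 0 := by rw [hvΨ]; exact le_antisymm (not_lt.1 hx) (h.nonneg x)
    rw [density_of_zero F lam (fun y => h.nonneg (g y)) hx', hdet, abs_of_pos (hJ x), smul_eq_mul]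

/-- First and second inner variations along a compactly supported field. -/
theorem inner_variation (h : Minimizer F F' F'' c₀ C₀ lam u W) {X : Fin 2 → Plane → ℝ}
    (hX : ∀ i, ContDiff ℝ 1 (X i)) (hc : ∀ i, HasCompactSupport (X i)) :
    (∫ x in {y | 0 < u y}, ((F (sq W x) + lam ^ 2) * divg X x - 2 * F' (sq W x) * qform W X x))
      + F 0 * ∫ x in {y | 0 < u y}ᶜ, divg X x = 0 ∧
    0 ≤ (∫ x in {y | 0 < u y}, (F' (sq W x) * tsq W X x + 2 * F'' (sq W x) * qform W X x ^ 2
        + (F (sq W x) + lam ^ 2 - 2 * sq W x * F' (sq W x)) * jac X x))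
      + F 0 * ∫ x in {y | 0 < u y}ᶜ, jac X x := by
  have hfc := contDiff_field hX
  have hfs := hasCompactSupport_field hc
  obtain ⟨L, hL⟩ := ContDiff.lipschitzWith_of_hasCompactSupport hfs hfc (by simp)
  obtain ⟨R₁, hR₁⟩ := (hc 0).isCompact.isBounded.subset_ball (0 : Plane)
  obtain ⟨R₂, hR₂⟩ := (hc 1).isCompact.isBounded.subset_ball (0 : Plane)
  set R : ℝ := max 1 (max R₁ R₂) with hRdef
  have hR : 0 < R := lt_of_lt_of_le one_pos (le_max_left _ _)
  have hts : ∀ i, tsupport (X i) ⊆ ball (0 : Plane) R := by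
    intro i
    fin_cases i
    · exact hR₁.trans (ball_subset_ball ((le_max_left _ _).trans (le_max_right _ _)))
    · exact hR₂.trans (ball_subset_ball ((le_max_right _ _).trans (le_max_right _ _)))
  have hout : ∀ x ∉ ball (0 : Plane) R, ∀ i, X i x = 0 := fun x hx i =>
    image_eq_zero_of_notMem_tsupport fun hx' => hx (hts i hx')
  have hpout : ∀ x ∉ ball (0 : Plane) R, ∀ i j, pd j (X i) x = 0 := fun x hx i j =>
    pd_eq_zero_of_notMem_tsupport (fun hx' => hx (hts i hx')) j
  have hTc : Continuous (divg X) := (continuous_pd (hX 0) 0).add (continuous_pd (hX 1) 1)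
  have hdc : Continuous (jac X) := ((continuous_pd (hX 0) 0).mul (continuous_pd (hX 1) 1)).sub
    ((continuous_pd (hX 0) 1).mul (continuous_pd (hX 1) 0))
  have hTout : ∀ x ∉ ball (0 : Plane) R, divg X x = 0 := fun x hx => by
    simp [divg, hpout x hx]
  have hdout : ∀ x ∉ ball (0 : Plane) R, jac X x = 0 := fun x hx => by
    simp [jac, hpout x hx]
  obtain ⟨M₁, hM₁⟩ := (isCompact_closedBall (0 : Plane) R).exists_bound_of_continuousOn
    hTc.continuousOn
  obtain ⟨M₂, hM₂⟩ := (isCompact_closedBall (0 : Plane) R).exists_bound_of_continuousOn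
    hdc.continuousOn
  set M : ℝ := max 0 (max M₁ M₂) with hMdef
  have hM0 : 0 ≤ M := le_max_left _ _
  have hMT : ∀ x, |divg X x| ≤ M := by
    intro x
    by_cases hx : x ∈ ball (0 : Plane) R
    · exact (hM₁ x (ball_subset_closedBall hx)).trans
        ((le_max_left _ _).trans (le_max_right _ _))
    · rw [hTout x hx, abs_zero]; exact hM0
  have hMd : ∀ x, |jac X x| ≤ M := by
    intro x
    by_cases hx : x ∈ ball (0 : Plane) R
    · exact (hM₂ x (ball_subset_closedBall hx)).trans
        ((le_max_right _ _).trans (le_max_right _ _))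
    · rw [hdout x hx, abs_zero]; exact hM0
  set t₀ : ℝ := 1 / (4 * (M + L + 1)) with ht₀
  have hden : 0 < M + L + 1 := by positivity
  have ht₀pos : 0 < t₀ := by positivity
  have ht₀le : t₀ ≤ 1 := by
    rw [ht₀, div_le_one (by positivity)]
    have : (0 : ℝ) ≤ L := L.2
    linarith
  have ht₀M : t₀ * M ≤ 1 / 4 := by
    rw [ht₀, div_mul_eq_mul_div, div_le_div_iff₀ (by positivity) (by norm_num)]
    have : (0 : ℝ) ≤ L := L.2
    linarith
  have ht₀L : t₀ * L ≤ 1 / 2 := by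
    rw [ht₀, div_mul_eq_mul_div, div_le_div_iff₀ (by positivity) (by norm_num)]
    have : (0 : ℝ) ≤ L := L.2
    linarith
  have hJ : ∀ t ∈ Icc (-t₀) t₀, ∀ x, 0 < trJ (divg X x) (jac X x) t := by
    intro t ht x
    have ht' : |t| ≤ t₀ := abs_le.2 ht
    have h1 : |divg X x * t| ≤ 1 / 4 := by
      rw [abs_mul, mul_comm]
      calc |t| * |divg X x| ≤ t₀ * M := by gcongr; exact hMT x
        _ ≤ 1 / 4 := ht₀M
    have h2 : |jac X x * t ^ 2| ≤ 1 / 4 := by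
      rw [abs_mul, abs_pow, mul_comm]
      calc |t| ^ 2 * |jac X x| ≤ t₀ ^ 2 * M := by gcongr; exact hMd x
        _ = t₀ * (t₀ * M) := by ring
        _ ≤ 1 * (1 / 4) := by gcongr
        _ = 1 / 4 := by ring
    unfold trJ
    linarith [(abs_le.1 h1).1, (abs_le.1 h2).1]
  have hLip : ∀ t ∈ Icc (-t₀) t₀, ∀ x y,
      ‖t • field X x - t • field X y‖ ≤ 1 / 2 * ‖x - y‖ := by
    intro t ht x y
    have ht' : |t| ≤ t₀ := abs_le.2 ht
    rw [← smul_sub, norm_smul, Real.norm_eq_abs]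
    calc |t| * ‖field X x - field X y‖ ≤ t₀ * (L * ‖x - y‖) := by
          gcongr
          exact hL.norm_sub_le x y
      _ = (t₀ * L) * ‖x - y‖ := by ring
      _ ≤ 1 / 2 * ‖x - y‖ := by gcongr
  set a : Plane → ℝ := qform W X with ha
  set b : Plane → ℝ := tsq W X with hb
  set f : ℝ → Plane → ℝ := fun t x => trJ (divg X x) (jac X x) t *
    (F (trQ (divg X x) (jac X x) (sq W x) (a x) (b x) t) + lam ^ 2) with hf
  set f₁ : ℝ → Plane → ℝ := fun t x => (divg X x + 2 * jac X x * t) *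
      (F (trQ (divg X x) (jac X x) (sq W x) (a x) (b x) t) + lam ^ 2)
      + F' (trQ (divg X x) (jac X x) (sq W x) (a x) (b x) t)
        * trP (divg X x) (jac X x) (sq W x) (a x) (b x) t with hf₁
  set f₂ : ℝ → Plane → ℝ := fun t x => 2 * jac X x *
      (F (trQ (divg X x) (jac X x) (sq W x) (a x) (b x) t) + lam ^ 2)
      + (divg X x + 2 * jac X x * t) * (F' (trQ (divg X x) (jac X x) (sq W x) (a x) (b x) t)
        * (trP (divg X x) (jac X x) (sq W x) (a x) (b x) t / trJ (divg X x) (jac X x) t))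
      + (F'' (trQ (divg X x) (jac X x) (sq W x) (a x) (b x) t)
        * (trP (divg X x) (jac X x) (sq W x) (a x) (b x) t / trJ (divg X x) (jac X x) t)
        * trP (divg X x) (jac X x) (sq W x) (a x) (b x) t
      + F' (trQ (divg X x) (jac X x) (sq W x) (a x) (b x) t)
        * trP' (divg X x) (jac X x) (sq W x) (a x) (b x) t) with hf₂
  set k : ℝ → Plane → ℝ := fun t x => trJ (divg X x) (jac X x) t * F 0 with hk
  set k₁ : ℝ → Plane → ℝ := fun t x => (divg X x + 2 * jac X x * t) * F 0 with hk₁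
  set k₂ : ℝ → Plane → ℝ := fun _ x => 2 * jac X x * F 0 with hk₂
  set K : Set (ℝ × Plane) := Icc (-t₀) t₀ ×ˢ closedBall (0 : Plane) R with hK
  have hac : Continuous a := by
    have h0 := continuous_pd (hX 0)
    have h1 := continuous_pd (hX 1)
    have h2 := h.continuous_p
    rw [ha]; unfold qform
    fun_prop
  have hbc : Continuous b := by
    have h0 := continuous_pd (hX 0)
    have h1 := continuous_pd (hX 1)
    have h2 := h.continuous_p
    rw [hb]; unfold tsq
    fun_prop
  have hsc := h.continuous_sq
  have hFc := h.continuous_F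
  have hF'c := h.continuous_F'
  have hF''c := h.continuous''
  have hJc : ContinuousOn (fun q : ℝ × Plane => trJ (divg X q.2) (jac X q.2) q.1) K := by
    unfold trJ; fun_prop
  have hJ0 : ∀ q ∈ K, trJ (divg X q.2) (jac X q.2) q.1 ≠ 0 := fun q hq => (hJ q.1 hq.1 q.2).ne'
  have hSc : ContinuousOn (fun q : ℝ × Plane =>
      trS (divg X q.2) (sq W q.2) (a q.2) (b q.2) q.1) K := by
    unfold trS; fun_prop
  have hQc : ContinuousOn (fun q : ℝ × Plane =>
      trQ (divg X q.2) (jac X q.2) (sq W q.2) (a q.2) (b q.2) q.1) K :=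
    hSc.div (hJc.pow 2) fun q hq => pow_ne_zero 2 (hJ0 q hq)
  have hPc : ContinuousOn (fun q : ℝ × Plane =>
      trP (divg X q.2) (jac X q.2) (sq W q.2) (a q.2) (b q.2) q.1) K := by
    refine ContinuousOn.div ?_ (hJc.pow 2) fun q hq => pow_ne_zero 2 (hJ0 q hq)
    fun_prop
  have hP'c : ContinuousOn (fun q : ℝ × Plane =>
      trP' (divg X q.2) (jac X q.2) (sq W q.2) (a q.2) (b q.2) q.1) K := by
    refine ContinuousOn.sub (ContinuousOn.div ?_ (hJc.pow 2) fun q hq => pow_ne_zero 2 (hJ0 q hq))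
      (ContinuousOn.div ?_ hJc hJ0)
    · fun_prop
    · fun_prop
  have hFQ := hFc.comp_continuousOn hQc
  have hF'Q := hF'c.comp_continuousOn hQc
  have hF''Q := hF''c.comp_continuousOn hQc
  have hPJ := hPc.div hJc hJ0
  have hfcK : ContinuousOn (fun q : ℝ × Plane => f q.1 q.2) K := by
    simp only [Function.comp_def] at hFQ
    simp only [hf]
    fun_prop
  have hf₁cK : ContinuousOn (fun q : ℝ × Plane => f₁ q.1 q.2) K := by
    simp only [Function.comp_def] at hFQ hF'Q
    simp only [hf₁]
    fun_prop
  have hf₂cK : ContinuousOn (fun q : ℝ × Plane => f₂ q.1 q.2) K := by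
    have hlin : ContinuousOn (fun q : ℝ × Plane => divg X q.2 + 2 * jac X q.2 * q.1) K := by
      fun_prop
    have hlin' : ContinuousOn (fun q : ℝ × Plane => 2 * jac X q.2) K := by fun_prop
    exact ((hlin'.mul (hFQ.add continuousOn_const)).add (hlin.mul (hF'Q.mul hPJ))).add
      (((hF''Q.mul hPJ).mul hPc).add (hF'Q.mul hP'c))
  have hkcK : ContinuousOn (fun q : ℝ × Plane => k q.1 q.2) K := hJc.mul continuousOn_const
  have hk₁cK : ContinuousOn (fun q : ℝ × Plane => k₁ q.1 q.2) K := by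
    simp only [hk₁]; fun_prop
  have hk₂cK : ContinuousOn (fun q : ℝ × Plane => k₂ q.1 q.2) K := by
    simp only [hk₂]; fun_prop
  have hOm := h.isOpen.measurableSet
  have hBcl := isCompact_closedBall (0 : Plane) R
  have hsub₁ : ball (0 : Plane) R ∩ {y | 0 < u y} ⊆ closedBall 0 R :=
    inter_subset_left.trans ball_subset_closedBall
  have hsub₂ : ball (0 : Plane) R \ {y | 0 < u y} ⊆ closedBall 0 R :=
    sdiff_subset.trans ball_subset_closedBall
  have hm₁ : MeasurableSet (ball (0 : Plane) R ∩ {y | 0 < u y}) := measurableSet_ball.inter hOm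
  have hm₂ : MeasurableSet (ball (0 : Plane) R \ {y | 0 < u y}) := measurableSet_ball.diff hOm
  have hΦ₁ : ∀ t ∈ Ioo (-t₀) t₀, HasDerivAt
      (fun t => (∫ x in ball (0 : Plane) R ∩ {y | 0 < u y}, f t x)
        + ∫ x in ball (0 : Plane) R \ {y | 0 < u y}, k t x)
      ((∫ x in ball (0 : Plane) R ∩ {y | 0 < u y}, f₁ t x)
        + ∫ x in ball (0 : Plane) R \ {y | 0 < u y}, k₁ t x) t := fun t ht =>
    (hasDerivAt_setIntegral hm₁ hBcl hsub₁ hfcK hf₁cK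
      (fun τ hτ x _ => hasDerivAt_transported h.hasDerivAt _ _ _ _ (hJ τ hτ x).ne') ht).add
    (hasDerivAt_setIntegral hm₂ hBcl hsub₂ hkcK hk₁cK
      (fun τ _ x _ => (hasDerivAt_trJ _ _ _).mul_const _) ht)
  have h0mem : (0 : ℝ) ∈ Ioo (-t₀) t₀ := ⟨by linarith, ht₀pos⟩
  have hΦ₂ : HasDerivAt
      (fun t => (∫ x in ball (0 : Plane) R ∩ {y | 0 < u y}, f₁ t x)
        + ∫ x in ball (0 : Plane) R \ {y | 0 < u y}, k₁ t x)
      ((∫ x in ball (0 : Plane) R ∩ {y | 0 < u y}, f₂ 0 x)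
        + ∫ x in ball (0 : Plane) R \ {y | 0 < u y}, k₂ 0 x) 0 :=
    (hasDerivAt_setIntegral hm₁ hBcl hsub₁ hf₁cK hf₂cK
      (fun τ hτ x _ => hasDerivAt_transported_deriv h.hasDerivAt h.hasDerivAt' _ _ _ _
        (hJ τ hτ x).ne') h0mem).add
    (hasDerivAt_setIntegral hm₂ hBcl hsub₂ hk₁cK hk₂cK
      (fun τ _ x _ => by
        have := (((hasDerivAt_id τ).const_mul (2 * jac X x)).const_add (divg X x)).mul_const (F 0)
        simpa [hk₁, hk₂] using this) h0mem)
  have hQ0 : ∀ x, trQ (divg X x) (jac X x) (sq W x) (a x) (b x) 0 = sq W x := by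
    intro x; simp [trQ, trS, trJ]
  have hmin : ∀ t ∈ Ioo (-t₀) t₀,
      (∫ x in ball (0 : Plane) R ∩ {y | 0 < u y}, f 0 x)
        + ∫ x in ball (0 : Plane) R \ {y | 0 < u y}, k 0 x ≤
      (∫ x in ball (0 : Plane) R ∩ {y | 0 < u y}, f t x)
        + ∫ x in ball (0 : Plane) R \ {y | 0 < u y}, k t x := by
    intro t ht
    have ht' := Ioo_subset_Icc_self ht
    have hf0 : ∀ x, f 0 x = F (sq W x) + lam ^ 2 := fun x => by
      simp only [hf, hQ0]; simp [trJ]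
    have hk0 : ∀ x, k 0 x = F 0 := fun x => by simp [hk, trJ]
    simp_rw [hf0, hk0]
    exact h.transported_energy hX hR hout (hLip t ht') (hJ t ht')
  obtain ⟨hfirst, hsecond⟩ := second_order_necessary ht₀pos hΦ₁ hΦ₂ hmin
  have hf₁0 : ∀ x, f₁ 0 x = (F (sq W x) + lam ^ 2) * divg X x - 2 * F' (sq W x) * a x := fun x => by
    simp only [hf₁, hQ0]
    simp [trP, trS, trJ]; ring
  have hf₂0 : ∀ x, f₂ 0 x = 2 * (F' (sq W x) * b x + 2 * F'' (sq W x) * a x ^ 2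
      + (F (sq W x) + lam ^ 2 - 2 * sq W x * F' (sq W x)) * jac X x) := fun x => by
    simp only [hf₂, hQ0]
    simp [trP, trP', trS, trJ]; ring
  have hk₁0 : ∀ x, k₁ 0 x = F 0 * divg X x := fun x => by simp [hk₁]; ring
  have hk₂0 : ∀ x, k₂ 0 x = F 0 * (2 * jac X x) := fun x => by simp [hk₂]; ring
  have haout : ∀ x ∉ ball (0 : Plane) R, a x = 0 := fun x hx => by
    simp [ha, qform, hpout x hx]
  have hbout : ∀ x ∉ ball (0 : Plane) R, b x = 0 := fun x hx => by
    simp [hb, tsq, hpout x hx]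
  have hO : ∀ g : Plane → ℝ, (∀ x ∉ ball (0 : Plane) R, g x = 0) →
      ∫ x in {y | 0 < u y}, g x = ∫ x in ball (0 : Plane) R ∩ {y | 0 < u y}, g x := by
    intro g hg
    refine setIntegral_eq_of_subset_of_forall_sdiff_eq_zero hOm inter_subset_right ?_
    rintro x ⟨hx1, hx2⟩
    exact hg x fun hx => hx2 ⟨hx, hx1⟩
  have hOc : ∀ g : Plane → ℝ, (∀ x ∉ ball (0 : Plane) R, g x = 0) →
      ∫ x in {y | 0 < u y}ᶜ, g x = ∫ x in ball (0 : Plane) R \ {y | 0 < u y}, g x := by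
    intro g hg
    refine setIntegral_eq_of_subset_of_forall_sdiff_eq_zero hOm.compl (fun x hx => hx.2) ?_
    rintro x ⟨hx1, hx2⟩
    exact hg x fun hx => hx2 ⟨hx, hx1⟩
  simp_rw [hf₁0, hk₁0, integral_const_mul] at hfirst
  simp_rw [hf₂0, hk₂0, integral_const_mul] at hsecond
  rw [hO _ fun x hx => by simp [hTout x hx, haout x hx], hOc _ hTout,
    hO _ fun x hx => by simp [hdout x hx, haout x hx, hbout x hx], hOc _ hdout]
  exact ⟨hfirst, by linarith⟩

end Minimizer
theorem hasDerivAt_line {f : Plane → ℝ} (hf : Differentiable ℝ f) (x e : Plane) (τ : ℝ) :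
    HasDerivAt (fun τ : ℝ => f (x + τ • e)) (fderiv ℝ f (x + τ • e) e) τ := by
  have h1 : HasDerivAt (fun τ : ℝ => x + τ • e) e τ := by
    simpa using ((hasDerivAt_id τ).smul_const e).const_add x
  exact (hf (x + τ • e)).hasFDerivAt.comp_hasDerivAt τ h1

/-- A preconnected set meeting a set and its complement meets its frontier. -/
theorem inter_frontier_nonempty {S T : Set Plane} (hS : IsPreconnected S) {x y : Plane}
    (hx : x ∈ S) (hxT : x ∈ T) (hy : y ∈ S) (hyT : y ∉ T) : (S ∩ frontier T).Nonempty := by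
  by_contra hne
  have hout : ∀ z ∈ S, z ∉ frontier T := fun z hz hz' => hne ⟨z, hz, hz'⟩
  have hxi : x ∈ interior T := by
    by_contra hxi
    exact hout x hx ⟨subset_closure hxT, hxi⟩
  have hyc : y ∈ (closure T)ᶜ := fun hyc => hout y hy ⟨hyc, fun h => hyT (interior_subset h)⟩
  obtain ⟨z, -, hz1, hz2⟩ := hS (interior T) (closure T)ᶜ isOpen_interior
    isClosed_closure.isOpen_compl (fun z hz => by
      by_cases hzi : z ∈ interior T
      · exact Or.inl hzi
      · exact Or.inr fun hzc => hout z hz ⟨hzc, hzi⟩) ⟨x, hx, hxi⟩ ⟨y, hy, hyc⟩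
  exact hz2 (subset_closure (interior_subset hz1))

theorem exists_deriv_smoothTransition_bound :
    ∃ K, (∀ y, |deriv Real.smoothTransition y| ≤ K) ∧
      ∀ y, 1 < y → deriv Real.smoothTransition y = 0 := by
  have h1 : ∀ y, 1 < y → deriv Real.smoothTransition y = 0 := by
    intro y hy
    have : Real.smoothTransition =ᶠ[nhds y] fun _ => 1 := by
      filter_upwards [lt_mem_nhds hy] with z hz
      exact Real.smoothTransition.one_of_one_le hz.le
    rw [this.deriv_eq]; simp
  have h0 : ∀ y < 0, deriv Real.smoothTransition y = 0 := by
    intro y hy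
    have : Real.smoothTransition =ᶠ[nhds y] fun _ => 0 := by
      filter_upwards [gt_mem_nhds hy] with z hz
      exact Real.smoothTransition.zero_of_nonpos hz.le
    rw [this.deriv_eq]; simp
  have hc : Continuous (deriv Real.smoothTransition) :=
    (Real.smoothTransition.contDiff (n := 1)).continuous_deriv (by simp)
  obtain ⟨K, hK⟩ := isCompact_Icc.exists_bound_of_continuousOn (s := Icc (0 : ℝ) 1) hc.continuousOn
  have hK0 : 0 ≤ K := (norm_nonneg _).trans (hK 0 ⟨le_rfl, zero_le_one⟩)
  refine ⟨K, fun y => ?_, h1⟩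
  rcases lt_or_ge y 0 with hy | hy
  · rw [h0 y hy, abs_zero]; exact hK0
  rcases lt_or_ge 1 y with hy' | hy'
  · rw [h1 y hy', abs_zero]; exact hK0
  · exact hK y ⟨hy, hy'⟩

namespace Minimizer

variable {F F' F'' : ℝ → ℝ} {c₀ C₀ lam : ℝ} {u W : Plane → ℝ}

theorem u_eq_zero_of_frontier (h : Minimizer F F' F'' c₀ C₀ lam u W) {z : Plane}
    (hz : z ∈ frontier {y | 0 < u y}) : u z = 0 := by
  rw [h.isOpen.frontier_eq] at hz
  exact le_antisymm (not_lt.1 hz.2) (h.nonneg z)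

theorem W_eq_zero_of_frontier (h : Minimizer F F' F'' c₀ C₀ lam u W) {z : Plane}
    (hz : z ∈ frontier {y | 0 < u y}) : W z = 0 := by
  have h1 : EqOn W u (closure {y | 0 < u y}) :=
    EqOn.closure (fun x hx => h.eq_on x hx) h.smooth.continuous h.lip.continuous
  rw [h1 (frontier_subset_closure hz), h.u_eq_zero_of_frontier hz]

/-- A point near the free boundary is above a free boundary point, in the direction of the
gradient. -/
theorem exists_frontier_below (h : Minimizer F F' F'' c₀ C₀ lam u W) {z : Plane}
    (hz : z ∈ frontier {y | 0 < u y}) {k : Plane → ℝ} (hk : ContDiff ℝ 1 k)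
    (hk0 : ∀ y ∈ frontier {y | 0 < u y}, k y = 0) :
    ∃ C, ∃ N ∈ nhds z, ∀ x ∈ N, 0 < u x → |k x| ≤ C * u x := by
  set e : Plane := gradient W z with he
  have hen : ‖e‖ = 1 := by
    have h1 : ‖e‖ ^ 2 = 1 := by rw [he, norm_gradient_sq]; exact h.sq_eq_one z hz
    nlinarith [norm_nonneg e]
  have hWe : fderiv ℝ W z e = 1 := by
    rw [fderiv_apply_eq, he, gradient_apply, gradient_apply, ← h.sq_eq_one z hz, sq]
    ring
  have hW1 := smooth_of_le h.smooth
  have hcW : Continuous fun y => fderiv ℝ W y e := (hW1.continuous_fderiv (by simp)).clm_apply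
    continuous_const
  have hck : Continuous fun y => fderiv ℝ k y e := (hk.continuous_fderiv (by simp)).clm_apply
    continuous_const
  have hev1 : ∀ᶠ y in nhds z, 1 / 2 < fderiv ℝ W y e :=
    hcW.continuousAt.eventually_const_lt (by simp only [hWe]; norm_num)
  set M : ℝ := |fderiv ℝ k z e| + 1 with hM
  have hev2 : ∀ᶠ y in nhds z, |fderiv ℝ k y e| < M :=
    hck.abs.continuousAt.eventually_lt_const (by rw [hM]; linarith)
  obtain ⟨r, hr, hball⟩ := Metric.eventually_nhds_iff_ball.1 (hev1.and hev2)
  have hev3 : ∀ᶠ y in nhds z, W y < r / 4 :=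
    h.smooth.continuous.continuousAt.eventually_lt_const
      (by rw [h.W_eq_zero_of_frontier hz]; positivity)
  refine ⟨2 * M, ball z (r / 2) ∩ {y | W y < r / 4},
    Filter.inter_mem (ball_mem_nhds z (by positivity)) hev3, ?_⟩
  rintro x ⟨hx, hxW⟩ hux
  have hseg : ∀ τ ∈ Icc (-(r / 2)) 0, x + τ • e ∈ ball z r := by
    intro τ hτ
    rw [mem_ball, dist_eq_norm] at hx ⊢
    calc ‖x + τ • e - z‖ = ‖(x - z) + τ • e‖ := by congr 1; abel
      _ ≤ ‖x - z‖ + ‖τ • e‖ := norm_add_le _ _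
      _ < r / 2 + r / 2 := by
        rw [norm_smul, hen, mul_one, Real.norm_eq_abs]
        have : |τ| ≤ r / 2 := abs_le.2 ⟨hτ.1, by linarith [hτ.2]⟩
        linarith
      _ = r := by ring
  have hWm : ∀ τ ∈ Icc (-(r / 2)) 0, W (x + τ • e) ≤ W x + τ / 2 := by
    intro τ hτ
    rcases hτ.2.eq_or_lt with rfl | hlt
    · simp
    obtain ⟨ξ, hξ, hξ'⟩ := exists_hasDerivAt_eq_slope (fun τ : ℝ => W (x + τ • e)) _ hlt
      (fun y _ => (hasDerivAt_line h.W_differentiable x e y).continuousAt.continuousWithinAt)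
      (fun y _ => hasDerivAt_line h.W_differentiable x e y)
    have h1 := (hball _ (hseg ξ ⟨hτ.1.trans hξ.1.le, hξ.2.le⟩)).1
    rw [hξ', lt_div_iff₀ (by linarith)] at h1
    simp at h1
    linarith
  have hkm : ∀ τ ∈ Icc (-(r / 2)) 0, |k x - k (x + τ • e)| ≤ M * (-τ) := by
    intro τ hτ
    rcases hτ.2.eq_or_lt with rfl | hlt
    · simp
    have hkd := hk.differentiable (by simp)
    obtain ⟨ξ, hξ, hξ'⟩ := exists_hasDerivAt_eq_slope (fun τ : ℝ => k (x + τ • e)) _ hlt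
      (fun y _ => (hasDerivAt_line hkd x e y).continuousAt.continuousWithinAt)
      (fun y _ => hasDerivAt_line hkd x e y)
    have h1 := (hball _ (hseg ξ ⟨hτ.1.trans hξ.1.le, hξ.2.le⟩)).2.le
    rw [hξ', abs_div, abs_of_pos (by linarith : (0 : ℝ) < 0 - τ), div_le_iff₀ (by linarith)] at h1
    simpa using h1
  have hex : ∃ τ ∈ Icc (-(r / 2)) 0, x + τ • e ∈ frontier {y | 0 < u y} := by
    have hpre : IsPreconnected ((fun τ : ℝ => x + τ • e) '' Icc (-(r / 2)) 0) :=
      isPreconnected_Icc.image _ (by fun_prop)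
    have hmem0 : (0 : ℝ) ∈ Icc (-(r / 2)) 0 := ⟨by linarith, le_rfl⟩
    have hmem1 : -(r / 2) ∈ Icc (-(r / 2)) 0 := ⟨le_rfl, by linarith⟩
    obtain ⟨y, ⟨τ, hτ, rfl⟩, hy⟩ := inter_frontier_nonempty hpre (T := {y | 0 < u y})
      (x := x) (y := x + (-(r / 2)) • e) ⟨0, hmem0, by simp⟩ hux ⟨_, hmem1, rfl⟩ (fun hpos => by
        have h1 := hWm _ hmem1
        have h2 := h.W_pos hpos
        simp only [mem_ofPred_eq] at hxW
        linarith)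
    exact ⟨τ, hτ, hy⟩
  obtain ⟨τ, hτ, hy⟩ := hex
  have h1 := hWm τ hτ
  rw [h.W_eq_zero_of_frontier hy, h.eq_on x hux] at h1
  have h2 := hkm τ hτ
  rw [hk0 _ hy, sub_zero] at h2
  have hM0 : 0 ≤ M := by positivity
  nlinarith

/-- A smooth function vanishing on the free boundary is locally controlled by `u`. -/
theorem exists_bound_of_vanishing (h : Minimizer F F' F'' c₀ C₀ lam u W) {k : Plane → ℝ}
    (hk : ContDiff ℝ 1 k) (hk0 : ∀ y ∈ frontier {y | 0 < u y}, k y = 0) {K : Set Plane}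
    (hK : IsCompact K) : ∃ C, ∀ x ∈ K, 0 < u x → |k x| ≤ C * u x := by
  refine hK.induction_on (p := fun S => ∃ C, ∀ x ∈ S, 0 < u x → |k x| ≤ C * u x) ⟨0, by simp⟩
    ?_ ?_ ?_
  · rintro S T hST ⟨C, hC⟩
    exact ⟨C, fun x hx => hC x (hST hx)⟩
  · rintro S T ⟨C, hC⟩ ⟨C', hC'⟩
    refine ⟨max C C', ?_⟩
    rintro x (hx | hx) hux
    · exact (hC x hx hux).trans (by gcongr; exact le_max_left _ _)
    · exact (hC' x hx hux).trans (by gcongr; exact le_max_right _ _)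
  · intro z _
    suffices ∃ C, ∃ N ∈ nhds z, ∀ x ∈ N, 0 < u x → |k x| ≤ C * u x by
      obtain ⟨C, N, hN, hC⟩ := this
      exact ⟨N, mem_nhdsWithin_of_mem_nhds hN, C, hC⟩
    by_cases hz : z ∈ frontier {y | 0 < u y}
    · exact h.exists_frontier_below hz hk hk0
    by_cases hz' : 0 < u z
    · refine ⟨(|k z| + 1) / (u z / 2), {y | u z / 2 < u y} ∩ {y | |k y| < |k z| + 1},
        Filter.inter_mem
          (h.lip.continuous.continuousAt.eventually_const_lt (by linarith))
          (hk.continuous.abs.continuousAt.eventually_lt_const (by linarith)), ?_⟩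
      rintro x ⟨hx1, hx2⟩ -
      simp only [mem_ofPred_eq] at hx1 hx2
      rw [div_mul_eq_mul_div, le_div_iff₀ (by positivity)]
      have : 0 ≤ |k x| := abs_nonneg _
      nlinarith
    · refine ⟨0, (closure {y | 0 < u y})ᶜ, isClosed_closure.isOpen_compl.mem_nhds ?_, ?_⟩
      · intro hcl
        exact hz (by rw [h.isOpen.frontier_eq]; exact ⟨hcl, hz'⟩)
      · intro x hx hux
        exact absurd (subset_closure (s := {y | 0 < u y}) hux) hx

/-- The divergence theorem in the positivity set, for fields whose normal component vanishes on the
free boundary to first order. -/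
theorem setIntegral_divg (h : Minimizer F F' F'' c₀ C₀ lam u W) {Z : Fin 2 → Plane → ℝ}
    (hZ : ∀ i, ContDiff ℝ 1 (Z i)) (hc : ∀ i, HasCompactSupport (Z i)) {C : ℝ}
    (hC : ∀ x, 0 < u x → |Z 0 x * pd 0 W x + Z 1 x * pd 1 W x| ≤ C * u x) :
    ∫ x in {y | 0 < u y}, divg Z x = 0 := by
  obtain ⟨K, hK0, hK1⟩ := exists_deriv_smoothTransition_bound
  set χ : ℕ → Plane → ℝ := fun n x => Real.smoothTransition (u x * (n + 1) - 1) with hχ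
  have hχ0 : ∀ n x, u x = 0 → χ n =ᶠ[nhds x] fun _ => 0 := by
    intro n x hx
    have hcont : Continuous fun y => u y * (n + 1) - 1 := by
      have := h.lip.continuous
      fun_prop
    have hlt : (fun y => u y * (n + 1) - 1) x < 0 := by simp [hx]
    filter_upwards [hcont.continuousAt.eventually_lt_const hlt] with y hy
    exact Real.smoothTransition.zero_of_nonpos hy.le
  have hχ1 : ∀ n x, 0 < u x →
      χ n =ᶠ[nhds x] fun y => Real.smoothTransition (W y * (n + 1) - 1) := by
    intro n x hx
    filter_upwards [h.eventually_eq hx] with y hy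
    simp only [hχ, hy]
  have hT : ContDiff ℝ 1 Real.smoothTransition := Real.smoothTransition.contDiff (n := 1)
  have hW1 := smooth_of_le h.smooth
  have hin : ∀ n : ℕ, ContDiff ℝ 1 fun y => W y * (n + 1) - 1 := fun n =>
    (hW1.mul contDiff_const).sub contDiff_const
  have hχc : ∀ n, ContDiff ℝ 1 (χ n) := by
    intro n
    rw [contDiff_iff_contDiffAt]
    intro x
    rcases (h.nonneg x).eq_or_lt with hx | hx
    · exact contDiffAt_const.congr_of_eventuallyEq (hχ0 n x hx.symm)
    · exact (hT.comp (hin n)).contDiffAt.congr_of_eventuallyEq (hχ1 n x hx)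
  set Y : ℕ → Fin 2 → Plane → ℝ := fun n i x => χ n x * Z i x with hY
  have hYc : ∀ n i, ContDiff ℝ 1 (Y n i) := fun n i => (hχc n).mul (hZ i)
  have hYs : ∀ n i, HasCompactSupport (Y n i) := fun n i => (hc i).mul_left
  have hzero : ∀ n, ∫ x in {y | 0 < u y}, divg (Y n) x = 0 := by
    intro n
    rw [setIntegral_eq_integral_of_forall_compl_eq_zero]
    · have hinteg : ∀ i, Integrable (pd i (Y n i)) := fun i =>
        integrable_of_cs (continuous_pd (hYc n i) i) (hasCompactSupport_pd (hYs n i) i)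
      simp only [divg]
      rw [integral_add (hinteg 0) (hinteg 1), integral_pd (hYc n 0) (hYs n 0),
        integral_pd (hYc n 1) (hYs n 1), add_zero]
    · intro x hx
      have hx' : u x = 0 := le_antisymm (not_lt.1 hx) (h.nonneg x)
      have hev : ∀ i, Y n i =ᶠ[nhds x] fun _ => 0 := by
        intro i
        filter_upwards [hχ0 n x hx'] with y hy
        simp [hY, hy]
      rw [divg, pd_congr (hev 0), pd_congr (hev 1), pd_const, pd_const, add_zero]
  have hdiv : ∀ n x, 0 < u x → divg (Y n) x = χ n x * divg Z x
      + deriv Real.smoothTransition (u x * (n + 1) - 1) * (n + 1)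
        * (Z 0 x * pd 0 W x + Z 1 x * pd 1 W x) := by
    intro n x hx
    have hχd : DifferentiableAt ℝ (χ n) x := (hχc n).differentiable (by simp) x
    have hZd : ∀ i, DifferentiableAt ℝ (Z i) x := fun i => (hZ i).differentiable (by simp) x
    have hWd := h.W_differentiable x
    have hpχ : ∀ i, pd i (χ n) x
        = deriv Real.smoothTransition (u x * (n + 1) - 1) * ((n + 1) * pd i W x) := by
      intro i
      rw [pd_congr (hχ1 n x hx), pd_comp (g := Real.smoothTransition)
        (hT.differentiable (by simp) _).hasDerivAt ((hin n).differentiable (by simp) x),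
        pd_sub (hWd.mul_const _) (differentiableAt_const _), pd_const,
        pd_mul hWd (differentiableAt_const _), pd_const, h.eq_on x hx]
      ring
    simp only [divg, hY]
    rw [pd_mul hχd (hZd 0), pd_mul hχd (hZd 1), hpχ, hpχ]
    ring
  obtain ⟨R₁, hR₁⟩ := (hc 0).isCompact.isBounded.subset_closedBall (0 : Plane)
  obtain ⟨R₂, hR₂⟩ := (hc 1).isCompact.isBounded.subset_closedBall (0 : Plane)
  set B : Set Plane := closedBall 0 R₁ ∪ closedBall 0 R₂ with hB
  have hBc : IsCompact B := (isCompact_closedBall _ _).union (isCompact_closedBall _ _)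
  have hZB : ∀ x ∉ B, Z 0 x = 0 ∧ Z 1 x = 0 := by
    intro x hx
    exact ⟨image_eq_zero_of_notMem_tsupport fun hx' => hx (Or.inl (hR₁ hx')),
      image_eq_zero_of_notMem_tsupport fun hx' => hx (Or.inr (hR₂ hx'))⟩
  have hdZ : Continuous (divg Z) := (continuous_pd (hZ 0) 0).add (continuous_pd (hZ 1) 1)
  have hdZi : Integrable (divg Z) :=
    (integrable_of_cs (continuous_pd (hZ 0) 0) (hasCompactSupport_pd (hc 0) 0)).add
      (integrable_of_cs (continuous_pd (hZ 1) 1) (hasCompactSupport_pd (hc 1) 1))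
  set bound : Plane → ℝ := fun x => |divg Z x| + B.indicator (fun _ => 2 * K * |C|) x with hbound
  have hlim : Filter.Tendsto (fun n => ∫ x in {y | 0 < u y}, divg (Y n) x) Filter.atTop
      (nhds (∫ x in {y | 0 < u y}, divg Z x)) := by
    refine tendsto_integral_of_dominated_convergence bound ?_ ?_ ?_ ?_
    · intro n
      exact ((continuous_pd (hYc n 0) 0).add (continuous_pd (hYc n 1) 1)).aestronglyMeasurable
    · refine Integrable.restrict (hdZi.abs.add ?_)
      rw [integrable_indicator_iff hBc.measurableSet]
      exact integrableOn_const hBc.measure_lt_top.ne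
    · intro n
      filter_upwards [ae_restrict_mem h.isOpen.measurableSet] with x hx
      have hx' : 0 < u x := hx
      rw [hdiv n x hx', hbound, Real.norm_eq_abs]
      refine (abs_add_le _ _).trans (add_le_add ?_ ?_)
      · rw [abs_mul, abs_of_nonneg (Real.smoothTransition.nonneg _)]
        exact mul_le_of_le_one_left (abs_nonneg _) (Real.smoothTransition.le_one _)
      · by_cases hxB : x ∈ B
        · rw [indicator_of_mem hxB]
          have hn : (0 : ℝ) < n + 1 := by positivity
          by_cases hle : u x * (n + 1) ≤ 2
          · rw [abs_mul, abs_mul, abs_of_pos hn]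
            calc |deriv Real.smoothTransition (u x * (n + 1) - 1)| * (n + 1)
                  * |Z 0 x * pd 0 W x + Z 1 x * pd 1 W x|
                ≤ K * (n + 1) * (|C| * u x) := by
                  have : 0 ≤ K := (abs_nonneg _).trans (hK0 0)
                  gcongr
                  · exact hK0 _
                  · exact (hC x hx').trans (mul_le_mul_of_nonneg_right (le_abs_self C) hx'.le)
              _ = K * |C| * (u x * (n + 1)) := by ring
              _ ≤ K * |C| * 2 := by
                  have : 0 ≤ K := (abs_nonneg _).trans (hK0 0)
                  gcongr
              _ = 2 * K * |C| := by ring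
          · rw [hK1 _ (by linarith)]
            have : 0 ≤ K := (abs_nonneg _).trans (hK0 0)
            simp only [zero_mul, abs_zero]
            positivity
        · rw [indicator_of_notMem hxB, (hZB x hxB).1, (hZB x hxB).2]
          simp
    · filter_upwards [ae_restrict_mem h.isOpen.measurableSet] with x hx
      have hx' : 0 < u x := hx
      refine tendsto_const_nhds.congr' ?_
      obtain ⟨N, hN⟩ := exists_nat_gt (2 / u x)
      filter_upwards [Filter.eventually_ge_atTop N] with n hn
      have h2 : 2 < u x * (n + 1) := by
        rw [div_lt_iff₀ hx'] at hN
        have : (N : ℝ) ≤ n := by exact_mod_cast hn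
        nlinarith
      rw [hdiv n x hx', hK1 _ (by linarith)]
      simp only [hχ]
      rw [Real.smoothTransition.one_of_one_le (by linarith)]
      ring
  simp_rw [hzero] at hlim
  exact tendsto_nhds_unique hlim tendsto_const_nhds

end Minimizer
/-- A potential field whose divergence is the Jacobian determinant of `X`. -/
noncomputable def jacPot (X : Fin 2 → Plane → ℝ) : Fin 2 → Plane → ℝ :=
  ![fun x => 1 / 2 * (X 0 x * pd 1 (X 1) x - X 1 x * pd 1 (X 0) x),
    fun x => 1 / 2 * (X 1 x * pd 0 (X 0) x - X 0 x * pd 0 (X 1) x)]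

theorem jacPot_zero (X : Fin 2 → Plane → ℝ) (x : Plane) :
    jacPot X 0 x = 1 / 2 * (X 0 x * pd 1 (X 1) x - X 1 x * pd 1 (X 0) x) := rfl

theorem jacPot_one (X : Fin 2 → Plane → ℝ) (x : Plane) :
    jacPot X 1 x = 1 / 2 * (X 1 x * pd 0 (X 0) x - X 0 x * pd 0 (X 1) x) := rfl

theorem contDiff_jacPot {X : Fin 2 → Plane → ℝ} (hX : ∀ i, ContDiff ℝ (⊤ : ℕ∞) (X i)) (i : Fin 2) :
    ContDiff ℝ 1 (jacPot X i) := by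
  refine smooth_of_le ?_
  fin_cases i
  · exact contDiff_const.mul (((hX 0).mul (contDiff_pd (hX 1) 1)).sub
      ((hX 1).mul (contDiff_pd (hX 0) 1)))
  · exact contDiff_const.mul (((hX 1).mul (contDiff_pd (hX 0) 0)).sub
      ((hX 0).mul (contDiff_pd (hX 1) 0)))

theorem hasCompactSupport_jacPot {X : Fin 2 → Plane → ℝ} (hc : ∀ i, HasCompactSupport (X i))
    (i : Fin 2) : HasCompactSupport (jacPot X i) := by
  fin_cases i
  · exact HasCompactSupport.mul_left (f := fun _ => (1 / 2 : ℝ))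
      ((hc 0).mul_right.sub (hc 1).mul_right)
  · exact HasCompactSupport.mul_left (f := fun _ => (1 / 2 : ℝ))
      ((hc 1).mul_right.sub (hc 0).mul_right)

theorem divg_jacPot {X : Fin 2 → Plane → ℝ} (hX : ∀ i, ContDiff ℝ (⊤ : ℕ∞) (X i)) (x : Plane) :
    divg (jacPot X) x = jac X x := by
  have hd : ∀ i, DifferentiableAt ℝ (X i) x := fun i => (hX i).differentiable (by simp) x
  have hdd : ∀ i j, DifferentiableAt ℝ (pd j (X i)) x := fun i j =>
    (contDiff_pd (hX i) j).differentiable (by simp) x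
  have h0 : jacPot X 0 = fun x => 1 / 2 * (X 0 x * pd 1 (X 1) x - X 1 x * pd 1 (X 0) x) := rfl
  have h1 : jacPot X 1 = fun x => 1 / 2 * (X 1 x * pd 0 (X 0) x - X 0 x * pd 0 (X 1) x) := rfl
  rw [divg, h0, h1, pd_const_mul _ (((hd 0).fun_mul (hdd 1 1)).fun_sub ((hd 1).fun_mul (hdd 0 1))),
    pd_const_mul _ (((hd 1).fun_mul (hdd 0 0)).fun_sub ((hd 0).fun_mul (hdd 1 0))),
    pd_sub ((hd 0).fun_mul (hdd 1 1)) ((hd 1).fun_mul (hdd 0 1)),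
    pd_sub ((hd 1).fun_mul (hdd 0 0)) ((hd 0).fun_mul (hdd 1 0)),
    pd_mul (hd 0) (hdd 1 1), pd_mul (hd 1) (hdd 0 1), pd_mul (hd 1) (hdd 0 0),
    pd_mul (hd 0) (hdd 1 0), pd_comm (hX 0), pd_comm (hX 1), jac]
  ring

namespace Minimizer

variable {F F' F'' : ℝ → ℝ} {c₀ C₀ lam : ℝ} {u W : Plane → ℝ}

/-- The divergence theorem in the positivity set for fields tangent to the free boundary. -/
theorem setIntegral_divg_of_tangent (h : Minimizer F F' F'' c₀ C₀ lam u W)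
    {Z : Fin 2 → Plane → ℝ} (hZ : ∀ i, ContDiff ℝ 1 (Z i)) (hc : ∀ i, HasCompactSupport (Z i))
    (ht : ∀ x ∈ frontier {y | 0 < u y}, Z 0 x * pd 0 W x + Z 1 x * pd 1 W x = 0) :
    ∫ x in {y | 0 < u y}, divg Z x = 0 := by
  have hk : ContDiff ℝ 1 fun x => Z 0 x * pd 0 W x + Z 1 x * pd 1 W x :=
    ((hZ 0).mul (smooth_of_le (h.contDiff_p 0))).add ((hZ 1).mul (smooth_of_le (h.contDiff_p 1)))
  obtain ⟨C, hC⟩ := h.exists_bound_of_vanishing hk ht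
    ((hc 0).isCompact.union (hc 1).isCompact)
  refine h.setIntegral_divg hZ hc (C := |C|) fun x hx => ?_
  by_cases hxK : x ∈ tsupport (Z 0) ∪ tsupport (Z 1)
  · exact (hC x hxK hx).trans (mul_le_mul_of_nonneg_right (le_abs_self C) hx.le)
  · rw [mem_union, not_or] at hxK
    rw [image_eq_zero_of_notMem_tsupport hxK.1, image_eq_zero_of_notMem_tsupport hxK.2]
    simp only [zero_mul, add_zero, abs_zero]
    positivity

theorem pd_F_sq (h : Minimizer F F' F'' c₀ C₀ lam u W) (i : Fin 2) (x : Plane) :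
    pd i (fun x => F (sq W x)) x = F' (sq W x) * pd i (sq W) x :=
  pd_comp (h.hasDerivAt _) (h.contDiff_sq.differentiable (by simp) x) i

theorem contDiff_F_sq (h : Minimizer F F' F'' c₀ C₀ lam u W) :
    ContDiff ℝ 1 fun x => F (sq W x) := h.contDiff_F.comp (smooth_of_le h.contDiff_sq)

/-- The energy of the null set does not contribute to the first inner variation. -/
theorem F_zero_mul_divg (h : Minimizer F F' F'' c₀ C₀ lam u W)
    {Y : Fin 2 → Plane → ℝ} (hY : ∀ i, ContDiff ℝ 1 (Y i)) (hc : ∀ i, HasCompactSupport (Y i)) :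
    F 0 * ∫ x in {y | 0 < u y}ᶜ, divg Y x = 0 := by
  have h1 := (h.inner_variation hY hc).1
  set g : Plane → ℝ := fun x => Y 0 x * pd 0 W x + Y 1 x * pd 1 W x with hg
  set Z : Fin 2 → Plane → ℝ := fun i x =>
    (F (sq W x) + lam ^ 2) * Y i x - 2 * (g x * (F' (sq W x) * pd i W x)) with hZ
  have hp1 : ∀ i, ContDiff ℝ 1 (pd i W) := fun i => smooth_of_le (h.contDiff_p i)
  have hgc : ContDiff ℝ 1 g := ((hY 0).mul (hp1 0)).add ((hY 1).mul (hp1 1))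
  have hFl : ContDiff ℝ 1 fun x => F (sq W x) + lam ^ 2 := h.contDiff_F_sq.add contDiff_const
  have hFp : ∀ i, ContDiff ℝ 1 fun x => F' (sq W x) * pd i W x := fun i =>
    h.contDiff_F'_sq.mul (hp1 i)
  have hZc : ∀ i, ContDiff ℝ 1 (Z i) := fun i =>
    (hFl.mul (hY i)).sub (contDiff_const.mul (hgc.mul (hFp i)))
  have hgs : HasCompactSupport g := (hc 0).mul_right.add (hc 1).mul_right
  have hZs : ∀ i, HasCompactSupport (Z i) := fun i =>
    (hc i).mul_left.sub (HasCompactSupport.mul_left (f := fun _ => (2 : ℝ)) hgs.mul_right)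
  have h2 := h.setIntegral_divg_of_tangent hZc hZs fun x hx => by
    have hs := h.sq_eq_one x hx
    have hs' : pd 0 W x ^ 2 + pd 1 W x ^ 2 = 1 := hs
    have e : Z 0 x * pd 0 W x + Z 1 x * pd 1 W x
        = g x * (F (sq W x) + lam ^ 2 - 2 * F' (sq W x) * (pd 0 W x ^ 2 + pd 1 W x ^ 2)) := by
      simp only [hZ, hg]; ring
    rw [e, hs', hs, h.lam_sq]
    ring
  have h3 : ∫ x in {y | 0 < u y},
        ((F (sq W x) + lam ^ 2) * divg Y x - 2 * F' (sq W x) * qform W Y x)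
      = ∫ x in {y | 0 < u y}, divg Z x := by
    refine setIntegral_congr_fun h.isOpen.measurableSet fun x hx => ?_
    have hEL := h.euler_lagrange hx
    have dY : ∀ i, DifferentiableAt ℝ (Y i) x := fun i => (hY i).differentiable (by simp) x
    have dp : ∀ i, DifferentiableAt ℝ (pd i W) x := fun i => (hp1 i).differentiable (by simp) x
    have dg := hgc.differentiable (by simp) x
    have dFl := hFl.differentiable (by simp) x
    have dF := h.contDiff_F_sq.differentiable (by simp) x
    have dF' := h.contDiff_F'_sq.differentiable (by simp) x
    have dFp : ∀ i, DifferentiableAt ℝ (fun x => F' (sq W x) * pd i W x) x :=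
      fun i => (hFp i).differentiable (by simp) x
    have hgp : ∀ i, pd i g x = pd i (Y 0) x * pd 0 W x + Y 0 x * pd i (pd 0 W) x
        + (pd i (Y 1) x * pd 1 W x + Y 1 x * pd i (pd 1 W) x) := by
      intro i
      rw [hg, pd_add ((dY 0).fun_mul (dp 0)) ((dY 1).fun_mul (dp 1)), pd_mul (dY 0) (dp 0),
        pd_mul (dY 1) (dp 1)]
    have hZp : ∀ i, pd i (Z i) x = F' (sq W x) * pd i (sq W) x * Y i x
        + (F (sq W x) + lam ^ 2) * pd i (Y i) x
        - 2 * (pd i g x * (F' (sq W x) * pd i W x)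
          + g x * (F'' (sq W x) * pd i (sq W) x * pd i W x
            + F' (sq W x) * pd i (pd i W) x)) := by
      intro i
      rw [hZ, pd_sub (dFl.fun_mul (dY i)) ((differentiableAt_const _).fun_mul (dg.fun_mul (dFp i))),
        pd_const_mul _ (dg.fun_mul (dFp i)), pd_mul dFl (dY i), pd_mul dg (dFp i),
        pd_mul dF' (dp i), pd_add dF (differentiableAt_const _), pd_const, h.pd_F_sq, h.pd_F'_sq,
        add_zero]
    simp only [divg, hZp, hgp, h.pd_sq_grad, pd_comm h.smooth, qform]
    linear_combination 2 * g x * hEL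
  rw [h3, h2, zero_add] at h1
  exact h1

/-- The null Lagrangian term in the second inner variation, for a general field. -/
theorem setIntegral_mul_jac (h : Minimizer F F' F'' c₀ C₀ lam u W)
    {X : Fin 2 → Plane → ℝ} (hX : ∀ i, ContDiff ℝ (⊤ : ℕ∞) (X i))
    (hc : ∀ i, HasCompactSupport (X i)) :
    ∫ x in {y | 0 < u y}, (F (sq W x) + lam ^ 2 - 2 * sq W x * F' (sq W x)) * jac X x =
      ∫ x in {y | 0 < u y}, (F' (sq W x) + 2 * sq W x * F'' (sq W x)) *
        (pd 0 (sq W) x * jacPot X 0 x + pd 1 (sq W) x * jacPot X 1 x) := by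
  have hs1 : ContDiff ℝ 1 (sq W) := smooth_of_le h.contDiff_sq
  have hY := contDiff_jacPot hX
  have hYs := hasCompactSupport_jacPot hc
  set k : Plane → ℝ := fun x => F (sq W x) + lam ^ 2 - 2 * (sq W x * F' (sq W x)) with hk
  have hkc : ContDiff ℝ 1 k :=
    (h.contDiff_F_sq.add contDiff_const).sub (contDiff_const.mul (hs1.mul h.contDiff_F'_sq))
  set Z : Fin 2 → Plane → ℝ := fun i x => k x * jacPot X i x with hZ
  have h1 := h.setIntegral_divg_of_tangent (Z := Z) (fun i => hkc.mul (hY i))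
    (fun i => (hYs i).mul_left) fun x hx => by
      have hk0 : k x = 0 := by
        simp only [hk]
        rw [h.sq_eq_one x hx, h.lam_sq]
        ring
      simp only [hZ, hk0]
      ring
  have hpk : ∀ i x, pd i k x = -(F' (sq W x) + 2 * sq W x * F'' (sq W x)) * pd i (sq W) x := by
    intro i x
    have ds := hs1.differentiable (by simp) x
    have dF := h.contDiff_F_sq.differentiable (by simp) x
    have dF' := h.contDiff_F'_sq.differentiable (by simp) x
    rw [hk, pd_sub (dF.fun_add (differentiableAt_const _))
      ((differentiableAt_const _).fun_mul (ds.fun_mul dF')), pd_const_mul _ (ds.fun_mul dF'),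
      pd_add dF (differentiableAt_const _), pd_const, pd_mul ds dF', h.pd_F_sq, h.pd_F'_sq]
    ring
  have hdivZ : ∀ x, divg Z x
      = (F (sq W x) + lam ^ 2 - 2 * sq W x * F' (sq W x)) * jac X x
        - (F' (sq W x) + 2 * sq W x * F'' (sq W x)) *
        (pd 0 (sq W) x * jacPot X 0 x + pd 1 (sq W) x * jacPot X 1 x) := by
    intro x
    have dk := hkc.differentiable (by simp) x
    have dY : ∀ i, DifferentiableAt ℝ (jacPot X i) x := fun i => (hY i).differentiable (by simp) x
    rw [divg, hZ, pd_mul dk (dY 0), pd_mul dk (dY 1), hpk, hpk, ← divg_jacPot hX, divg]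
    simp only [hk]
    ring
  simp_rw [hdivZ] at h1
  have hjc : Continuous (jac X) := by
    have := fun i j => continuous_pd (smooth_of_le (hX i)) j
    unfold jac
    fun_prop
  have hjs : HasCompactSupport (jac X) :=
    (hasCompactSupport_pd (hc 0) 0).mul_right.sub (hasCompactSupport_pd (hc 0) 1).mul_right
  have hsc := h.continuous_sq
  have hF' := h.continuous_F'
  have hF := h.continuous_F
  have hF2 := h.continuous''
  rw [integral_sub, sub_eq_zero] at h1
  · exact h1
  · refine (integrable_of_cs ?_ hjs.mul_left).restrict
    fun_prop
  · have hps := fun i => continuous_pd hs1 i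
    have hYc := fun i => (hY i).continuous
    refine (integrable_of_cs ?_ (HasCompactSupport.mul_left
      ((hYs 0).mul_left.add (hYs 1).mul_left))).restrict
    fun_prop

end Minimizer
/-- The squared length of the Hessian applied to the rotated gradient. -/
noncomputable def tanSq (W : Plane → ℝ) (x : Plane) : ℝ :=
  (pd 0 W x * pd 0 (pd 1 W) x - pd 1 W x * pd 0 (pd 0 W) x) ^ 2
    + (pd 0 W x * pd 1 (pd 1 W) x - pd 1 W x * pd 0 (pd 1 W) x) ^ 2

/-- The squared Frobenius norm of the Hessian. -/
noncomputable def hessSq (W : Plane → ℝ) (x : Plane) : ℝ :=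
  pd 0 (pd 0 W) x ^ 2 + 2 * pd 0 (pd 1 W) x ^ 2 + pd 1 (pd 1 W) x ^ 2

/-- A pointwise consequence of ellipticity: the determinant of the Hessian controls the tangential
part of the Hessian. -/
theorem det_hess_le {f f' c p₀ p₁ a b d : ℝ} (hc : c ≤ f) (hf' : 0 ≤ f')
    (hEL : f * (a + d) + 2 * f' * (p₀ ^ 2 * a + 2 * p₀ * p₁ * b + p₁ ^ 2 * d) = 0) :
    (f + 2 * (p₀ ^ 2 + p₁ ^ 2) * f') * ((p₀ ^ 2 + p₁ ^ 2) * (a * d - b ^ 2)) ≤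
      -c * ((p₀ * b - p₁ * a) ^ 2 + (p₀ * d - p₁ * b) ^ 2) := by
  set s := p₀ ^ 2 + p₁ ^ 2 with hs
  rcases (by positivity : 0 ≤ s).eq_or_lt with h0 | hpos
  · have h1 : p₀ = 0 := by nlinarith
    have h2 : p₁ = 0 := by nlinarith
    subst h1 h2
    simp [hs]
  set A := p₀ ^ 2 * a + 2 * p₀ * p₁ * b + p₁ ^ 2 * d with hA
  set B := p₀ * (p₀ * b - p₁ * a) + p₁ * (p₀ * d - p₁ * b) with hB
  set G := -p₁ * (p₀ * b - p₁ * a) + p₀ * (p₀ * d - p₁ * b) with hG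
  have e1 : s ^ 2 * (a * d - b ^ 2) = A * G - B ^ 2 := by rw [hs, hA, hB, hG]; ring
  have e2 : s * ((p₀ * b - p₁ * a) ^ 2 + (p₀ * d - p₁ * b) ^ 2) = B ^ 2 + G ^ 2 := by
    rw [hs, hB, hG]; ring
  have e3 : (f + 2 * s * f') * A = -f * G := by
    have : s * (a + d) = A + G := by rw [hs, hA, hG]; ring
    linear_combination s * hEL - f * this
  have key : s * ((f + 2 * s * f') * (s * (a * d - b ^ 2))) ≤
      s * (-c * ((p₀ * b - p₁ * a) ^ 2 + (p₀ * d - p₁ * b) ^ 2)) := by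
    have l : s * ((f + 2 * s * f') * (s * (a * d - b ^ 2)))
        = -f * G ^ 2 - (f + 2 * s * f') * B ^ 2 := by
      linear_combination (f + 2 * s * f') * e1 + G * e3
    have r : s * (-c * ((p₀ * b - p₁ * a) ^ 2 + (p₀ * d - p₁ * b) ^ 2))
        = -c * (B ^ 2 + G ^ 2) := by linear_combination -c * e2
    rw [l, r]
    have : 0 ≤ s * f' := by positivity
    nlinarith [mul_nonneg (sub_nonneg.2 hc) (_root_.sq_nonneg B),
      mul_nonneg (sub_nonneg.2 hc) (_root_.sq_nonneg G), mul_nonneg this (_root_.sq_nonneg B)]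
  exact le_of_mul_le_mul_left key hpos

namespace Minimizer

variable {F F' F'' : ℝ → ℝ} {c₀ C₀ lam : ℝ} {u W : Plane → ℝ}

theorem C₀_pos (h : Minimizer F F' F'' c₀ C₀ lam u W) : 0 < C₀ :=
  h.c₀_pos.trans_le ((h.le_deriv 0 le_rfl).trans (h.deriv_le 0 le_rfl))

theorem continuous_tanSq (h : Minimizer F F' F'' c₀ C₀ lam u W) : Continuous (tanSq W) := by
  have h1 := h.continuous_p
  have h2 := fun i j => continuous_pd (smooth_of_le (h.contDiff_p i)) j
  unfold tanSq
  fun_prop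

theorem continuous_hessSq (h : Minimizer F F' F'' c₀ C₀ lam u W) : Continuous (hessSq W) := by
  have h2 := fun i j => continuous_pd (smooth_of_le (h.contDiff_p i)) j
  unfold hessSq
  fun_prop

/-- The second order terms in the inner variation are controlled by the transposed differential. -/
theorem second_variation_le (h : Minimizer F F' F'' c₀ C₀ lam u W) (X : Fin 2 → Plane → ℝ)
    (x : Plane) :
    F' (sq W x) * tsq W X x + 2 * F'' (sq W x) * qform W X x ^ 2 ≤ 3 * C₀ * tsq W X x := by
  have hs := sq_nonneg W x
  have h1 : qform W X x ^ 2 ≤ sq W x * tsq W X x := by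
    unfold qform sq tsq
    nlinarith [_root_.sq_nonneg (pd 0 W x * (pd 1 (X 0) x * pd 0 W x + pd 1 (X 1) x * pd 1 W x)
      - pd 1 W x * (pd 0 (X 0) x * pd 0 W x + pd 0 (X 1) x * pd 1 W x))]
  have hb : 0 ≤ tsq W X x := by unfold tsq; positivity
  have h2 : F'' (sq W x) * sq W x ≤ C₀ := by
    have h3 := h.deriv2_le _ hs
    rw [le_div_iff₀ (by linarith)] at h3
    have := h.deriv2_nonneg _ hs
    linarith
  have h4 := mul_le_mul_of_nonneg_right (h.deriv_le _ hs) hb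
  have h5 := mul_le_mul_of_nonneg_left h1 (h.deriv2_nonneg _ hs)
  have h6 := mul_le_mul_of_nonneg_right h2 hb
  linarith

/-- The regularized stability inequality. -/
theorem stability_regularized (h : Minimizer F F' F'' c₀ C₀ lam u W) {φ : Plane → ℝ}
    (hφ : ContDiff ℝ (⊤ : ℕ∞) φ) (hc : HasCompactSupport φ) {ε : ℝ} (hε : 0 < ε) :
    c₀ * ∫ x in {y | 0 < u y}, φ x ^ 2 * tanSq W x / (sq W x + ε) ≤
      6 * C₀ * ∫ x in {y | 0 < u y}, (sq W x * (pd 0 φ x ^ 2 + pd 1 φ x ^ 2)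
        + φ x ^ 2 * (ε ^ 2 * (sq W x * hessSq W x) / (sq W x + ε) ^ 3)) := by
  have hsε : ∀ x, 0 < sq W x + ε := fun x => by linarith [sq_nonneg W x]
  set r : Plane → ℝ := fun x => Real.sqrt (sq W x + ε) with hr
  have hrpos : ∀ x, 0 < r x := fun x => Real.sqrt_pos.2 (hsε x)
  have hrsq : ∀ x, r x ^ 2 = sq W x + ε := fun x => Real.sq_sqrt (hsε x).le
  have hrc : ContDiff ℝ (⊤ : ℕ∞) r :=
    (h.contDiff_sq.add contDiff_const).sqrt fun x => (hsε x).ne'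
  set κ : Plane → ℝ := fun x => (r x)⁻¹ with hκ
  have hκc : ContDiff ℝ (⊤ : ℕ∞) κ := hrc.inv fun x => (hrpos x).ne'
  have hκsq : ∀ x, κ x ^ 2 * (sq W x + ε) = 1 := fun x => by
    rw [← hrsq, hκ]
    have := (hrpos x).ne'
    field_simp
  have hκp : ∀ i x, pd i κ x = -(1 / 2) * κ x ^ 3 * pd i (sq W) x := by
    intro i x
    have dκ := hκc.differentiable (by simp) x
    have ds := h.contDiff_sq.differentiable (by simp) x
    have hds : DifferentiableAt ℝ (fun x => sq W x + ε) x := ds.add_const _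
    have e : (fun x => κ x ^ 2 * (sq W x + ε)) = fun _ => 1 := funext hκsq
    have e2 : pd i (fun x => κ x ^ 2 * (sq W x + ε)) x = 0 := by rw [e, pd_const]
    rw [pd_mul (dκ.fun_pow 2) hds, pd_sq dκ, pd_add ds (differentiableAt_const _), pd_const] at e2
    have hk := hκsq x
    linear_combination (κ x / 2) * e2 - pd i κ x * hk
  set η : Plane → ℝ := fun x => φ x * κ x with hη
  have hηc : ContDiff ℝ (⊤ : ℕ∞) η := hφ.mul hκc
  have hηs : HasCompactSupport η := hc.mul_right
  set X : Fin 2 → Plane → ℝ := fun i x => η x * pd i W x with hX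
  have hXc : ∀ i, ContDiff ℝ (⊤ : ℕ∞) (X i) := fun i => hηc.mul (h.contDiff_p i)
  have hXs : ∀ i, HasCompactSupport (X i) := fun i => hηs.mul_right
  have hXp : ∀ i j x, pd j (X i) x = pd j η x * pd i W x + η x * pd j (pd i W) x := by
    intro i j x
    rw [hX, pd_mul (hηc.differentiable (by simp) x) ((h.contDiff_p i).differentiable (by simp) x)]
  have hηp : ∀ j x, pd j η x = pd j φ x * κ x + φ x * (-(1 / 2) * κ x ^ 3 * pd j (sq W) x) := by
    intro j x
    rw [hη, pd_mul (hφ.differentiable (by simp) x) (hκc.differentiable (by simp) x), hκp]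
  have h2 := (h.inner_variation (fun i => smooth_of_le (hXc i)) hXs).2
  have h0 := h.F_zero_mul_divg (contDiff_jacPot hXc) (hasCompactSupport_jacPot hXs)
  simp_rw [divg_jacPot hXc] at h0
  rw [h0, add_zero] at h2
  have hpot : ∀ x, pd 0 (sq W) x * jacPot X 0 x + pd 1 (sq W) x * jacPot X 1 x =
      η x ^ 2 * (sq W x * (pd 0 (pd 0 W) x * pd 1 (pd 1 W) x - pd 0 (pd 1 W) x ^ 2)) := by
    intro x
    rw [jacPot_zero, jacPot_one, hXp, hXp, hXp, hXp, h.pd_sq_grad, h.pd_sq_grad, pd_comm h.smooth]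
    simp only [hX, sq]
    ring
  have hjac := h.setIntegral_mul_jac hXc hXs
  simp_rw [hpot] at hjac
  have hp := h.continuous_p
  have hpp := fun i j => continuous_pd (smooth_of_le (h.contDiff_p i)) j
  have hsc := h.continuous_sq
  have hF' := h.continuous_F'
  have hF := h.continuous_F
  have hF2 := h.continuous''
  have hXpc := fun i j => continuous_pd (smooth_of_le (hXc i)) j
  have hφc := hφ.continuous
  have hφp := fun j => continuous_pd (smooth_of_le hφ) j
  have hηcc := hηc.continuous
  have htan := h.continuous_tanSq
  have hhess := h.continuous_hessSq
  have htc : Continuous (tsq W X) := by unfold tsq; fun_prop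
  have hts : HasCompactSupport (tsq W X) := by
    refine HasCompactSupport.intro (K := tsupport η) hηs fun x hx => ?_
    have hz : ∀ i j, pd j (X i) x = 0 := fun i j => by
      rw [hXp, pd_eq_zero_of_notMem_tsupport hx, image_eq_zero_of_notMem_tsupport hx]; ring
    simp [tsq, hz]
  have hqc : Continuous (qform W X) := by unfold qform; fun_prop
  have hqs : HasCompactSupport (qform W X) := by
    refine HasCompactSupport.intro (K := tsupport η) hηs fun x hx => ?_
    have hz : ∀ i j, pd j (X i) x = 0 := fun i j => by
      rw [hXp, pd_eq_zero_of_notMem_tsupport hx, image_eq_zero_of_notMem_tsupport hx]; ring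
    simp [qform, hz]
  have hjc : Continuous (jac X) := by unfold jac; fun_prop
  have hjs : HasCompactSupport (jac X) :=
    (hasCompactSupport_pd (hXs 0) 0).mul_right.sub (hasCompactSupport_pd (hXs 0) 1).mul_right
  have i1 : Integrable fun x => F' (sq W x) * tsq W X x + 2 * F'' (sq W x) * qform W X x ^ 2 := by
    refine integrable_of_cs (by fun_prop) (hts.mul_left.add (HasCompactSupport.mul_left ?_))
    exact hqs.comp_left (g := fun t : ℝ => t ^ 2) (by simp)
  have i2 : Integrable fun x => (F (sq W x) + lam ^ 2 - 2 * sq W x * F' (sq W x)) * jac X x :=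
    integrable_of_cs (by fun_prop) hjs.mul_left
  have i3 : Integrable fun x => 3 * C₀ * tsq W X x :=
    (integrable_of_cs htc hts).const_mul _
  have hφ2s : HasCompactSupport fun x => φ x ^ 2 := hc.comp_left (g := fun t : ℝ => t ^ 2) (by simp)
  have hη2s : HasCompactSupport fun x => η x ^ 2 :=
    hηs.comp_left (g := fun t : ℝ => t ^ 2) (by simp)
  have i4 : Integrable fun x => φ x ^ 2 * tanSq W x / (sq W x + ε) := by
    refine integrable_of_cs ?_ ?_
    · exact (by fun_prop : Continuous fun x => φ x ^ 2 * tanSq W x).div (by fun_prop)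
        fun x => (hsε x).ne'
    · exact HasCompactSupport.mul_right (hφ2s.mul_right)
  have i5 : Integrable fun x => sq W x * (pd 0 φ x ^ 2 + pd 1 φ x ^ 2)
        + φ x ^ 2 * (ε ^ 2 * (sq W x * hessSq W x) / (sq W x + ε) ^ 3) := by
    refine integrable_of_cs ?_ (HasCompactSupport.add (HasCompactSupport.mul_left ?_)
      hφ2s.mul_right)
    · refine Continuous.add (by fun_prop) (Continuous.mul (by fun_prop) (Continuous.div ?_ ?_ ?_))
      · fun_prop
      · fun_prop
      · exact fun x => (pow_pos (hsε x) 3).ne'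
    · exact ((hasCompactSupport_pd hc 0).comp_left (g := fun t : ℝ => t ^ 2) (by simp)).add
        ((hasCompactSupport_pd hc 1).comp_left (g := fun t : ℝ => t ^ 2) (by simp))
  rw [integral_add (f := fun x => F' (sq W x) * tsq W X x + 2 * F'' (sq W x) * qform W X x ^ 2)
    i1.restrict i2.restrict, hjac] at h2
  have hle1 : ∫ x in {y | 0 < u y},
      (F' (sq W x) * tsq W X x + 2 * F'' (sq W x) * qform W X x ^ 2) ≤
      ∫ x in {y | 0 < u y}, 6 * C₀ * (sq W x * (pd 0 φ x ^ 2 + pd 1 φ x ^ 2)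
        + φ x ^ 2 * (ε ^ 2 * (sq W x * hessSq W x) / (sq W x + ε) ^ 3)) := by
    refine integral_mono i1.restrict (i5.const_mul _).restrict fun x => ?_
    refine (h.second_variation_le X x).trans ?_
    have hC := h.C₀_pos
    suffices tsq W X x ≤ 2 * (sq W x * (pd 0 φ x ^ 2 + pd 1 φ x ^ 2)
        + φ x ^ 2 * (ε ^ 2 * (sq W x * hessSq W x) / (sq W x + ε) ^ 3)) by nlinarith
    set g₀ := pd 0 W x * pd 0 (pd 0 W) x + pd 1 W x * pd 0 (pd 1 W) x with hg₀
    set g₁ := pd 0 W x * pd 0 (pd 1 W) x + pd 1 W x * pd 1 (pd 1 W) x with hg₁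
    have hk := hκsq x
    have hk3 : κ x ^ 6 = 1 / (sq W x + ε) ^ 3 := by
      rw [eq_div_iff (pow_pos (hsε x) 3).ne']
      calc κ x ^ 6 * (sq W x + ε) ^ 3 = (κ x ^ 2 * (sq W x + ε)) ^ 3 := by ring
        _ = 1 := by rw [hk]; norm_num
    have et : tsq W X x = (sq W x * κ x * pd 0 φ x + φ x * (ε * κ x ^ 3) * g₀) ^ 2
        + (sq W x * κ x * pd 1 φ x + φ x * (ε * κ x ^ 3) * g₁) ^ 2 := by
      have hs : sq W x = pd 0 W x ^ 2 + pd 1 W x ^ 2 := rfl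
      have ek : κ x = κ x ^ 3 * (sq W x + ε) := by linear_combination (-κ x) * hk
      have c0 : pd 0 (X 0) x * pd 0 W x + pd 0 (X 1) x * pd 1 W x
          = sq W x * κ x * pd 0 φ x + φ x * (ε * κ x ^ 3) * g₀ := by
        rw [hXp, hXp, hηp, h.pd_sq_grad, ← hg₀]
        have hηx : η x = φ x * κ x := rfl
        rw [hηx]
        rw [hs] at ek ⊢
        linear_combination φ x * g₀ * ek
      have c1 : pd 1 (X 0) x * pd 0 W x + pd 1 (X 1) x * pd 1 W x
          = sq W x * κ x * pd 1 φ x + φ x * (ε * κ x ^ 3) * g₁ := by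
        rw [hXp, hXp, hηp, h.pd_sq_grad, pd_comm h.smooth, ← hg₁]
        have hηx : η x = φ x * κ x := rfl
        rw [hηx]
        rw [hs] at ek ⊢
        linear_combination φ x * g₁ * ek
      rw [tsq, c0, c1]
    have hg : g₀ ^ 2 + g₁ ^ 2 ≤ sq W x * hessSq W x := by
      unfold sq hessSq
      rw [hg₀, hg₁]
      nlinarith [_root_.sq_nonneg (pd 0 W x * pd 0 (pd 1 W) x - pd 1 W x * pd 0 (pd 0 W) x),
        _root_.sq_nonneg (pd 0 W x * pd 1 (pd 1 W) x - pd 1 W x * pd 0 (pd 1 W) x)]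
    have hsk : sq W x * κ x ^ 2 ≤ 1 := by nlinarith [_root_.sq_nonneg (κ x)]
    have hs := sq_nonneg W x
    rw [et]
    have m1 : (sq W x * κ x * pd 0 φ x) ^ 2 + (sq W x * κ x * pd 1 φ x) ^ 2
        ≤ sq W x * (pd 0 φ x ^ 2 + pd 1 φ x ^ 2) := by
      have : (sq W x * κ x * pd 0 φ x) ^ 2 + (sq W x * κ x * pd 1 φ x) ^ 2
        = (sq W x * κ x ^ 2) * (sq W x * (pd 0 φ x ^ 2 + pd 1 φ x ^ 2)) := by ring
      rw [this]
      exact mul_le_of_le_one_left (by positivity) hsk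
    have m2 : (φ x * (ε * κ x ^ 3) * g₀) ^ 2 + (φ x * (ε * κ x ^ 3) * g₁) ^ 2
        ≤ φ x ^ 2 * (ε ^ 2 * (sq W x * hessSq W x) / (sq W x + ε) ^ 3) := by
      have e : (φ x * (ε * κ x ^ 3) * g₀) ^ 2 + (φ x * (ε * κ x ^ 3) * g₁) ^ 2
        = φ x ^ 2 * (ε ^ 2 * (g₀ ^ 2 + g₁ ^ 2) * κ x ^ 6) := by ring
      rw [e, hk3, div_eq_mul_one_div (ε ^ 2 * (sq W x * hessSq W x))]
      have := hsε x
      gcongr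
    nlinarith [_root_.sq_nonneg (sq W x * κ x * pd 0 φ x - φ x * (ε * κ x ^ 3) * g₀),
      _root_.sq_nonneg (sq W x * κ x * pd 1 φ x - φ x * (ε * κ x ^ 3) * g₁)]
  have hle2 : ∫ x in {y | 0 < u y}, (F' (sq W x) + 2 * sq W x * F'' (sq W x)) *
      (η x ^ 2 * (sq W x * (pd 0 (pd 0 W) x * pd 1 (pd 1 W) x - pd 0 (pd 1 W) x ^ 2))) ≤
      ∫ x in {y | 0 < u y}, -c₀ * (φ x ^ 2 * tanSq W x / (sq W x + ε)) := by
    refine setIntegral_mono_on ?_ (i4.const_mul _).restrict h.isOpen.measurableSet fun x hx => ?_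
    · refine (integrable_of_cs (by fun_prop) (HasCompactSupport.mul_left
        (HasCompactSupport.mul_right hη2s))).integrableOn
    have hd := det_hess_le (h.le_deriv _ (sq_nonneg W x)) (h.deriv2_nonneg _ (sq_nonneg W x))
      (h.euler_lagrange hx)
    have hη2 : η x ^ 2 = φ x ^ 2 / (sq W x + ε) := by
      rw [eq_div_iff (hsε x).ne']
      have := hκsq x
      simp only [hη]
      linear_combination φ x ^ 2 * this
    have hη0 : 0 ≤ η x ^ 2 := by positivity
    calc _ = η x ^ 2 * ((F' (sq W x) + 2 * sq W x * F'' (sq W x)) *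
          (sq W x * (pd 0 (pd 0 W) x * pd 1 (pd 1 W) x - pd 0 (pd 1 W) x ^ 2))) := by ring
      _ ≤ η x ^ 2 * (-c₀ * tanSq W x) := mul_le_mul_of_nonneg_left hd hη0
      _ = _ := by rw [hη2]; ring
  rw [integral_const_mul] at hle1 hle2
  linarith

/-- The stability inequality. -/
theorem stability (h : Minimizer F F' F'' c₀ C₀ lam u W) {φ : Plane → ℝ}
    (hφ : ContDiff ℝ (⊤ : ℕ∞) φ) (hc : HasCompactSupport φ) :
    c₀ * ∫ x in {y | 0 < u y}, φ x ^ 2 * tanSq W x / (sq W x + 1) ≤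
      6 * C₀ * ∫ x in {y | 0 < u y}, sq W x * (pd 0 φ x ^ 2 + pd 1 φ x ^ 2) := by
  have hsc := h.continuous_sq
  have htan := h.continuous_tanSq
  have hhess := h.continuous_hessSq
  have hφc := hφ.continuous
  have hφp := fun j => continuous_pd (smooth_of_le hφ) j
  have hφ2s : HasCompactSupport fun x => φ x ^ 2 := hc.comp_left (g := fun t : ℝ => t ^ 2) (by simp)
  set ε : ℕ → ℝ := fun n => 1 / ((n : ℝ) + 1) with hεdef
  have hε : ∀ n, 0 < ε n := fun n => by positivity
  have hε1 : ∀ n, ε n ≤ 1 := fun n => by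
    rw [hεdef, div_le_one (by positivity)]
    linarith [(Nat.cast_nonneg n : (0 : ℝ) ≤ n)]
  have hε0 : Filter.Tendsto ε Filter.atTop (nhds 0) := tendsto_one_div_add_atTop_nhds_zero_nat
  have i1 : ∀ n, Integrable fun x => φ x ^ 2 * tanSq W x / (sq W x + ε n) := fun n => by
    refine integrable_of_cs ?_ (HasCompactSupport.mul_right (hφ2s.mul_right))
    exact (by fun_prop : Continuous fun x => φ x ^ 2 * tanSq W x).div (by fun_prop)
      fun x => by linarith [sq_nonneg W x, hε n]
  have i1' : Integrable fun x => φ x ^ 2 * tanSq W x / (sq W x + 1) := by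
    refine integrable_of_cs ?_ (HasCompactSupport.mul_right (hφ2s.mul_right))
    exact (by fun_prop : Continuous fun x => φ x ^ 2 * tanSq W x).div (by fun_prop)
      fun x => by linarith [sq_nonneg W x]
  have htn : ∀ x, 0 ≤ tanSq W x := fun x => by unfold tanSq; positivity
  have hhn : ∀ x, 0 ≤ hessSq W x := fun x => by unfold hessSq; positivity
  have hg : Continuous fun x => sq W x * (pd 0 φ x ^ 2 + pd 1 φ x ^ 2) := by fun_prop
  have hgi : Integrable fun x => sq W x * (pd 0 φ x ^ 2 + pd 1 φ x ^ 2) := by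
    refine integrable_of_cs hg (HasCompactSupport.mul_left ?_)
    exact ((hasCompactSupport_pd hc 0).comp_left (g := fun t : ℝ => t ^ 2) (by simp)).add
        ((hasCompactSupport_pd hc 1).comp_left (g := fun t : ℝ => t ^ 2) (by simp))
  have hle : ∀ n, c₀ * ∫ x in {y | 0 < u y}, φ x ^ 2 * tanSq W x / (sq W x + 1) ≤
      6 * C₀ * ∫ x in {y | 0 < u y}, (sq W x * (pd 0 φ x ^ 2 + pd 1 φ x ^ 2)
        + φ x ^ 2 * (ε n ^ 2 * (sq W x * hessSq W x) / (sq W x + ε n) ^ 3)) := by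
    intro n
    refine le_trans ?_ (h.stability_regularized hφ hc (hε n))
    refine mul_le_mul_of_nonneg_left ?_ h.c₀_pos.le
    refine integral_mono i1'.restrict (i1 n).restrict fun x => ?_
    have h1 := sq_nonneg W x
    have h2 := hε n
    have h3 := htn x
    have h4 := hε1 n
    simp only
    gcongr
  have hlim : Filter.Tendsto (fun n => ∫ x in {y | 0 < u y},
      (sq W x * (pd 0 φ x ^ 2 + pd 1 φ x ^ 2)
        + φ x ^ 2 * (ε n ^ 2 * (sq W x * hessSq W x) / (sq W x + ε n) ^ 3))) Filter.atTop
      (nhds (∫ x in {y | 0 < u y}, sq W x * (pd 0 φ x ^ 2 + pd 1 φ x ^ 2))) := by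
    refine tendsto_integral_of_dominated_convergence
      (fun x => sq W x * (pd 0 φ x ^ 2 + pd 1 φ x ^ 2) + φ x ^ 2 * hessSq W x) ?_ ?_ ?_ ?_
    · intro n
      refine Continuous.aestronglyMeasurable (hg.add (Continuous.mul (by fun_prop)
        (Continuous.div (by fun_prop) (by fun_prop) fun x => ?_)))
      have := sq_nonneg W x
      have := hε n
      positivity
    · exact (hgi.add (integrable_of_cs (by fun_prop) hφ2s.mul_right)).restrict
    · intro n
      refine Filter.Eventually.of_forall fun x => ?_
      have h1 := sq_nonneg W x
      have h2 := hε n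
      have h3 := hhn x
      rw [Real.norm_eq_abs, abs_of_nonneg (by positivity)]
      have : ε n ^ 2 * (sq W x * hessSq W x) / (sq W x + ε n) ^ 3 ≤ hessSq W x := by
        rw [div_le_iff₀ (by positivity)]
        have : ε n ^ 2 * sq W x ≤ (sq W x + ε n) ^ 3 := by
          nlinarith [mul_nonneg h1 (mul_nonneg h1 h2.le), pow_pos h2 3,
            mul_nonneg h1 (_root_.sq_nonneg (ε n)), pow_nonneg h1 3]
        nlinarith
      gcongr
    · refine Filter.Eventually.of_forall fun x => ?_
      rcases (sq_nonneg W x).eq_or_lt with h0 | hpos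
      · simp [← h0]
      · have hcont : ContinuousAt (fun e : ℝ => sq W x * (pd 0 φ x ^ 2 + pd 1 φ x ^ 2)
            + φ x ^ 2 * (e ^ 2 * (sq W x * hessSq W x) / (sq W x + e) ^ 3)) 0 := by
          refine ContinuousAt.add continuousAt_const (ContinuousAt.mul continuousAt_const
            (ContinuousAt.div (by fun_prop) (by fun_prop) ?_))
          simp [hpos.ne']
        have := hcont.tendsto.comp hε0
        simpa [Function.comp_def] using this
  exact ge_of_tendsto' (hlim.const_mul (6 * C₀)) hle

/-- Caccioppoli's inequality. -/
theorem caccioppoli (h : Minimizer F F' F'' c₀ C₀ lam u W) {ψ : Plane → ℝ}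
    (hψ : ContDiff ℝ 1 ψ) (hc : HasCompactSupport ψ) :
    c₀ * ∫ x in {y | 0 < u y}, sq W x * ψ x ^ 2 ≤
      4 * C₀ * ∫ x in {y | 0 < u y}, W x ^ 2 * (pd 0 ψ x ^ 2 + pd 1 ψ x ^ 2) := by
  have hψ2s : HasCompactSupport fun x => ψ x ^ 2 := hc.comp_left (g := fun t : ℝ => t ^ 2) (by simp)
  have h1 := h.outer_variation (hψ.pow 2) hψ2s
  have hψp : ∀ i x, pd i (fun x => ψ x ^ 2) x = 2 * ψ x * pd i ψ x := fun i x =>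
    pd_sq (hψ.differentiable (by simp) x) i
  simp only [hψp] at h1
  have hsc := h.continuous_sq
  have hF' := h.continuous_F'
  have hp := h.continuous_p
  have hW := h.smooth.continuous
  have hψc := hψ.continuous
  have hψpc := fun i => continuous_pd hψ i
  have hgs : HasCompactSupport fun x => pd 0 ψ x ^ 2 + pd 1 ψ x ^ 2 :=
    ((hasCompactSupport_pd hc 0).comp_left (g := fun t : ℝ => t ^ 2) (by simp)).add
        ((hasCompactSupport_pd hc 1).comp_left (g := fun t : ℝ => t ^ 2) (by simp))
  have i1 : Integrable fun x => sq W x * ψ x ^ 2 :=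
    integrable_of_cs (by fun_prop) hψ2s.mul_left
  have i2 : Integrable fun x => W x ^ 2 * (pd 0 ψ x ^ 2 + pd 1 ψ x ^ 2) :=
    integrable_of_cs (by fun_prop) hgs.mul_left
  have i3 : Integrable fun x => F' (sq W x) * (ψ x ^ 2 * sq W x
      + W x * (pd 0 W x * (2 * ψ x * pd 0 ψ x) + pd 1 W x * (2 * ψ x * pd 1 ψ x))) := by
    refine integrable_of_cs (by fun_prop) (hc.mono' ?_)
    intro x hx
    contrapose! hx
    rw [Function.mem_support, not_not, image_eq_zero_of_notMem_tsupport hx]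
    ring
  have hle : ∫ x in {y | 0 < u y}, (c₀ / 2 * (sq W x * ψ x ^ 2)
      - 2 * C₀ * (W x ^ 2 * (pd 0 ψ x ^ 2 + pd 1 ψ x ^ 2))) ≤ 0 := by
    refine le_of_le_of_eq ?_ h1
    refine integral_mono ((i1.const_mul _).sub (i2.const_mul _)).restrict i3.restrict fun x => ?_
    have hl := h.le_deriv _ (sq_nonneg W x)
    have hu := h.deriv_le _ (sq_nonneg W x)
    have hc0 := h.c₀_pos
    have hs : sq W x = pd 0 W x ^ 2 + pd 1 W x ^ 2 := rfl
    have hn1 : 0 ≤ sq W x * ψ x ^ 2 := mul_nonneg (sq_nonneg W x) (_root_.sq_nonneg _)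
    have hn2 : 0 ≤ W x ^ 2 * (pd 0 ψ x ^ 2 + pd 1 ψ x ^ 2) := by positivity
    have hq : 1 / 2 * (sq W x * ψ x ^ 2) - 2 * (W x ^ 2 * (pd 0 ψ x ^ 2 + pd 1 ψ x ^ 2)) ≤
        ψ x ^ 2 * sq W x
      + W x * (pd 0 W x * (2 * ψ x * pd 0 ψ x) + pd 1 W x * (2 * ψ x * pd 1 ψ x)) := by
      rw [hs]
      nlinarith [_root_.sq_nonneg (ψ x * pd 0 W x + 2 * W x * pd 0 ψ x),
        _root_.sq_nonneg (ψ x * pd 1 W x + 2 * W x * pd 1 ψ x)]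
    have := mul_le_mul_of_nonneg_left hq (hc0.le.trans hl)
    simp only
    nlinarith
  rw [integral_sub (i1.const_mul _).restrict (i2.const_mul _).restrict, integral_const_mul,
    integral_const_mul] at hle
  linarith

end Minimizer
/-- Second order necessary conditions at a local minimum in the plane. -/
theorem hess_nonneg_of_isLocalMin {f : Plane → ℝ} (hf : ContDiff ℝ (⊤ : ℕ∞) f) {y : Plane}
    (hy : IsLocalMin f y) : (∀ i, pd i f y = 0) ∧ ∀ a b : ℝ,
      0 ≤ a ^ 2 * pd 0 (pd 0 f) y + 2 * a * b * pd 0 (pd 1 f) y + b ^ 2 * pd 1 (pd 1 f) y := by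
  refine ⟨fun i => by rw [pd, hy.fderiv_eq_zero]; simp, fun a b => ?_⟩
  set v : Plane := !₂[a, b] with hv
  have hv0 : v 0 = a := rfl
  have hv1 : v 1 = b := rfl
  have hdp : ∀ i, Differentiable ℝ (pd i f) := fun i => (contDiff_pd hf i).differentiable (by simp)
  set g : Plane → ℝ := fun x => a * pd 0 f x + b * pd 1 f x with hg
  have hgd : Differentiable ℝ g := ((hdp 0).const_mul a).add ((hdp 1).const_mul b)
  have h1 : ∀ t : ℝ, HasDerivAt (fun t : ℝ => f (y + t • v)) (g (y + t • v)) t := by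
    intro t
    have := hasDerivAt_line (hf.differentiable (by simp)) y v t
    rwa [fderiv_apply_eq] at this
  have h2 := hasDerivAt_line hgd y v 0
  have hcont : ContinuousAt (fun t : ℝ => y + t • v) 0 := by fun_prop
  have hev : ∀ᶠ t : ℝ in nhds 0, f y ≤ f (y + t • v) := by
    have h0 : Filter.Tendsto (fun t : ℝ => y + t • v) (nhds 0) (nhds y) := by
      simpa [ContinuousAt] using hcont
    exact h0.eventually hy
  obtain ⟨t₀, ht₀, hball⟩ := Metric.eventually_nhds_iff.1 hev
  have h3 := (second_order_necessary ht₀ (fun t _ => h1 t) h2 fun t ht => by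
    simpa using hball (by simpa [abs_lt] using ht)).2
  rw [zero_smul, add_zero, fderiv_apply_eq, hg,
    pd_add ((hdp 0).const_mul a y) ((hdp 1).const_mul b y),
    pd_add ((hdp 0).const_mul a y) ((hdp 1).const_mul b y),
    pd_const_mul _ (hdp 0 y), pd_const_mul _ (hdp 1 y), pd_const_mul _ (hdp 0 y),
    pd_const_mul _ (hdp 1 y), pd_comm hf, hv0, hv1] at h3
  linarith

theorem contDiff_coord (i : Fin 2) : ContDiff ℝ (⊤ : ℕ∞) fun x : Plane => x i :=
  (EuclideanSpace.proj i : Plane →L[ℝ] ℝ).contDiff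

theorem contDiff_norm_sub_sq (c : Plane) : ContDiff ℝ (⊤ : ℕ∞) fun x : Plane => ‖x - c‖ ^ 2 :=
  (contDiff_id.sub contDiff_const).norm_sq ℝ

theorem pd_norm_sub_sq (c : Plane) (i : Fin 2) (x : Plane) :
    pd i (fun x => ‖x - c‖ ^ 2) x = 2 * (x i - c i) := by
  have hd : ∀ j : Fin 2, DifferentiableAt ℝ (fun x : Plane => x j) x := fun j =>
    (contDiff_coord j).differentiable (by simp) x
  have hd' : ∀ j : Fin 2, DifferentiableAt ℝ (fun x : Plane => x j - c j) x := fun j =>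
    (hd j).sub_const _
  have e : (fun x : Plane => ‖x - c‖ ^ 2) = fun x => (x 0 - c 0) ^ 2 + (x 1 - c 1) ^ 2 := by
    funext x; rw [norm_sq_eq]; rfl
  rw [e, pd_add ((hd' 0).fun_pow 2) ((hd' 1).fun_pow 2), pd_sq (hd' 0), pd_sq (hd' 1),
    pd_sub (hd 0) (differentiableAt_const _), pd_sub (hd 1) (differentiableAt_const _),
    pd_const, pd_const, pd_coord, pd_coord]
  fin_cases i <;> simp

theorem pd_radial {β β' : ℝ → ℝ} (hβ : ∀ t, HasDerivAt β (β' t) t) (c : Plane) (i : Fin 2)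
    (x : Plane) :
    pd i (fun x => β (‖x - c‖ ^ 2)) x = 2 * (β' (‖x - c‖ ^ 2) * (x i - c i)) := by
  rw [pd_comp (hβ _) ((contDiff_norm_sub_sq c).differentiable (by simp) x), pd_norm_sub_sq]
  ring

theorem pd_pd_radial {β β' β'' : ℝ → ℝ} (hβ : ∀ t, HasDerivAt β (β' t) t)
    (hβ' : ∀ t, HasDerivAt β' (β'' t) t) (c : Plane) (i j : Fin 2) (x : Plane) :
    pd j (pd i fun x => β (‖x - c‖ ^ 2)) x =
      4 * β'' (‖x - c‖ ^ 2) * (x i - c i) * (x j - c j)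
        + 2 * β' (‖x - c‖ ^ 2) * if j = i then 1 else 0 := by
  have e : (pd i fun x => β (‖x - c‖ ^ 2)) = fun x => 2 * (β' (‖x - c‖ ^ 2) * (x i - c i)) :=
    funext (pd_radial hβ c i)
  have hd : DifferentiableAt ℝ (fun x : Plane => x i) x :=
    (contDiff_coord i).differentiable (by simp) x
  have hd' : DifferentiableAt ℝ (fun x : Plane => x i - c i) x := hd.sub_const _
  have hN := (contDiff_norm_sub_sq c).differentiable (by simp) x
  have hb : DifferentiableAt ℝ (fun x => β' (‖x - c‖ ^ 2)) x :=
    (hβ' (‖x - c‖ ^ 2)).differentiableAt.comp x hN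
  rw [e, pd_const_mul _ (hb.fun_mul hd'), pd_mul hb hd', pd_radial hβ',
    pd_sub hd (differentiableAt_const _), pd_const, pd_coord]
  ring

namespace Minimizer

variable {F F' F'' : ℝ → ℝ} {c₀ C₀ lam : ℝ} {u W : Plane → ℝ}

/-- A solution cannot be touched from below by a strict radial subsolution. -/
theorem not_isLocalMin_sub_radial (h : Minimizer F F' F'' c₀ C₀ lam u W) {β β' β'' : ℝ → ℝ}
    (hβc : ContDiff ℝ (⊤ : ℕ∞) β) (hβ : ∀ t, HasDerivAt β (β' t) t)
    (hβ' : ∀ t, HasDerivAt β' (β'' t) t) {c y : Plane} (hy : 0 < u y)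
    (h1 : 0 < β' (‖y - c‖ ^ 2) + ‖y - c‖ ^ 2 * β'' (‖y - c‖ ^ 2))
    (h2 : 0 ≤ β' (‖y - c‖ ^ 2) + 2 * ‖y - c‖ ^ 2 * β'' (‖y - c‖ ^ 2)) :
    ¬ IsLocalMin (fun x => W x - β (‖x - c‖ ^ 2)) y := by
  intro hloc
  have hb : ContDiff ℝ (⊤ : ℕ∞) fun x : Plane => β (‖x - c‖ ^ 2) :=
    hβc.comp (contDiff_norm_sub_sq c)
  obtain ⟨hg, hH⟩ := hess_nonneg_of_isLocalMin (h.smooth.sub hb) hloc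
  have dW := h.W_differentiable
  have db := hb.differentiable (by simp)
  have e1 : ∀ i, (pd i fun x => W x - β (‖x - c‖ ^ 2))
      = fun x => pd i W x - pd i (fun x => β (‖x - c‖ ^ 2)) x := fun i =>
    funext fun x => pd_sub (dW x) (db x) i
  have e2 : ∀ i j x, pd j (pd i fun x => W x - β (‖x - c‖ ^ 2)) x
      = pd j (pd i W) x - pd j (pd i fun x => β (‖x - c‖ ^ 2)) x := fun i j x => by
    rw [e1, pd_sub ((h.contDiff_p i).differentiable (by simp) x)
      ((contDiff_pd hb i).differentiable (by simp) x)]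
  simp only [e2, pd_pd_radial hβ hβ'] at hH
  simp only [e1, pd_radial hβ] at hg
  have hN : ‖y - c‖ ^ 2 = (y 0 - c 0) ^ 2 + (y 1 - c 1) ^ 2 := by rw [norm_sq_eq]; rfl
  have hEL := h.euler_lagrange hy
  have hs := sq_nonneg W y
  have hF := h.le_deriv _ hs
  have hF2 := h.deriv2_nonneg _ hs
  have hc := h.c₀_pos
  have t0 := hH 1 0
  have t1 := hH 0 1
  have tp := hH (pd 0 W y) (pd 1 W y)
  have g0 : pd 0 W y = 2 * (β' (‖y - c‖ ^ 2) * (y 0 - c 0)) := by linarith [hg 0]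
  have g1 : pd 1 W y = 2 * (β' (‖y - c‖ ^ 2) * (y 1 - c 1)) := by linarith [hg 1]
  simp at t0 t1 tp
  set B' := β' (‖y - c‖ ^ 2)
  set B'' := β'' (‖y - c‖ ^ 2)
  have htr : 0 < pd 0 (pd 0 W) y + pd 1 (pd 1 W) y := by
    rw [hN] at h1
    nlinarith
  have hq : 0 ≤ pd 0 W y ^ 2 * pd 0 (pd 0 W) y + 2 * pd 0 W y * pd 1 W y * pd 0 (pd 1 W) y
        + pd 1 W y ^ 2 * pd 1 (pd 1 W) y := by
    have e : pd 0 W y ^ 2 * (4 * B'' * (y 0 - c 0) * (y 0 - c 0) + 2 * B')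
        + 2 * pd 0 W y * pd 1 W y * (4 * B'' * (y 1 - c 1) * (y 0 - c 0))
        + pd 1 W y ^ 2 * (4 * B'' * (y 1 - c 1) * (y 1 - c 1) + 2 * B')
        = 8 * (B' ^ 2 * ‖y - c‖ ^ 2) * (B' + 2 * ‖y - c‖ ^ 2 * B'') := by
      rw [g0, g1, hN]; ring
    have : 0 ≤ 8 * (B' ^ 2 * ‖y - c‖ ^ 2) * (B' + 2 * ‖y - c‖ ^ 2 * B'') := by positivity
    linarith
  have : 0 < F' (sq W y) * (pd 0 (pd 0 W) y + pd 1 (pd 1 W) y) :=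
    mul_pos (hc.trans_le hF) htr
  have : 0 ≤ F'' (sq W y) * (pd 0 W y ^ 2 * pd 0 (pd 0 W) y
      + 2 * pd 0 W y * pd 1 W y * pd 0 (pd 1 W) y + pd 1 W y ^ 2 * pd 1 (pd 1 W) y) :=
    mul_nonneg hF2 hq
  linarith

theorem W_eq_of_closure (h : Minimizer F F' F'' c₀ C₀ lam u W) {x : Plane}
    (hx : x ∈ closure {y | 0 < u y}) : W x = u x :=
  EqOn.closure (fun x hx => h.eq_on x hx) h.smooth.continuous h.lip.continuous hx

/-- The growth of `u` away from the free boundary, via a Hopf-type barrier. -/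
theorem le_of_le_on_sphere (h : Minimizer F F' F'' c₀ C₀ lam u W) {x₀ z : Plane} {r ρ m : ℝ}
    (hr : 0 < r) (hball : ball x₀ r ⊆ {y | 0 < u y}) (hz : z ∈ frontier {y | 0 < u y})
    (hzr : dist z x₀ = r) (hρ : r / 4 ≤ ρ) (hρr : ρ < r) (hm0 : 0 < m)
    (hm : ∀ y ∈ sphere x₀ ρ, m ≤ u y) : m ≤ Real.exp 32 / 64 * r := by
  set α : ℝ := 32 / r ^ 2 with hα
  have hαr : α * r ^ 2 = 32 := by rw [hα]; field_simp
  have hαpos : 0 < α := by positivity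
  set β : ℝ → ℝ := fun t => m * (Real.exp (-α * t) - Real.exp (-32)) with hβdef
  set β' : ℝ → ℝ := fun t => m * (-α * Real.exp (-α * t)) with hβ'def
  set β'' : ℝ → ℝ := fun t => m * (-α * (-α * Real.exp (-α * t))) with hβ''def
  have hexp : ∀ t, HasDerivAt (fun t => Real.exp (-α * t)) (-α * Real.exp (-α * t)) t := by
    intro t
    have := ((hasDerivAt_id t).const_mul (-α)).exp
    simpa [mul_comm] using this
  have hβ : ∀ t, HasDerivAt β (β' t) t := fun t => ((hexp t).sub_const _).const_mul m
  have hβ' : ∀ t, HasDerivAt β' (β'' t) t := fun t => ((hexp t).const_mul (-α)).const_mul m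
  have hβc : ContDiff ℝ (⊤ : ℕ∞) β := by
    refine contDiff_const.mul (ContDiff.sub ?_ contDiff_const)
    exact (contDiff_const.mul contDiff_id).exp
  set f : Plane → ℝ := fun x => W x - β (‖x - x₀‖ ^ 2) with hf
  have hfc : ContDiff ℝ (⊤ : ℕ∞) f := h.smooth.sub (hβc.comp (contDiff_norm_sub_sq x₀))
  have hcl : closedBall x₀ r ⊆ closure {y | 0 < u y} := by
    rw [← closure_ball x₀ hr.ne']; exact closure_mono hball
  have hWu : ∀ x ∈ closedBall x₀ r, W x = u x := fun x hx => h.W_eq_of_closure (hcl hx)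
  have hβr : β (r ^ 2) = 0 := by
    simp only [hβdef]
    rw [show -α * r ^ 2 = -32 by linarith]
    ring
  set K : Set Plane := closedBall x₀ r \ ball x₀ ρ with hK
  have hKc : IsCompact K := (isCompact_closedBall x₀ r).diff isOpen_ball
  have hzK : z ∈ K := ⟨by rw [mem_closedBall, hzr], by rw [mem_ball, hzr]; linarith⟩
  have hfz : f z = 0 := by
    rw [dist_eq_norm] at hzr
    simp only [hf]
    rw [hzr, hβr, h.W_eq_zero_of_frontier hz, sub_zero]
  have hfK : ∀ x ∈ K, 0 ≤ f x := by
    obtain ⟨y, hyK, hy⟩ := hKc.exists_isMinOn ⟨z, hzK⟩ hfc.continuous.continuousOn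
    suffices 0 ≤ f y from fun x hx => this.trans (hy hx)
    by_contra hneg
    push Not at hneg
    have hyr : ‖y - x₀‖ ≤ r := by simpa [dist_eq_norm] using hyK.1
    have hyρ : ρ ≤ ‖y - x₀‖ := by simpa [dist_eq_norm] using hyK.2
    have hρpos : 0 < ρ := by linarith
    have hyr' : ‖y - x₀‖ < r := by
      refine lt_of_le_of_ne hyr fun he => ?_
      simp only [hf] at hneg
      rw [he, hβr, hWu y hyK.1] at hneg
      linarith [h.nonneg y]
    have hyρ' : ρ < ‖y - x₀‖ := by
      refine lt_of_le_of_ne hyρ fun he => ?_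
      simp only [hf] at hneg
      have h1 := hm y (by rw [mem_sphere, dist_eq_norm, he])
      rw [hWu y hyK.1] at hneg
      have h2 : β (‖y - x₀‖ ^ 2) ≤ m := by
        simp only [hβdef]
        have h3 : Real.exp (-α * ‖y - x₀‖ ^ 2) ≤ 1 := Real.exp_le_one_iff.2 (by
          have : 0 ≤ α * ‖y - x₀‖ ^ 2 := by positivity
          linarith)
        have h4 := Real.exp_pos (-32)
        nlinarith
      linarith
    have hnh : K ∈ nhds y := by
      refine Filter.mem_of_superset (((isOpen_ball (x := x₀) (ε := r)).inter
        (isClosed_closedBall (x := x₀) (ε := ρ)).isOpen_compl).mem_nhds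
        ⟨by simpa [dist_eq_norm] using hyr', by simpa [dist_eq_norm] using hyρ'⟩) ?_
      rintro x ⟨hx1, hx2⟩
      exact ⟨ball_subset_closedBall hx1, fun hx => hx2 (ball_subset_closedBall hx)⟩
    have hτ : 2 ≤ α * ‖y - x₀‖ ^ 2 := by
      have : (r / 4) ^ 2 ≤ ‖y - x₀‖ ^ 2 := by gcongr; linarith
      nlinarith
    have hE := Real.exp_pos (-α * ‖y - x₀‖ ^ 2)
    have hmE : 0 < m * α * Real.exp (-α * ‖y - x₀‖ ^ 2) := by positivity
    refine h.not_isLocalMin_sub_radial hβc hβ hβ' (c := x₀)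
      (hball (by simpa [dist_eq_norm] using hyr')) ?_ ?_ (hy.isLocalMin hnh)
    · have : β' (‖y - x₀‖ ^ 2) + ‖y - x₀‖ ^ 2 * β'' (‖y - x₀‖ ^ 2)
        = m * α * Real.exp (-α * ‖y - x₀‖ ^ 2) * (α * ‖y - x₀‖ ^ 2 - 1) := by
        simp only [hβ'def, hβ''def]; ring
      rw [this]
      exact mul_pos hmE (by linarith)
    · have : β' (‖y - x₀‖ ^ 2) + 2 * ‖y - x₀‖ ^ 2 * β'' (‖y - x₀‖ ^ 2)
        = m * α * Real.exp (-α * ‖y - x₀‖ ^ 2) * (2 * (α * ‖y - x₀‖ ^ 2) - 1) := by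
        simp only [hβ'def, hβ''def]; ring
      rw [this]
      exact (mul_pos hmE (by linarith)).le
  -- the normal derivative at the free boundary point
  set v : Plane := x₀ - z with hv
  have hvr : ‖v‖ = r := by rw [hv, ← dist_eq_norm, dist_comm, hzr]
  have hline := hasDerivAt_line (hfc.differentiable (by simp)) z v 0
  rw [zero_smul, add_zero] at hline
  have hder : 0 ≤ fderiv ℝ f z v := by
    by_contra hneg
    push Not at hneg
    have hev : ∀ᶠ t in nhdsWithin (0 : ℝ) (Ioi 0), slope (fun τ : ℝ => f (z + τ • v)) 0 t < 0 :=
      (hasDerivAt_iff_tendsto_slope.1 hline).mono_left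
        (nhdsWithin_mono _ fun x hx => ne_of_gt hx) |>.eventually_lt_const hneg
    have hpos : ∀ᶠ t in nhdsWithin (0 : ℝ) (Ioi 0), t ∈ Ioo (0 : ℝ) (1 - ρ / r) :=
      Ioo_mem_nhdsGT (by rw [sub_pos, div_lt_one hr]; exact hρr)
    obtain ⟨t, ht1, ht0, ht2⟩ := (hev.and hpos).exists
    have hdist : ‖z + t • v - x₀‖ = (1 - t) * r := by
      have e : z + t • v - x₀ = (t - 1) • v := by
        rw [hv]; module
      have ht3 : 0 < ρ / r := by apply div_pos <;> linarith
      rw [e, norm_smul, hvr, Real.norm_eq_abs, abs_of_neg (by linarith)]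
      ring
    have hmem : z + t • v ∈ K := by
      constructor
      · rw [mem_closedBall, dist_eq_norm, hdist]
        nlinarith
      · rw [mem_ball, dist_eq_norm, hdist, not_lt]
        have : ρ / r ≤ 1 - t := by linarith
        rwa [div_le_iff₀ hr] at this
    have := hfK _ hmem
    rw [slope_def_field, zero_smul, add_zero, hfz, sub_zero, sub_zero] at ht1
    have := div_nonneg this ht0.le
    linarith
  have hcomp : fderiv ℝ f z v = (v 0 * pd 0 W z + v 1 * pd 1 W z)
      - 64 * m * Real.exp (-32) := by
    have dW := h.W_differentiable z
    have db : DifferentiableAt ℝ (fun x : Plane => β (‖x - x₀‖ ^ 2)) z :=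
      (hβc.comp (contDiff_norm_sub_sq x₀)).differentiable (by simp) z
    rw [fderiv_apply_eq, hf, pd_sub dW db, pd_sub dW db, pd_radial hβ, pd_radial hβ]
    have hzn : ‖z - x₀‖ = r := by rw [← dist_eq_norm, hzr]
    have hv0 : z 0 - x₀ 0 = - v 0 := by simp [hv]
    have hv1 : z 1 - x₀ 1 = - v 1 := by simp [hv]
    have hvs : v 0 ^ 2 + v 1 ^ 2 = r ^ 2 := by rw [← norm_sq_eq, hvr]
    rw [hzn, hv0, hv1]
    simp only [hβ'def]
    rw [show -α * r ^ 2 = -32 by linarith]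
    linear_combination (-2) * m * α * Real.exp (-32) * hvs - 2 * m * Real.exp (-32) * hαr
  have hcs : v 0 * pd 0 W z + v 1 * pd 1 W z ≤ r := by
    have hvs : v 0 ^ 2 + v 1 ^ 2 = r ^ 2 := by rw [← norm_sq_eq, hvr]
    have hs : pd 0 W z ^ 2 + pd 1 W z ^ 2 = 1 := h.sq_eq_one z hz
    refine abs_le_of_sq_le_sq' ?_ hr.le |>.2
    nlinarith [_root_.sq_nonneg (v 0 * pd 1 W z - v 1 * pd 0 W z)]
  have hE : Real.exp 32 * Real.exp (-32) = 1 := by rw [← Real.exp_add]; simp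
  have hE1 := Real.exp_pos 32
  have : 64 * m * Real.exp (-32) ≤ r := by linarith
  have := mul_le_mul_of_nonneg_left this hE1.le
  nlinarith

/-- The maximum principle on a disc. -/
theorem exists_ge_on_sphere (h : Minimizer F F' F'' c₀ C₀ lam u W) {x₀ : Plane} {ρ : ℝ}
    (hρ : 0 < ρ) (hball : closedBall x₀ ρ ⊆ {y | 0 < u y}) : ∃ y ∈ sphere x₀ ρ, u x₀ ≤ u y := by
  by_contra! hlt
  obtain ⟨w, hw, hwmax⟩ := (isCompact_sphere x₀ ρ).exists_isMaxOn
    (NormedSpace.sphere_nonempty.2 hρ.le) h.lip.continuous.continuousOn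
  set ε : ℝ := (u x₀ - u w) / (2 * ρ ^ 2) with hε
  have hεpos : 0 < ε := div_pos (by linarith [hlt w hw]) (by positivity)
  have hερ : ε * ρ ^ 2 = (u x₀ - u w) / 2 := by rw [hε]; field_simp
  set f : Plane → ℝ := fun x => W x + ε * ‖x - x₀‖ ^ 2 with hf
  have hfc : ContDiff ℝ (⊤ : ℕ∞) f := h.smooth.add (contDiff_const.mul (contDiff_norm_sub_sq x₀))
  obtain ⟨y, hyK, hy⟩ := (isCompact_closedBall x₀ ρ).exists_isMaxOn
    (nonempty_closedBall.2 hρ.le) hfc.continuous.continuousOn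
  have hx0 : x₀ ∈ closedBall x₀ ρ := mem_closedBall_self hρ.le
  have hfy : u x₀ ≤ f y := by
    have : f x₀ ≤ f y := hy hx0
    simpa [hf, h.eq_on x₀ (hball hx0)] using this
  have hyb : y ∈ ball x₀ ρ := by
    rw [mem_ball]
    refine lt_of_le_of_ne hyK fun he => ?_
    have h1 : u y ≤ u w := hwmax (mem_sphere.2 he)
    simp only [hf] at hfy
    rw [← dist_eq_norm, he, hερ, h.eq_on y (hball hyK)] at hfy
    linarith [hlt w hw]
  have hloc : IsLocalMin (fun x => - f x) y :=
    (hy.isLocalMax (Filter.mem_of_superset (isOpen_ball.mem_nhds hyb) ball_subset_closedBall)).neg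
  obtain ⟨hg, hH⟩ := hess_nonneg_of_isLocalMin hfc.neg hloc
  have hβ : ∀ t, HasDerivAt (fun t => ε * t) ((fun _ => ε) t) t := fun t => by
    simpa using (hasDerivAt_id t).const_mul ε
  have hβ' : ∀ t : ℝ, HasDerivAt (fun _ => ε) ((fun _ => (0 : ℝ)) t) t := fun t =>
    hasDerivAt_const t ε
  have hb : ContDiff ℝ (⊤ : ℕ∞) fun x : Plane => ε * ‖x - x₀‖ ^ 2 :=
    contDiff_const.mul (contDiff_norm_sub_sq x₀)
  have dW := h.W_differentiable
  have db := hb.differentiable (by simp)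
  have e1 : ∀ i, (pd i fun x => -f x)
      = fun x => -(pd i W x + pd i (fun x => ε * ‖x - x₀‖ ^ 2) x) := fun i =>
    funext fun x => by rw [pd_neg, hf, pd_add (dW x) (db x) i]
  have e2 : ∀ i j x, pd j (pd i fun x => - f x) x
      = -(pd j (pd i W) x + pd j (pd i fun x => ε * ‖x - x₀‖ ^ 2) x) := fun i j x => by
    rw [e1, pd_neg, pd_add ((h.contDiff_p i).differentiable (by simp) x)
      ((contDiff_pd hb i).differentiable (by simp) x)]
  have e3 : ∀ i j x, pd j (pd i fun x => ε * ‖x - x₀‖ ^ 2) x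
      = 2 * ε * if j = i then 1 else 0 := fun i j x => by
    have := pd_pd_radial hβ hβ' x₀ i j x
    simpa using this
  simp only [e2, e3] at hH
  have hyu := hball hyK
  have hEL := h.euler_lagrange hyu
  have hs := sq_nonneg W y
  have hF := h.le_deriv _ hs
  have hF2 := h.deriv2_nonneg _ hs
  have hc := h.c₀_pos
  have t0 := hH 1 0
  have t1 := hH 0 1
  have tp := hH (pd 0 W y) (pd 1 W y)
  simp at t0 t1 tp
  have hq : pd 0 W y ^ 2 * pd 0 (pd 0 W) y + 2 * pd 0 W y * pd 1 W y * pd 0 (pd 1 W) y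
        + pd 1 W y ^ 2 * pd 1 (pd 1 W) y ≤ 0 := by
    nlinarith [_root_.sq_nonneg (pd 0 W y), _root_.sq_nonneg (pd 1 W y)]
  have htr : pd 0 (pd 0 W) y + pd 1 (pd 1 W) y < 0 := by linarith
  have := mul_neg_of_pos_of_neg (hc.trans_le hF) htr
  have := mul_nonpos_of_nonneg_of_nonpos hF2 hq
  linarith

end Minimizer
/-- The point of the circle of radius `ρ` and centre `x₀` at angle `θ`. -/
noncomputable def circ (x₀ : Plane) (ρ θ : ℝ) : Plane :=
  x₀ + ρ • !₂[Real.cos θ, Real.sin θ]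

theorem circ_zero (x₀ : Plane) (ρ θ : ℝ) : circ x₀ ρ θ 0 = x₀ 0 + ρ * Real.cos θ := by
  simp [circ]

theorem circ_one (x₀ : Plane) (ρ θ : ℝ) : circ x₀ ρ θ 1 = x₀ 1 + ρ * Real.sin θ := by
  simp [circ]

theorem dist_circ (x₀ : Plane) {ρ : ℝ} (hρ : 0 ≤ ρ) (θ : ℝ) : dist (circ x₀ ρ θ) x₀ = ρ := by
  rw [dist_eq_norm]
  refine (pow_left_inj₀ (norm_nonneg _) hρ two_ne_zero).1 ?_
  rw [norm_sq_eq]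
  simp only [PiLp.sub_apply, circ_zero, circ_one]
  nlinarith [Real.cos_sq_add_sin_sq θ]

theorem exists_circ_eq {x₀ y : Plane} {ρ : ℝ} (hy : y ∈ sphere x₀ ρ) :
    ∃ θ ∈ Icc (-Real.pi) Real.pi, circ x₀ ρ θ = y := by
  set z : ℂ := ⟨y 0 - x₀ 0, y 1 - x₀ 1⟩ with hz
  have hn : ‖z‖ = ρ := by
    have h0 : 0 ≤ ρ := (mem_sphere.1 hy) ▸ dist_nonneg
    refine (pow_left_inj₀ (norm_nonneg _) h0 two_ne_zero).1 ?_
    rw [← mem_sphere.1 hy, dist_eq_norm, norm_sq_eq, Complex.sq_norm, Complex.normSq_apply]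
    simp [hz, pow_two]
  refine ⟨z.arg, ⟨(Complex.neg_pi_lt_arg z).le, Complex.arg_le_pi z⟩, ?_⟩
  ext i
  fin_cases i
  · have := Complex.norm_mul_cos_arg z
    rw [hn] at this
    simp only [Fin.zero_eta, circ_zero, this]
    simp [hz]
  · have := Complex.norm_mul_sin_arg z
    rw [hn] at this
    simp only [Fin.mk_one, circ_one, this]
    simp [hz]

theorem continuous_circ (x₀ : Plane) : Continuous fun p : ℝ × ℝ => circ x₀ p.1 p.2 := by
  unfold circ
  fun_prop

theorem hasDerivAt_comp_circ {f : Plane → ℝ} (x₀ : Plane) (ρ θ : ℝ)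
    (hf : DifferentiableAt ℝ f (circ x₀ ρ θ)) :
    HasDerivAt (fun θ => f (circ x₀ ρ θ))
      (-(ρ * Real.sin θ) * pd 0 f (circ x₀ ρ θ) + ρ * Real.cos θ * pd 1 f (circ x₀ ρ θ)) θ := by
  have h1 : HasDerivAt (circ x₀ ρ) (!₂[-(ρ * Real.sin θ), ρ * Real.cos θ]) θ := by
    rw [← hasDerivWithinAt_univ, hasDerivWithinAt_iff_hasFDerivWithinAt,
      hasFDerivWithinAt_euclidean]
    intro i
    rw [hasFDerivWithinAt_univ, hasFDerivAt_iff_hasDerivAt]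
    fin_cases i
    · simpa [circ_zero] using ((Real.hasDerivAt_cos θ).const_mul ρ).const_add (x₀ 0)
    · simpa [circ_one] using ((Real.hasDerivAt_sin θ).const_mul ρ).const_add (x₀ 1)
  have h2 := hf.hasFDerivAt.comp_hasDerivAt θ h1
  rw [fderiv_apply_eq] at h2
  exact h2

theorem lintegral_polar (x₀ : Plane) {f : Plane → ENNReal} (hf : Measurable f) :
    ∫⁻ x, f x = ∫⁻ ρ in Ioi (0 : ℝ), ∫⁻ θ in Ioo (-Real.pi) Real.pi,
      ENNReal.ofReal ρ * f (circ x₀ ρ θ) := by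
  have hm : Measurable fun p : ℝ × ℝ => ENNReal.ofReal p.1 * f (circ x₀ p.1 p.2) :=
    (ENNReal.measurable_ofReal.comp measurable_fst).mul
      (hf.comp (continuous_circ x₀).measurable)
  rw [← lintegral_add_left_eq_self f x₀,
    ← (PiLp.volume_preserving_toLp (Fin 2)).lintegral_comp_emb
      (MeasurableEquiv.toLp 2 (Fin 2 → ℝ)).measurableEmbedding,
    ← ((volume_preserving_finTwoArrow ℝ).symm _).lintegral_comp_emb
      (MeasurableEquiv.finTwoArrow (α := ℝ)).symm.measurableEmbedding,
    ← lintegral_comp_polarCoord_symm, polarCoord_target, Measure.volume_eq_prod,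
    setLIntegral_prod _ ?_]
  · refine lintegral_congr fun ρ => lintegral_congr fun θ => ?_
    simp only [smul_eq_mul, circ]
    congr 3
    ext i
    fin_cases i <;> simp [MeasurableEquiv.finTwoArrow]
  · refine Measurable.aemeasurable ?_
    convert hm using 2 with p
    simp only [smul_eq_mul, circ]
    congr 3
    ext i
    fin_cases i <;> simp [MeasurableEquiv.finTwoArrow]

/-- A lower bound for an integral from lower bounds on the concentric circles. -/
theorem le_integral_of_le_circ (x₀ : Plane) {f : Plane → ℝ} (hf : Continuous f)
    (hf0 : ∀ x, 0 ≤ f x) (hfi : Integrable f) {a b k : ℝ} (ha : 0 ≤ a) (hk : 0 ≤ k)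
    (h : ∀ ρ ∈ Ioo a b, k ≤ ∫ θ in (-Real.pi)..Real.pi, ρ * f (circ x₀ ρ θ)) :
    k * (b - a) ≤ ∫ x, f x := by
  rw [← ENNReal.ofReal_le_ofReal_iff (integral_nonneg hf0),
    ofReal_integral_eq_lintegral_ofReal hfi (.of_forall hf0),
    lintegral_polar x₀ (f := fun x => ENNReal.ofReal (f x))
      (ENNReal.measurable_ofReal.comp hf.measurable)]
  calc ENNReal.ofReal (k * (b - a)) = ∫⁻ _ in Ioo a b, ENNReal.ofReal k := by
        rw [setLIntegral_const, Real.volume_Ioo, ENNReal.ofReal_mul hk]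
    _ ≤ ∫⁻ ρ in Ioo a b, ∫⁻ θ in Ioo (-Real.pi) Real.pi,
          ENNReal.ofReal ρ * ENNReal.ofReal (f (circ x₀ ρ θ)) := by
        refine setLIntegral_mono' measurableSet_Ioo fun ρ hρ => ?_
        have hρ0 : 0 ≤ ρ := ha.trans hρ.1.le
        have hc : Continuous fun θ => ρ * f (circ x₀ ρ θ) :=
          continuous_const.mul (hf.comp ((continuous_circ x₀).comp (by fun_prop :
            Continuous fun θ : ℝ => (ρ, θ))))
        refine (ENNReal.ofReal_le_ofReal (h ρ hρ)).trans ?_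
        rw [intervalIntegral.integral_of_le (by linarith [Real.pi_pos]),
          integral_Ioc_eq_integral_Ioo, ofReal_integral_eq_lintegral_ofReal
          ((hc.integrableOn_Icc).mono_set Ioo_subset_Icc_self)
          (.of_forall fun θ => mul_nonneg hρ0 (hf0 _))]
        exact lintegral_mono fun θ => (ENNReal.ofReal_mul hρ0).le
    _ ≤ _ := lintegral_mono_set fun ρ hρ => ha.trans_lt hρ.1

/-- The oscillation of a `C¹` function is controlled by the energy of its derivative. -/
theorem sub_le_of_energy {g g' : ℝ → ℝ} {a b : ℝ} (hab : a ≤ b)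
    (hg : ∀ t ∈ Icc a b, HasDerivAt g (g' t) t)
    (hc : ContinuousOn g' (Icc a b)) {s t : ℝ} (hs : s ∈ Icc a b) (ht : t ∈ Icc a b) :
    g t - g s ≤ (b - a) / 2 + (∫ x in a..b, g' x ^ 2) / 2 := by
  have hsub : uIcc s t ⊆ Icc a b := uIcc_subset_Icc hs ht
  have hi : IntervalIntegrable g' volume s t := (hc.mono hsub).intervalIntegrable
  rw [← intervalIntegral.integral_eq_sub_of_hasDerivAt (fun x hx => hg x (hsub hx)) hi]
  have hI : IntegrableOn (fun x => (1 + g' x ^ 2) / 2) (Ioc a b) :=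
    (((continuousOn_const.add (hc.pow 2)).div_const 2).integrableOn_Icc).mono_set
      Ioc_subset_Icc_self
  have h2 : IntervalIntegrable (fun x => g' x ^ 2) volume a b :=
    (((hc.pow 2).mono (by rw [uIcc_of_le hab])).intervalIntegrable)
  calc ∫ x in s..t, g' x ≤ ‖∫ x in s..t, g' x‖ := le_abs_self _
    _ ≤ ∫ x in uIoc s t, ‖g' x‖ := intervalIntegral.norm_integral_le_integral_norm_uIoc
    _ ≤ ∫ x in uIoc s t, (1 + g' x ^ 2) / 2 := by
        have hsub' : uIoc s t ⊆ Ioc a b := by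
          rw [uIoc]; exact Ioc_subset_Ioc (le_min hs.1 ht.1) (max_le hs.2 ht.2)
        refine setIntegral_mono (intervalIntegrable_iff.1 hi).norm (hI.mono_set hsub') fun x => ?_
        have : |g' x| ^ 2 = g' x ^ 2 := sq_abs _
        simp only [Real.norm_eq_abs]
        nlinarith [_root_.sq_nonneg (|g' x| - 1)]
    _ ≤ ∫ x in Ioc a b, (1 + g' x ^ 2) / 2 := by
        refine setIntegral_mono_set hI (.of_forall fun x => by positivity) ?_
        exact (Ioc_subset_Ioc (le_min hs.1 ht.1) (max_le hs.2 ht.2)).eventuallyLE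
    _ = _ := by
        rw [← intervalIntegral.integral_of_le hab, intervalIntegral.integral_div,
          intervalIntegral.integral_add intervalIntegrable_const h2]
        simp
        ring

namespace Minimizer

variable {F F' F'' : ℝ → ℝ} {c₀ C₀ lam : ℝ} {u W : Plane → ℝ}

/-- Caccioppoli estimate for `log u`. -/
theorem log_caccioppoli (h : Minimizer F F' F'' c₀ C₀ lam u W) {ζ : Plane → ℝ}
    (hζ : ContDiff ℝ (⊤ : ℕ∞) ζ) (hcs : HasCompactSupport ζ) (hsub : tsupport ζ ⊆ {y | 0 < u y}) :
    Continuous (fun x => ζ x ^ 2 * (sq W x * ((W x)⁻¹) ^ 2)) ∧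
    Integrable (fun x => ζ x ^ 2 * (sq W x * ((W x)⁻¹) ^ 2)) ∧
    c₀ * ∫ x, ζ x ^ 2 * (sq W x * ((W x)⁻¹) ^ 2)
      ≤ 4 * C₀ * ∫ x, (pd 0 ζ x ^ 2 + pd 1 ζ x ^ 2) := by
  have hζ2 : ContDiff ℝ (⊤ : ℕ∞) fun x => ζ x ^ 2 := hζ.pow 2
  have hcs2 : HasCompactSupport fun x => ζ x ^ 2 :=
    hcs.comp_left (g := fun t : ℝ => t ^ 2) (by simp)
  have hsub2 : tsupport (fun x => ζ x ^ 2) ⊆ {y | 0 < u y} := by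
    refine (closure_mono fun x hx => ?_).trans hsub
    simpa using hx
  have hinv : ∀ x, 0 < u x → ContDiffAt ℝ (⊤ : ℕ∞) (fun x => (W x)⁻¹) x := fun x hx =>
    h.smooth.contDiffAt.inv (h.W_pos hx).ne'
  have hφ : ContDiff ℝ (⊤ : ℕ∞) fun x => ζ x ^ 2 * (W x)⁻¹ :=
    contDiff_mul_of_tsupport hζ2 fun x hx => hinv x (hsub2 hx)
  have hG : ContDiff ℝ (⊤ : ℕ∞) fun x => ζ x ^ 2 * (sq W x * ((W x)⁻¹) ^ 2) :=
    contDiff_mul_of_tsupport hζ2 fun x hx =>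
      h.contDiff_sq.contDiffAt.mul ((hinv x (hsub2 hx)).pow 2)
  have hGi : Integrable (fun x => ζ x ^ 2 * (sq W x * ((W x)⁻¹) ^ 2)) :=
    hG.continuous.integrable_of_hasCompactSupport hcs2.mul_right
  refine ⟨hG.continuous, hGi, ?_⟩
  have hφsub : tsupport (fun x => ζ x ^ 2 * (W x)⁻¹) ⊆ {y | 0 < u y} :=
    (tsupport_mul_subset_left (f := fun x => ζ x ^ 2)).trans hsub2
  have hwel := h.weak_euler_lagrange (hφ.of_le (by simp)) hcs2.mul_right hφsub
  have c0 := continuous_pd (smooth_of_le hζ) 0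
  have c1 := continuous_pd (smooth_of_le hζ) 1
  have i0 : Integrable fun x => pd 0 ζ x ^ 2 + pd 1 ζ x ^ 2 := by
    refine (Continuous.integrable_of_hasCompactSupport (by fun_prop) ?_)
    exact ((hasCompactSupport_pd hcs 0).comp_left (g := fun t : ℝ => t ^ 2) (by simp)).add
      ((hasCompactSupport_pd hcs 1).comp_left (g := fun t : ℝ => t ^ 2) (by simp))
  have key : ∀ x, c₀ * (ζ x ^ 2 * (sq W x * ((W x)⁻¹) ^ 2)) / 2 +
      F' (sq W x) * (pd 0 W x * pd 0 (fun x => ζ x ^ 2 * (W x)⁻¹) x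
        + pd 1 W x * pd 1 (fun x => ζ x ^ 2 * (W x)⁻¹) x)
      ≤ 2 * C₀ * (pd 0 ζ x ^ 2 + pd 1 ζ x ^ 2) := by
    intro x
    by_cases hx : 0 < u x
    · have hp : ∀ i, pd i (fun x => ζ x ^ 2 * (W x)⁻¹) x
          = 2 * ζ x * pd i ζ x * (W x)⁻¹ - ζ x ^ 2 * (((W x)⁻¹) ^ 2 * pd i W x) := fun i => by
        have e1 : pd i (fun x => (W x)⁻¹) x = -((W x)⁻¹) ^ 2 * pd i W x := by
          rw [pd_comp (hasDerivAt_inv (h.W_pos hx).ne') (h.W_differentiable x)]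
          simp
        rw [pd_mul (hζ2.differentiable (by simp) x) ((hinv x hx).differentiableAt (by simp)),
          pd_sq (hζ.differentiable (by simp) x), e1]
        ring
      rw [hp, hp]
      have hF1 := h.le_deriv _ (sq_nonneg W x)
      have hF2 := h.deriv_le _ (sq_nonneg W x)
      have hc := h.c₀_pos
      set v := (W x)⁻¹
      set f := F' (sq W x)
      have hA : (pd 0 W x * (2 * ζ x * pd 0 ζ x * v - ζ x ^ 2 * (v ^ 2 * pd 0 W x))
        + pd 1 W x * (2 * ζ x * pd 1 ζ x * v - ζ x ^ 2 * (v ^ 2 * pd 1 W x)))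
        ≤ 2 * (pd 0 ζ x ^ 2 + pd 1 ζ x ^ 2) - ζ x ^ 2 * (sq W x * v ^ 2) / 2 := by
        simp only [sq]
        nlinarith [_root_.sq_nonneg (2 * pd 0 ζ x - ζ x * v * pd 0 W x),
          _root_.sq_nonneg (2 * pd 1 ζ x - ζ x * v * pd 1 W x)]
      have hB := mul_le_mul_of_nonneg_left hA (hc.le.trans hF1)
      have hs : 0 ≤ ζ x ^ 2 * (sq W x * v ^ 2) := by
        have := sq_nonneg W x
        positivity
      have hd : 0 ≤ pd 0 ζ x ^ 2 + pd 1 ζ x ^ 2 := by positivity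
      nlinarith [mul_le_mul_of_nonneg_right hF1 hs, mul_le_mul_of_nonneg_right hF2 hd]
    · have h1 : ζ x = 0 := by
        by_contra hne
        exact hx (hsub (subset_tsupport _ hne))
      have h2 : ∀ i, pd i (fun x => ζ x ^ 2 * (W x)⁻¹) x = 0 := fun i =>
        pd_eq_zero_of_notMem_tsupport (fun hm => hx (hφsub hm)) i
      rw [h1, h2, h2]
      have := h.C₀_pos
      simp
      positivity
  have hφi : Integrable fun x => F' (sq W x) * (pd 0 W x * pd 0 (fun x => ζ x ^ 2 * (W x)⁻¹) x
        + pd 1 W x * pd 1 (fun x => ζ x ^ 2 * (W x)⁻¹) x) := by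
    have cF : Continuous fun x => F' (sq W x) := h.continuous_F'.comp h.continuous_sq
    have d0 := continuous_pd (smooth_of_le hφ) 0
    have d1 := continuous_pd (smooth_of_le hφ) 1
    have p0 := h.continuous_p 0
    have p1 := h.continuous_p 1
    refine Continuous.integrable_of_hasCompactSupport
      (cF.mul ((p0.mul d0).add (p1.mul d1))) ?_
    exact ((hasCompactSupport_pd hcs2.mul_right 0).mul_left.add
      (hasCompactSupport_pd hcs2.mul_right 1).mul_left).mul_left
  have := integral_mono (((hGi.const_mul c₀).div_const 2).add hφi) (i0.const_mul (2 * C₀)) key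
  rw [integral_add' ((hGi.const_mul c₀).div_const 2) hφi, hwel, integral_div, integral_const_mul,
    integral_const_mul] at this
  linarith

end Minimizer
theorem measureReal_closedBall (x : Plane) {r : ℝ} (hr : 0 ≤ r) :
    volume.real (closedBall x r) = Real.pi * r ^ 2 := by
  rw [measureReal_def, EuclideanSpace.volume_closedBall_fin_two, ENNReal.toReal_mul,
    ENNReal.toReal_pow, ENNReal.toReal_ofReal hr, ENNReal.toReal_ofReal Real.pi_pos.le, mul_comm]

/-- A cutoff function between concentric balls with scale invariant energy. -/
theorem exists_cutoff : ∃ M, ∀ (x₀ : Plane) (r : ℝ), 0 < r → ∃ ζ : Plane → ℝ,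
    ContDiff ℝ (⊤ : ℕ∞) ζ ∧ HasCompactSupport ζ ∧ tsupport ζ ⊆ ball x₀ r ∧
    (∀ x, dist x x₀ ≤ r / 2 → ζ x = 1) ∧ ∫ x, (pd 0 ζ x ^ 2 + pd 1 ζ x ^ 2) ≤ M := by
  obtain ⟨K, hK, -⟩ := exists_deriv_smoothTransition_bound
  refine ⟨64 * K ^ 2 * Real.pi, fun x₀ r hr => ?_⟩
  set β : ℝ → ℝ := fun t => Real.smoothTransition (2 - 4 / r ^ 2 * t) with hβ
  have hβd : ∀ t, HasDerivAt β (deriv Real.smoothTransition (2 - 4 / r ^ 2 * t) * -(4 / r ^ 2)) t :=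
    fun t => by
    have h1 : HasDerivAt (fun t => 2 - 4 / r ^ 2 * t) (-(4 / r ^ 2)) t := by
      simpa using ((hasDerivAt_id t).const_mul (4 / r ^ 2)).const_sub 2
    exact ((Real.smoothTransition.contDiff (n := 1)).differentiable (by simp)
      _).hasDerivAt.comp t h1
  have hβc : ContDiff ℝ (⊤ : ℕ∞) β :=
    Real.smoothTransition.contDiff.comp (contDiff_const.sub (contDiff_const.mul contDiff_id))
  have hζ : ContDiff ℝ (⊤ : ℕ∞) fun x : Plane => β (‖x - x₀‖ ^ 2) :=
    hβc.comp (contDiff_norm_sub_sq x₀)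
  have hts : tsupport (fun x : Plane => β (‖x - x₀‖ ^ 2)) ⊆ {x | ‖x - x₀‖ ^ 2 ≤ r ^ 2 / 2} := by
    refine closure_minimal (fun x hx => ?_)
      (isClosed_le (contDiff_norm_sub_sq x₀).continuous continuous_const)
    by_contra hlt
    refine hx (Real.smoothTransition.zero_of_nonpos ?_)
    have : r ^ 2 / 2 < ‖x - x₀‖ ^ 2 := not_le.1 hlt
    have h2 : 4 / r ^ 2 * (r ^ 2 / 2) = 2 := by field_simp; norm_num
    nlinarith [mul_lt_mul_of_pos_left this (show 0 < 4 / r ^ 2 by positivity)]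
  have hts' : tsupport (fun x : Plane => β (‖x - x₀‖ ^ 2)) ⊆ ball x₀ r := fun x hx => by
    rw [mem_ball, dist_eq_norm]
    have : ‖x - x₀‖ ^ 2 ≤ r ^ 2 / 2 := hts hx
    nlinarith [norm_nonneg (x - x₀)]
  refine ⟨_, hζ, ?_, hts', fun x hx => Real.smoothTransition.one_of_one_le ?_, ?_⟩
  · exact (isCompact_closedBall x₀ r).of_isClosed_subset (isClosed_tsupport _)
      (hts'.trans ball_subset_closedBall)
  · have h1 : ‖x - x₀‖ ^ 2 ≤ (r / 2) ^ 2 := by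
      rw [← dist_eq_norm]; exact pow_le_pow_left₀ dist_nonneg hx 2
    have h2 : 4 / r ^ 2 * (r / 2) ^ 2 = 1 := by field_simp; norm_num
    nlinarith [mul_le_mul_of_nonneg_left h1 (show 0 ≤ 4 / r ^ 2 by positivity)]
  · have hpt : ∀ x ∈ closedBall x₀ r, pd 0 (fun x : Plane => β (‖x - x₀‖ ^ 2)) x ^ 2
        + pd 1 (fun x : Plane => β (‖x - x₀‖ ^ 2)) x ^ 2 ≤ 64 * K ^ 2 / r ^ 2 := fun x hx => by
      rw [pd_radial hβd, pd_radial hβd]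
      have hD := hK (2 - 4 / r ^ 2 * ‖x - x₀‖ ^ 2)
      set D := deriv Real.smoothTransition (2 - 4 / r ^ 2 * ‖x - x₀‖ ^ 2)
      have hD2 : D ^ 2 ≤ K ^ 2 := sq_le_sq' (abs_le.1 hD).1 (abs_le.1 hD).2
      have hx2 : ‖x - x₀‖ ^ 2 ≤ r ^ 2 := by
        rw [← dist_eq_norm]; exact pow_le_pow_left₀ dist_nonneg hx 2
      have hn := norm_sq_eq (x - x₀)
      simp only [PiLp.sub_apply] at hn
      calc _ = 64 / r ^ 4 * (D ^ 2 * ‖x - x₀‖ ^ 2) := by rw [hn]; field_simp; ring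
        _ ≤ 64 / r ^ 4 * (K ^ 2 * r ^ 2) := by gcongr
        _ = _ := by field_simp
    have hz : ∀ x, x ∉ closedBall x₀ r → pd 0 (fun x : Plane => β (‖x - x₀‖ ^ 2)) x ^ 2
        + pd 1 (fun x : Plane => β (‖x - x₀‖ ^ 2)) x ^ 2 = 0 := fun x hx => by
      have : x ∉ tsupport (fun x : Plane => β (‖x - x₀‖ ^ 2)) := fun hm =>
        hx (ball_subset_closedBall (hts' hm))
      simp [pd_eq_zero_of_notMem_tsupport this]
    rw [← setIntegral_eq_integral_of_forall_compl_eq_zero hz]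
    have c0 := continuous_pd (smooth_of_le hζ) 0
    have c1 := continuous_pd (smooth_of_le hζ) 1
    calc _ ≤ ∫ _ in closedBall x₀ r, 64 * K ^ 2 / r ^ 2 :=
          setIntegral_mono_on (((c0.pow 2).add (c1.pow 2)).continuousOn.integrableOn_compact
            (isCompact_closedBall x₀ r)) (integrableOn_const measure_closedBall_lt_top.ne)
            measurableSet_closedBall hpt
      _ = _ := by
          rw [setIntegral_const, measureReal_closedBall x₀ hr.le, smul_eq_mul]
          field_simp

namespace Minimizer

variable {F F' F'' : ℝ → ℝ} {c₀ C₀ lam : ℝ} {u W : Plane → ℝ}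

/-- Linear growth of a minimizer away from its free boundary. -/
theorem exists_linear_growth (h : Minimizer F F' F'' c₀ C₀ lam u W) :
    ∃ C > 0, ∀ x₀, ∀ z ∈ frontier {y | 0 < u y}, u x₀ ≤ C * dist z x₀ := by
  obtain ⟨M, hM⟩ := exists_cutoff
  set E := Real.exp 32 / 64
  set N := 4 * C₀ * M / c₀ with hN
  have hE : 0 < E := by positivity
  refine ⟨E * Real.exp (Real.pi + N), by positivity, fun x₀ z' hz' => ?_⟩
  by_cases hx0 : 0 < u x₀
  swap
  · have : u x₀ ≤ 0 := not_lt.1 hx0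
    exact this.trans (by positivity)
  obtain ⟨z, hz, hzr⟩ := (isClosed_frontier (s := {y | 0 < u y})).exists_infDist_eq_dist
    ⟨z', hz'⟩ x₀
  set r := infDist x₀ (frontier {y | 0 < u y}) with hr
  suffices hmain : u x₀ ≤ E * Real.exp (Real.pi + N) * r by
    refine hmain.trans (mul_le_mul_of_nonneg_left ?_ (by positivity))
    rw [dist_comm]
    exact infDist_le_dist_of_mem hz'
  have hrpos : 0 < r := by
    rw [hzr, dist_pos]
    rintro rfl
    exact hx0.ne' (h.u_eq_zero_of_frontier hz)
  have hball : ball x₀ r ⊆ {y | 0 < u y} := fun y hy => by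
    by_contra hyn
    obtain ⟨q, hqb, hq⟩ := inter_frontier_nonempty (convex_ball x₀ r).isPreconnected
      (mem_ball_self hrpos) hx0 hy hyn
    have h1 : r ≤ dist x₀ q := infDist_le_dist_of_mem hq
    rw [mem_ball, dist_comm] at hqb
    linarith
  obtain ⟨ζ, hζ, hcs, hts, hζ1, hζe⟩ := hM x₀ r hrpos
  obtain ⟨hGc, hGi, hGe⟩ := h.log_caccioppoli hζ hcs (hts.trans hball)
  have hGN : ∫ x, ζ x ^ 2 * (sq W x * ((W x)⁻¹) ^ 2) ≤ N := by
    rw [hN, le_div_iff₀ h.c₀_pos, mul_comm]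
    exact hGe.trans (mul_le_mul_of_nonneg_left hζe (by linarith [h.C₀_pos]))
  set k := Real.log (u x₀) - Real.log (E * r) - Real.pi with hk
  suffices hkN : k ≤ N by
    have : Real.log (u x₀) ≤ Real.log (E * r) + (Real.pi + N) := by linarith
    have h2 := Real.exp_le_exp.2 this
    rw [Real.exp_log hx0, Real.exp_add, Real.exp_log (by positivity)] at h2
    linarith
  have hG0 : ∀ x, 0 ≤ ζ x ^ 2 * (sq W x * ((W x)⁻¹) ^ 2) := fun x =>
    mul_nonneg (by positivity) (mul_nonneg (sq_nonneg W x) (by positivity))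
  rcases lt_or_ge k 0 with hk0 | hk0
  · exact hk0.le.trans ((integral_nonneg hG0).trans hGN)
  have hlow := le_integral_of_le_circ x₀ hGc hG0 hGi (a := r / 4) (b := r / 2) (k := 4 * k / r)
    (by positivity) (by positivity) ?_
  · have : 4 * k / r * (r / 2 - r / 4) = k := by field_simp; ring
    linarith
  rintro ρ ⟨hρ1, hρ2⟩
  have hρ : 0 < ρ := by linarith
  have hcb : closedBall x₀ ρ ⊆ {y | 0 < u y} :=
    (closedBall_subset_ball (by linarith)).trans hball
  have hcu : ∀ θ, 0 < u (circ x₀ ρ θ) := fun θ => hcb (dist_circ x₀ hρ.le θ).le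
  obtain ⟨y, hy, hyu⟩ := h.exists_ge_on_sphere hρ hcb
  obtain ⟨m, hm, hmmin⟩ := (isCompact_sphere x₀ ρ).exists_isMinOn ⟨y, hy⟩
    h.lip.continuous.continuousOn
  have hmpos : 0 < u m := hcb (sphere_subset_closedBall hm)
  have hmle : u m ≤ E * r := h.le_of_le_on_sphere hrpos hball hz
    (by rw [dist_comm]; exact hzr.symm) hρ1.le (by linarith) hmpos fun y hy => hmmin hy
  obtain ⟨θ₁, hθ₁, rfl⟩ := exists_circ_eq hy
  obtain ⟨θ₂, hθ₂, rfl⟩ := exists_circ_eq hm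
  have hcc : Continuous fun θ => circ x₀ ρ θ :=
    (continuous_circ x₀).comp (by fun_prop : Continuous fun θ : ℝ => (ρ, θ))
  have hosc := sub_le_of_energy (g := fun θ => Real.log (W (circ x₀ ρ θ)))
    (g' := fun θ => (-(ρ * Real.sin θ) * pd 0 W (circ x₀ ρ θ)
      + ρ * Real.cos θ * pd 1 W (circ x₀ ρ θ)) / W (circ x₀ ρ θ))
    (a := -Real.pi) (b := Real.pi) (by linarith [Real.pi_pos])
    (fun θ _ => (hasDerivAt_comp_circ x₀ ρ θ (h.W_differentiable _)).log
      (h.W_pos (hcu θ)).ne') ?_ hθ₂ hθ₁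
  swap
  · have p0 := (h.continuous_p 0).comp hcc
    have p1 := (h.continuous_p 1).comp hcc
    have pw := h.smooth.continuous.comp hcc
    refine Continuous.continuousOn (Continuous.div ?_ pw fun θ => (h.W_pos (hcu θ)).ne')
    exact ((by fun_prop : Continuous fun θ => -(ρ * Real.sin θ)).mul p0).add
      ((by fun_prop : Continuous fun θ => ρ * Real.cos θ).mul p1)
  have hle : ∫ θ in (-Real.pi)..Real.pi, ((-(ρ * Real.sin θ) * pd 0 W (circ x₀ ρ θ)
      + ρ * Real.cos θ * pd 1 W (circ x₀ ρ θ)) / W (circ x₀ ρ θ)) ^ 2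
      ≤ ∫ θ in (-Real.pi)..Real.pi, r / 2 * (ρ * (ζ (circ x₀ ρ θ) ^ 2 *
        (sq W (circ x₀ ρ θ) * ((W (circ x₀ ρ θ))⁻¹) ^ 2))) := by
    refine intervalIntegral.integral_mono_on (by linarith [Real.pi_pos]) ?_ ?_ fun θ _ => ?_
    · have p0 := (h.continuous_p 0).comp hcc
      have p1 := (h.continuous_p 1).comp hcc
      have pw := h.smooth.continuous.comp hcc
      refine Continuous.intervalIntegrable (Continuous.pow (Continuous.div ?_ pw
        fun θ => (h.W_pos (hcu θ)).ne') 2) _ _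
      exact ((by fun_prop : Continuous fun θ => -(ρ * Real.sin θ)).mul p0).add
        ((by fun_prop : Continuous fun θ => ρ * Real.cos θ).mul p1)
    · exact (continuous_const.mul (continuous_const.mul (hGc.comp hcc))).intervalIntegrable _ _
    · rw [hζ1 _ (by rw [dist_circ x₀ hρ.le]; exact hρ2.le), div_eq_mul_inv, mul_pow]
      have hcs := Real.cos_sq_add_sin_sq θ
      set a := pd 0 W (circ x₀ ρ θ)
      set b := pd 1 W (circ x₀ ρ θ)
      have hab : (-(ρ * Real.sin θ) * a + ρ * Real.cos θ * b) ^ 2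
          ≤ ρ ^ 2 * sq W (circ x₀ ρ θ) := by
        have : ρ ^ 2 * sq W (circ x₀ ρ θ) - (-(ρ * Real.sin θ) * a + ρ * Real.cos θ * b) ^ 2
            = ρ ^ 2 * (a * Real.cos θ + b * Real.sin θ) ^ 2 := by
          rw [show sq W (circ x₀ ρ θ) = (a ^ 2 + b ^ 2) * (Real.cos θ ^ 2 + Real.sin θ ^ 2) by
            rw [hcs, mul_one]; rfl]
          ring
        have h0 : 0 ≤ ρ ^ 2 * (a * Real.cos θ + b * Real.sin θ) ^ 2 := by positivity
        linarith
      have hsn : 0 ≤ sq W (circ x₀ ρ θ) := sq_nonneg W _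
      calc _ ≤ ρ ^ 2 * sq W (circ x₀ ρ θ) * ((W (circ x₀ ρ θ))⁻¹) ^ 2 :=
            mul_le_mul_of_nonneg_right hab (by positivity)
        _ = ρ * (ρ * (sq W (circ x₀ ρ θ) * ((W (circ x₀ ρ θ))⁻¹) ^ 2)) := by ring
        _ ≤ r / 2 * (ρ * (sq W (circ x₀ ρ θ) * ((W (circ x₀ ρ θ))⁻¹) ^ 2)) :=
            mul_le_mul_of_nonneg_right hρ2.le (by positivity)
        _ = _ := by ring
  rw [intervalIntegral.integral_const_mul] at hle
  have hl1 : Real.log (u x₀) ≤ Real.log (W (circ x₀ ρ θ₁)) := by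
    rw [h.eq_on _ (hcu θ₁)]; exact Real.log_le_log hx0 hyu
  have hl2 : Real.log (W (circ x₀ ρ θ₂)) ≤ Real.log (E * r) := by
    rw [h.eq_on _ (hcu θ₂)]; exact Real.log_le_log hmpos hmle
  rw [div_le_iff₀ hrpos]
  linarith

/-- A minimizer with nonempty free boundary grows at most linearly. -/
theorem exists_sq_le (h : Minimizer F F' F'' c₀ C₀ lam u W)
    (hne : (frontier {y | 0 < u y}).Nonempty) : ∃ C > 0, ∀ x, u x ^ 2 ≤ C * (1 + ‖x‖ ^ 2) := by
  obtain ⟨C, hC, hg⟩ := h.exists_linear_growth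
  obtain ⟨z, hz⟩ := hne
  refine ⟨2 * C ^ 2 * (1 + ‖z‖ ^ 2), by positivity, fun x => ?_⟩
  have h1 : u x ≤ C * (‖z‖ + ‖x‖) := (hg x z hz).trans
    (mul_le_mul_of_nonneg_left (by rw [dist_eq_norm]; exact norm_sub_le z x) hC.le)
  calc u x ^ 2 ≤ (C * (‖z‖ + ‖x‖)) ^ 2 := pow_le_pow_left₀ (h.nonneg x) h1 2
    _ ≤ _ := by nlinarith [mul_nonneg (_root_.sq_nonneg C) (_root_.sq_nonneg (‖z‖ - ‖x‖)),
        mul_nonneg (_root_.sq_nonneg C) (mul_nonneg (_root_.sq_nonneg ‖z‖) (_root_.sq_nonneg ‖x‖)),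
        _root_.sq_nonneg C]

end Minimizer
/-- The function `log (1 + |x|²)`. -/
noncomputable def logSq (x : Plane) : ℝ := Real.log (1 + ‖x‖ ^ 2)

theorem exp_logSq (x : Plane) : Real.exp (logSq x) = 1 + ‖x‖ ^ 2 := Real.exp_log (by positivity)

theorem logSq_nonneg (x : Plane) : 0 ≤ logSq x :=
  Real.log_nonneg (by nlinarith [_root_.sq_nonneg ‖x‖])

theorem contDiff_logSq : ContDiff ℝ (⊤ : ℕ∞) logSq := by
  have h : ContDiff ℝ (⊤ : ℕ∞) fun x : Plane => 1 + ‖x‖ ^ 2 :=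
    contDiff_const.add (contDiff_norm_sq ℝ)
  exact h.log fun x => by positivity

theorem pd_logSq_sq_le (x : Plane) :
    pd 0 logSq x ^ 2 + pd 1 logSq x ^ 2 ≤ 4 * Real.exp (-logSq x) := by
  have h : ContDiff ℝ (⊤ : ℕ∞) fun x : Plane => ‖x - 0‖ ^ 2 := contDiff_norm_sub_sq 0
  have hp : ∀ i, pd i logSq x = (1 + ‖x‖ ^ 2)⁻¹ * (2 * x i) := fun i => by
    have h1 : HasDerivAt (fun t => Real.log (1 + t)) (1 + ‖x - 0‖ ^ 2)⁻¹ (‖x - 0‖ ^ 2) := by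
      simpa using ((hasDerivAt_id (‖x - 0‖ ^ 2)).const_add 1).log
        (show 1 + ‖x - 0‖ ^ 2 ≠ 0 by positivity)
    have := pd_comp h1 (h.differentiable (by simp) x) i
    rw [pd_norm_sub_sq] at this
    simp only [sub_zero, PiLp.zero_apply] at this
    exact this
  rw [hp, hp, Real.exp_neg, exp_logSq]
  have hn := norm_sq_eq x
  set q := 1 + ‖x‖ ^ 2 with hq
  have hq0 : 0 < q := by positivity
  have e : (q⁻¹ * (2 * x 0)) ^ 2 + (q⁻¹ * (2 * x 1)) ^ 2 = 4 * (q⁻¹ * (q⁻¹ * (q - 1))) := by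
    rw [show q - 1 = x 0 ^ 2 + x 1 ^ 2 by rw [hq, hn]; ring]; ring
  rw [e]
  have : q⁻¹ * (q - 1) ≤ 1 := by rw [inv_mul_le_iff₀ hq0]; linarith
  have := mul_le_mul_of_nonneg_left this (inv_nonneg.2 hq0.le)
  linarith

theorem logSq_sublevel_subset (k : ℝ) :
    {x | logSq x ≤ k} ⊆ closedBall (0 : Plane) (Real.exp (k / 2)) := fun x hx => by
  have h1 := Real.exp_le_exp.2 (show logSq x ≤ k from hx)
  rw [exp_logSq] at h1
  have h2 : Real.exp (k / 2) ^ 2 = Real.exp k := by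
    rw [← Real.exp_nat_mul]; congr 1; push_cast; ring
  rw [mem_closedBall_zero_iff]
  exact abs_le_of_sq_le_sq' (by linarith) (Real.exp_pos _).le |>.2

theorem isCompact_logSq_sublevel (k : ℝ) : IsCompact {x | logSq x ≤ k} :=
  (isCompact_closedBall _ _).of_isClosed_subset
    (isClosed_le contDiff_logSq.continuous continuous_const) (logSq_sublevel_subset k)

theorem measureReal_logSq_sublevel_le (k : ℝ) :
    volume.real {x | logSq x ≤ k} ≤ Real.pi * Real.exp k := by
  refine (measureReal_mono (logSq_sublevel_subset k) measure_closedBall_lt_top.ne).trans ?_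
  rw [measureReal_closedBall _ (Real.exp_pos _).le, ← Real.exp_nat_mul]
  refine le_of_eq ?_
  congr 2
  push_cast
  ring

theorem setIntegral_exp_neg_logSq_le (k : ℕ) :
    ∫ x in {x | logSq x ≤ k}, Real.exp (-logSq x) ≤ Real.pi * Real.exp 1 * (k + 1) := by
  have hc : Continuous fun x => Real.exp (-logSq x) := contDiff_logSq.continuous.neg.rexp
  have hi : ∀ t : ℝ, IntegrableOn (fun x => Real.exp (-logSq x)) {x | logSq x ≤ t} := fun t =>
    hc.continuousOn.integrableOn_compact (isCompact_logSq_sublevel t)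
  induction k with
  | zero =>
    calc _ ≤ ∫ _ in {x : Plane | logSq x ≤ (0 : ℕ)}, (1 : ℝ) := by
          refine setIntegral_mono (hi _) (integrableOn_const
            (isCompact_logSq_sublevel _).measure_lt_top.ne) fun x => ?_
          exact Real.exp_le_one_iff.2 (neg_nonpos.2 (logSq_nonneg x))
      _ ≤ Real.pi := by
          have := measureReal_logSq_sublevel_le 0
          simpa using this
      _ ≤ _ := by
          have := Real.add_one_le_exp (1 : ℝ)
          push_cast
          nlinarith [Real.pi_pos]
  | succ k ih =>
    have hu : {x : Plane | logSq x ≤ ((k + 1 : ℕ) : ℝ)}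
        = {x | logSq x ≤ k} ∪ {x | logSq x ∈ Ioc (k : ℝ) (k + 1)} := by
      ext x
      simp only [mem_ofPred_eq, mem_union, mem_Ioc]
      push_cast
      constructor
      · intro hx
        rcases le_or_gt (logSq x) k with h1 | h1
        · exact Or.inl h1
        · exact Or.inr ⟨h1, hx⟩
      · rintro (h1 | h1) <;> linarith [h1]
    have hms : MeasurableSet {x | logSq x ∈ Ioc (k : ℝ) (k + 1)} :=
      contDiff_logSq.continuous.measurable measurableSet_Ioc
    have hsub : {x | logSq x ∈ Ioc (k : ℝ) (k + 1)} ⊆ {x | logSq x ≤ (k : ℝ) + 1} :=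
      fun x hx => hx.2
    have hdisj : Disjoint {x : Plane | logSq x ≤ k} {x | logSq x ∈ Ioc (k : ℝ) (k + 1)} :=
      Set.disjoint_left.2 fun x h1 h2 => (not_lt.2 h1 : ¬ (k : ℝ) < logSq x) h2.1
    rw [hu, setIntegral_union hdisj hms
      (hi k) ((hi (k + 1)).mono_set hsub)]
    have h2 : ∫ x in {x | logSq x ∈ Ioc (k : ℝ) (k + 1)}, Real.exp (-logSq x)
        ≤ Real.pi * Real.exp 1 := by
      have hfin : volume {x | logSq x ∈ Ioc (k : ℝ) (k + 1)} ≠ ⊤ :=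
        ((measure_mono hsub).trans_lt (isCompact_logSq_sublevel _).measure_lt_top).ne
      calc _ ≤ ∫ _ in {x | logSq x ∈ Ioc (k : ℝ) (k + 1)}, Real.exp (-k) :=
            setIntegral_mono_on ((hi (k + 1)).mono_set hsub) (integrableOn_const hfin) hms
              fun x hx => Real.exp_le_exp.2 (by linarith [hx.1])
        _ ≤ Real.pi * Real.exp (k + 1) * Real.exp (-k) := by
            rw [setIntegral_const, smul_eq_mul]
            refine mul_le_mul_of_nonneg_right ?_ (Real.exp_pos _).le
            exact (measureReal_mono hsub (isCompact_logSq_sublevel _).measure_lt_top.ne).trans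
              (measureReal_logSq_sublevel_le _)
        _ = _ := by rw [mul_assoc, ← Real.exp_add]; congr 2; ring
    push_cast
    linarith

/-- Logarithmic cutoffs. -/
theorem exists_log_cutoff : ∃ M > 0, ∀ N : ℕ, 1 ≤ N → ∃ φ ψ : Plane → ℝ,
    ContDiff ℝ (⊤ : ℕ∞) φ ∧ HasCompactSupport φ ∧ (∀ x, logSq x ≤ N → φ x = 1) ∧
    ContDiff ℝ (⊤ : ℕ∞) ψ ∧ HasCompactSupport ψ ∧
    (∀ x, pd 0 φ x ^ 2 + pd 1 φ x ^ 2 ≤ M / N ^ 2 * ψ x ^ 2) ∧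
    ∫ x, (1 + ‖x‖ ^ 2) * (pd 0 ψ x ^ 2 + pd 1 ψ x ^ 2) ≤ M * N := by
  obtain ⟨K, hK, -⟩ := exists_deriv_smoothTransition_bound
  set M := (4 * (K + 1) ^ 2 + 1) * (Real.pi * Real.exp 1 * 4 + 1) with hM
  have hK0 : 0 ≤ K := (abs_nonneg _).trans (hK 0)
  have hM1 : 4 * K ^ 2 ≤ M := by
    have h1 : 4 * K ^ 2 ≤ 4 * (K + 1) ^ 2 + 1 := by nlinarith
    have h2 : 1 ≤ Real.pi * Real.exp 1 * 4 + 1 := by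
      have := Real.pi_pos; have := Real.exp_pos 1; nlinarith [mul_pos Real.pi_pos (Real.exp_pos 1)]
    calc _ ≤ (4 * (K + 1) ^ 2 + 1) * 1 := by linarith
      _ ≤ _ := mul_le_mul_of_nonneg_left h2 (by positivity)
  refine ⟨M, by positivity, fun N hN => ?_⟩
  have hN1 : (1 : ℝ) ≤ N := by exact_mod_cast hN
  have hN0 : (0 : ℝ) < N := by linarith
  have hT := Real.smoothTransition.contDiff (n := (⊤ : ℕ∞))
  have hη : ∀ c : ℝ, ContDiff ℝ (⊤ : ℕ∞) fun x => Real.smoothTransition (c - logSq x / N) :=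
    fun c => hT.comp (contDiff_const.sub (contDiff_logSq.div_const _))
  have hηs : ∀ c : ℝ, HasCompactSupport fun x => Real.smoothTransition (c - logSq x / N) :=
    fun c => by
    refine HasCompactSupport.intro (isCompact_logSq_sublevel (c * N)) fun x hx => ?_
    refine Real.smoothTransition.zero_of_nonpos ?_
    have : c * N < logSq x := not_le.1 hx
    rw [sub_nonpos, le_div_iff₀ hN0]
    exact this.le
  have hdl := contDiff_logSq.differentiable (by simp)
  have hηp : ∀ c i x, pd i (fun x => Real.smoothTransition (c - logSq x / N)) x
      = -(deriv Real.smoothTransition (c - logSq x / N) / N) * pd i logSq x := fun c i x => by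
    have h1 : HasDerivAt (fun t => Real.smoothTransition (c - t / N))
        (deriv Real.smoothTransition (c - logSq x / N) * -(1 / N)) (logSq x) :=
      (hT.differentiable (by simp) _).hasDerivAt.comp _
        (((hasDerivAt_id (logSq x)).div_const (N : ℝ)).const_sub c)
    rw [pd_comp h1 (hdl x)]
    ring
  have he : ContDiff ℝ (⊤ : ℕ∞) fun x => Real.exp (-logSq x / 2) :=
    (contDiff_logSq.neg.div_const 2).exp
  have hψ : ContDiff ℝ (⊤ : ℕ∞) fun x =>
    Real.smoothTransition (3 - logSq x / N) * Real.exp (-logSq x / 2) := (hη 3).mul he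
  have hψs : HasCompactSupport fun x =>
    Real.smoothTransition (3 - logSq x / N) * Real.exp (-logSq x / 2) := (hηs 3).mul_right
  have hsq : ∀ x, Real.exp (-logSq x / 2) ^ 2 = Real.exp (-logSq x) := fun x => by
    rw [← Real.exp_nat_mul]; congr 1; push_cast; ring
  refine ⟨_, _, hη 2, hηs 2, fun x hx => ?_, hψ, hψs, fun x => ?_, ?_⟩
  · refine Real.smoothTransition.one_of_one_le ?_
    have : logSq x / N ≤ 1 := by rwa [div_le_one hN0]
    linarith
  · rcases le_or_gt (2 - logSq x / N) 0 with h0 | h0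
    · have : ∀ i, pd i (fun x => Real.smoothTransition (2 - logSq x / N)) x = 0 := fun i =>
        pd_eq_zero_of_nonneg (v := fun x => Real.smoothTransition (2 - logSq x / N))
          (fun x => Real.smoothTransition.nonneg _)
          (Real.smoothTransition.zero_of_nonpos h0) i
      rw [this, this]
      have : 0 < M := by positivity
      simp only [ne_eq, OfNat.ofNat_ne_zero, not_false_eq_true, zero_pow, add_zero]
      positivity
    · rw [hηp, hηp, Real.smoothTransition.one_of_one_le (by linarith : 1 ≤ 3 - logSq x / N),
        one_mul, hsq]
      have hD := hK (2 - logSq x / N)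
      set D := deriv Real.smoothTransition (2 - logSq x / N)
      have hD2 : D ^ 2 ≤ K ^ 2 := sq_le_sq' (abs_le.1 hD).1 (abs_le.1 hD).2
      calc _ = D ^ 2 / N ^ 2 * (pd 0 logSq x ^ 2 + pd 1 logSq x ^ 2) := by field_simp
        _ ≤ K ^ 2 / N ^ 2 * (4 * Real.exp (-logSq x)) :=
            mul_le_mul (by gcongr) (pd_logSq_sq_le x) (by positivity) (by positivity)
        _ = (4 * K ^ 2) / N ^ 2 * Real.exp (-logSq x) := by ring
        _ ≤ _ := by gcongr
  · set ψ : Plane → ℝ := fun x =>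
      Real.smoothTransition (3 - logSq x / N) * Real.exp (-logSq x / 2) with hψdef
    have hz : ∀ x, x ∉ {x | logSq x ≤ ((3 * N : ℕ) : ℝ)} →
        (1 + ‖x‖ ^ 2) * (pd 0 ψ x ^ 2 + pd 1 ψ x ^ 2) = 0 := fun x hx => by
      have hx' : 3 * (N : ℝ) < logSq x := by
        have : ((3 * N : ℕ) : ℝ) < logSq x := not_le.1 fun hle => hx hle
        push_cast at this
        exact this
      have : ∀ i, pd i ψ x = 0 := fun i => by
        refine pd_eq_zero_of_nonneg (fun x => mul_nonneg (Real.smoothTransition.nonneg _)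
          (Real.exp_pos _).le) ?_ i
        rw [Real.smoothTransition.zero_of_nonpos, zero_mul]
        rw [sub_nonpos, le_div_iff₀ hN0]
        exact hx'.le
      simp [this]
    have hpt : ∀ x, (1 + ‖x‖ ^ 2) * (pd 0 ψ x ^ 2 + pd 1 ψ x ^ 2)
        ≤ 4 * (K + 1) ^ 2 * Real.exp (-logSq x) := fun x => by
      have h1 : ∀ i, pd i ψ x = -((deriv Real.smoothTransition (3 - logSq x / N) / N
          + Real.smoothTransition (3 - logSq x / N) / 2) * Real.exp (-logSq x / 2))
            * pd i logSq x := fun i => by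
        have e1 : HasDerivAt (fun t => Real.exp (-t / 2)) (Real.exp (-logSq x / 2) * (-1 / 2))
            (logSq x) := ((hasDerivAt_neg (logSq x)).div_const 2).exp
        rw [hψdef, pd_mul ((hη 3).differentiable (by simp) x) (he.differentiable (by simp) x),
          hηp, pd_comp e1 (hdl x)]
        ring
      rw [h1, h1]
      have hD := hK (3 - logSq x / N)
      have hT0 := Real.smoothTransition.nonneg (3 - logSq x / N)
      have hT1 := Real.smoothTransition.le_one (3 - logSq x / N)
      set D := deriv Real.smoothTransition (3 - logSq x / N)
      set T := Real.smoothTransition (3 - logSq x / N)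
      have hb : |D / N + T / 2| ≤ K + 1 := by
        refine (abs_add_le _ _).trans (add_le_add ?_ ?_)
        · rw [abs_div, abs_of_pos hN0]
          exact (div_le_self (abs_nonneg _) hN1).trans hD
        · rw [abs_of_nonneg (by positivity)]; linarith
      have hb2 : (D / N + T / 2) ^ 2 ≤ (K + 1) ^ 2 := sq_le_sq' (abs_le.1 hb).1 (abs_le.1 hb).2
      have hl := pd_logSq_sq_le x
      have hee : Real.exp (logSq x) * Real.exp (-logSq x) = 1 := by
        rw [← Real.exp_add]; simp
      calc _ = Real.exp (logSq x) * Real.exp (-logSq x / 2) ^ 2 * ((D / N + T / 2) ^ 2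
            * (pd 0 logSq x ^ 2 + pd 1 logSq x ^ 2)) := by rw [exp_logSq]; ring
        _ = (D / N + T / 2) ^ 2 * (pd 0 logSq x ^ 2 + pd 1 logSq x ^ 2) := by
            rw [hsq, hee, one_mul]
        _ ≤ (K + 1) ^ 2 * (4 * Real.exp (-logSq x)) :=
            mul_le_mul hb2 hl (by positivity) (by positivity)
        _ = _ := by ring
    rw [← setIntegral_eq_integral_of_forall_compl_eq_zero hz]
    have c0 := continuous_pd (smooth_of_le hψ) 0
    have c1 := continuous_pd (smooth_of_le hψ) 1
    have hcomp := isCompact_logSq_sublevel ((3 * N : ℕ) : ℝ)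
    calc _ ≤ ∫ x in {x | logSq x ≤ ((3 * N : ℕ) : ℝ)}, 4 * (K + 1) ^ 2 * Real.exp (-logSq x) := by
          refine setIntegral_mono (ContinuousOn.integrableOn_compact hcomp ?_)
            (ContinuousOn.integrableOn_compact hcomp ?_) hpt
          · exact (((continuous_const.add (continuous_norm.pow 2)).mul
              ((c0.pow 2).add (c1.pow 2)))).continuousOn
          · exact (continuous_const.mul contDiff_logSq.continuous.neg.rexp).continuousOn
      _ ≤ 4 * (K + 1) ^ 2 * (Real.pi * Real.exp 1 * ((3 * N : ℕ) + 1)) := by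
          rw [integral_const_mul]
          exact mul_le_mul_of_nonneg_left (setIntegral_exp_neg_logSq_le _) (by positivity)
      _ ≤ (4 * (K + 1) ^ 2 + 1) * ((Real.pi * Real.exp 1 * 4 + 1) * N) := by
          have hpe : 0 < Real.pi * Real.exp 1 := mul_pos Real.pi_pos (Real.exp_pos 1)
          refine mul_le_mul (by linarith) ?_ (by positivity) (by positivity)
          push_cast
          nlinarith
      _ = _ := by rw [hM]; ring

namespace Minimizer

variable {F F' F'' : ℝ → ℝ} {c₀ C₀ lam : ℝ} {u W : Plane → ℝ}

theorem tanSq_eq_zero (h : Minimizer F F' F'' c₀ C₀ lam u W)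
    (hne : (frontier {y | 0 < u y}).Nonempty) {x : Plane} (hx : 0 < u x) : tanSq W x = 0 := by
  by_contra hne0
  obtain ⟨M, hM, hcut⟩ := exists_log_cutoff
  obtain ⟨C, hC, hCu⟩ := h.exists_sq_le hne
  have hc₀ := h.c₀_pos
  have hC₀ := h.C₀_pos
  have htan0 : ∀ y, 0 ≤ tanSq W y := fun y => by unfold tanSq; positivity
  set g : Plane → ℝ := fun y => tanSq W y / (sq W y + 1) with hg
  have hs1 : ∀ y, 0 < sq W y + 1 := fun y => by linarith [sq_nonneg W y]
  have hgc : Continuous g := h.continuous_tanSq.div (h.continuous_sq.add continuous_const)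
    fun y => (hs1 y).ne'
  have hg0 : ∀ y, 0 ≤ g y := fun y => div_nonneg (htan0 y) (hs1 y).le
  have hgx : 0 < g x := div_pos (lt_of_le_of_ne (htan0 x) (Ne.symm hne0)) (hs1 x)
  set R := ‖x‖ + 1
  have hgi : IntegrableOn g ({y | 0 < u y} ∩ ball 0 R) :=
    (hgc.continuousOn.integrableOn_compact (isCompact_closedBall 0 R)).mono_set
      (inter_subset_right.trans ball_subset_closedBall)
  have hI : 0 < ∫ y in {y | 0 < u y} ∩ ball 0 R, g y := by
    rw [setIntegral_pos_iff_support_of_nonneg_ae (.of_forall hg0) hgi]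
    have ho : IsOpen (Function.support g ∩ ({y | 0 < u y} ∩ ball 0 R)) :=
      hgc.isOpen_support.inter (h.isOpen.inter isOpen_ball)
    exact ho.measure_pos volume ⟨x, hgx.ne', hx, by simp [R]⟩
  set I := ∫ y in {y | 0 < u y} ∩ ball 0 R, g y
  set A := 6 * C₀ * (M * (4 * C₀ / c₀ * (C * M))) with hA
  have hbound : ∀ N : ℕ, 1 ≤ N → Real.log (1 + R ^ 2) ≤ N → c₀ * I * N ≤ A := by
    intro N hN hRN
    have hN1 : (1 : ℝ) ≤ N := by exact_mod_cast hN
    obtain ⟨φ, ψ, hφ, hφs, hφ1, hψ, hψs, hgrad, hinteg⟩ := hcut N hN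
    have hst := h.stability hφ hφs
    have hcc := h.caccioppoli (smooth_of_le hψ) hψs
    have c0 := continuous_pd (smooth_of_le hφ) 0
    have c1 := continuous_pd (smooth_of_le hφ) 1
    have d0 := continuous_pd (smooth_of_le hψ) 0
    have d1 := continuous_pd (smooth_of_le hψ) 1
    have hsq0 : ∀ {f : Plane → ℝ}, HasCompactSupport f → HasCompactSupport fun x => f x ^ 2 :=
      fun hf => hf.comp_left (g := fun t : ℝ => t ^ 2) (by simp)
    have hle1 : I ≤ ∫ y in {y | 0 < u y}, φ y ^ 2 * tanSq W y / (sq W y + 1) := by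
      have hfi : Integrable fun y => φ y ^ 2 * tanSq W y / (sq W y + 1) := by
        have : Integrable fun y => φ y ^ 2 * g y :=
          ((hφ.continuous.pow 2).mul hgc).integrable_of_hasCompactSupport (hsq0 hφs).mul_right
        simpa only [hg, mul_div_assoc] using this
      calc I = ∫ y in {y | 0 < u y} ∩ ball 0 R, φ y ^ 2 * tanSq W y / (sq W y + 1) := by
            refine setIntegral_congr_fun (h.isOpen.measurableSet.inter measurableSet_ball)
              fun y hy => ?_
            simp only [hg]
            rw [hφ1 y, one_pow, one_mul]
            refine le_trans (Real.log_le_log (by positivity) ?_) hRN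
            have := mem_ball_zero_iff.1 hy.2
            gcongr
        _ ≤ _ := setIntegral_mono_set hfi.integrableOn (.of_forall fun y => by
              exact div_nonneg (mul_nonneg (by positivity) (htan0 y)) (hs1 y).le)
              inter_subset_left.eventuallyLE
    have hle2 : ∫ y in {y | 0 < u y}, sq W y * (pd 0 φ y ^ 2 + pd 1 φ y ^ 2)
        ≤ M / N ^ 2 * ∫ y in {y | 0 < u y}, sq W y * ψ y ^ 2 := by
      rw [← integral_const_mul]
      refine integral_mono (Integrable.integrableOn ?_) (Integrable.integrableOn ?_) fun y => ?_
      · exact (h.continuous_sq.mul ((c0.pow 2).add (c1.pow 2))).integrable_of_hasCompactSupport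
          ((hsq0 (hasCompactSupport_pd hφs 0)).add (hsq0 (hasCompactSupport_pd hφs 1))).mul_left
      · exact (continuous_const.mul (h.continuous_sq.mul
          (hψ.continuous.pow 2))).integrable_of_hasCompactSupport (hsq0 hψs).mul_left.mul_left
      · have := mul_le_mul_of_nonneg_left (hgrad y) (sq_nonneg W y)
        simp only
        linarith
    have hle3 : ∫ y in {y | 0 < u y}, W y ^ 2 * (pd 0 ψ y ^ 2 + pd 1 ψ y ^ 2) ≤ C * (M * N) := by
      have hsupp : HasCompactSupport fun y => pd 0 ψ y ^ 2 + pd 1 ψ y ^ 2 :=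
        (hsq0 (hasCompactSupport_pd hψs 0)).add (hsq0 (hasCompactSupport_pd hψs 1))
      have hi2 : Integrable fun y : Plane =>
          C * ((1 + ‖y‖ ^ 2) * (pd 0 ψ y ^ 2 + pd 1 ψ y ^ 2)) :=
        (continuous_const.mul ((continuous_const.add (continuous_norm.pow 2)).mul
          ((d0.pow 2).add (d1.pow 2)))).integrable_of_hasCompactSupport hsupp.mul_left.mul_left
      calc _ ≤ ∫ y in {y | 0 < u y}, C * ((1 + ‖y‖ ^ 2) * (pd 0 ψ y ^ 2 + pd 1 ψ y ^ 2)) := by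
            refine setIntegral_mono_on (Integrable.integrableOn ?_) hi2.integrableOn
              h.isOpen.measurableSet fun y hy => ?_
            · exact ((h.smooth.continuous.pow 2).mul ((d0.pow 2).add
                (d1.pow 2))).integrable_of_hasCompactSupport hsupp.mul_left
            · rw [h.eq_on y hy, ← mul_assoc]
              exact mul_le_mul_of_nonneg_right (hCu y) (by positivity)
        _ ≤ ∫ y, C * ((1 + ‖y‖ ^ 2) * (pd 0 ψ y ^ 2 + pd 1 ψ y ^ 2)) :=
            setIntegral_le_integral hi2 (.of_forall fun y => by positivity)
        _ ≤ _ := by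
            rw [integral_const_mul]
            exact mul_le_mul_of_nonneg_left hinteg hC.le
    have hcc' : ∫ y in {y | 0 < u y}, sq W y * ψ y ^ 2 ≤ 4 * C₀ / c₀ * (C * (M * N)) := by
      rw [div_mul_eq_mul_div, le_div_iff₀ hc₀, mul_comm]
      exact hcc.trans (mul_le_mul_of_nonneg_left hle3 (by positivity))
    calc c₀ * I * N ≤ (6 * C₀ * (M / N ^ 2 * (4 * C₀ / c₀ * (C * (M * N))))) * N := by
          refine mul_le_mul_of_nonneg_right ?_ (by positivity)
          refine (mul_le_mul_of_nonneg_left hle1 hc₀.le).trans (hst.trans ?_)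
          refine mul_le_mul_of_nonneg_left (hle2.trans ?_) (by positivity)
          exact mul_le_mul_of_nonneg_left hcc' (by positivity)
      _ = A := by rw [hA]; field_simp
  obtain ⟨N, hN⟩ := exists_nat_gt (max (max 1 (Real.log (1 + R ^ 2))) (A / (c₀ * I)))
  have h1 : (1 : ℝ) < N := lt_of_le_of_lt ((le_max_left _ _).trans (le_max_left _ _)) hN
  have h2 : Real.log (1 + R ^ 2) < N :=
    lt_of_le_of_lt ((le_max_right _ _).trans (le_max_left _ _)) hN
  have h3 : A / (c₀ * I) < N := lt_of_le_of_lt (le_max_right _ _) hN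
  rw [div_lt_iff₀ (by positivity)] at h3
  have := hbound N (by exact_mod_cast h1.le) h2.le
  linarith

theorem hess_eq_zero_of_grad_ne_zero (h : Minimizer F F' F'' c₀ C₀ lam u W)
    (hne : (frontier {y | 0 < u y}).Nonempty) {x : Plane} (hx : 0 < u x) (hs : 0 < sq W x)
    (i j : Fin 2) : pd i (pd j W) x = 0 := by
  have ht := h.tanSq_eq_zero hne hx
  have hEL := h.euler_lagrange hx
  have hF := h.c₀_pos.trans_le (h.le_deriv _ hs.le)
  have hF2 := h.deriv2_nonneg _ hs.le
  have hcm := pd_comm h.smooth x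
  unfold tanSq at ht
  obtain ⟨t1, t2⟩ := (add_eq_zero_iff_of_nonneg (_root_.sq_nonneg _) (_root_.sq_nonneg _)).1 ht
  rw [pow_eq_zero_iff two_ne_zero] at t1 t2
  have hsq : sq W x = pd 0 W x ^ 2 + pd 1 W x ^ 2 := rfl
  set s := sq W x
  set p := pd 0 W x
  set q := pd 1 W x
  set a := pd 0 (pd 0 W) x
  set b := pd 0 (pd 1 W) x
  set d := pd 1 (pd 1 W) x
  have e1 : p ^ 2 * a + 2 * p * q * b + q ^ 2 * d = s * (a + d) := by
    rw [hsq]; linear_combination q * t1 - p * t2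
  rw [e1] at hEL
  have htr : a + d = 0 := by
    have : (F' s + 2 * F'' s * s) * (a + d) = 0 := by linear_combination hEL
    exact (mul_eq_zero.1 this).resolve_left (by positivity)
  have ha : a = 0 := by
    have : s * a = 0 := by rw [hsq]; linear_combination p ^ 2 * htr - q * t1 - p * t2
    exact (mul_eq_zero.1 this).resolve_left hs.ne'
  have hd : d = 0 := by linarith
  have hb : b = 0 := by
    have : s * b = 0 := by
      rw [hsq]; linear_combination p * t1 - q * t2 + p * q * htr
    exact (mul_eq_zero.1 this).resolve_left hs.ne'
  fin_cases i <;> fin_cases j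
  exacts [ha, hb, hcm.trans hb, hd]

/-- A minimizer with nonempty free boundary is locally affine where it is positive. -/
theorem hess_eq_zero (h : Minimizer F F' F'' c₀ C₀ lam u W)
    (hne : (frontier {y | 0 < u y}).Nonempty) {x : Plane} (hx : 0 < u x)
    (i j : Fin 2) : pd i (pd j W) x = 0 := by
  by_contra hH
  have hev : ∀ᶠ y in nhds x, pd i (pd j W) y ≠ 0 :=
    (continuous_pd (smooth_of_le (h.contDiff_p j)) i).continuousAt.eventually_ne hH
  have hz : pd j W =ᶠ[nhds x] fun _ => 0 := by
    filter_upwards [hev, h.isOpen.mem_nhds hx] with y hy hyu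
    have : ¬ 0 < sq W y := fun hs => hy (h.hess_eq_zero_of_grad_ne_zero hne hyu hs i j)
    have h0 : pd 0 W y ^ 2 + pd 1 W y ^ 2 ≤ 0 := not_lt.1 this
    have h1 : pd j W y ^ 2 ≤ 0 := by
      fin_cases j
      · simpa using (by nlinarith [_root_.sq_nonneg (pd 1 W y)] : pd 0 W y ^ 2 ≤ 0)
      · simpa using (by nlinarith [_root_.sq_nonneg (pd 0 W y)] : pd 1 W y ^ 2 ≤ 0)
    exact pow_eq_zero_iff two_ne_zero |>.1 (le_antisymm h1 (_root_.sq_nonneg _))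
  exact hH ((pd_congr hz i).trans (pd_const 0 i x))

end Minimizer
theorem fderiv_eq_inner (f : Plane → ℝ) (x v : Plane) : fderiv ℝ f x v = ⟪v, gradient f x⟫ := by
  rw [fderiv_apply_eq, inner_eq, gradient_apply, gradient_apply]

theorem gradient_eq_iff {f g : Plane → ℝ} {x y : Plane} :
    gradient f x = gradient g y ↔ ∀ i, pd i f x = pd i g y := by
  refine ⟨fun h i => by rw [← gradient_apply, h, gradient_apply], fun h => ?_⟩
  ext i
  rw [gradient_apply, gradient_apply, h]

theorem continuous_gradient {f : Plane → ℝ} (hf : ContDiff ℝ 1 f) : Continuous (gradient f) :=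
  (InnerProductSpace.toDual ℝ Plane).symm.continuous.comp (hf.continuous_fderiv (by simp))

theorem convex_lt_inner (e : Plane) (c : ℝ) : Convex ℝ {y : Plane | c < ⟪y, e⟫} := by
  have : {y : Plane | c < ⟪y, e⟫} = {y : Plane | c < innerSL ℝ e y} := by
    ext y
    simp [real_inner_comm]
  rw [this]
  exact convex_halfSpace_gt (innerSL ℝ e).toLinearMap.isLinear c

/-- A point of the bounding line of a half-plane is a limit of points of the half-plane. -/
theorem mem_closure_lt_inner {e : Plane} (he : e ≠ 0) {c : ℝ} {y : Plane} (hy : ⟪y, e⟫ = c) :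
    y ∈ closure {y : Plane | c < ⟪y, e⟫} := by
  have h : Filter.Tendsto (fun t : ℝ => y + t • e) (nhdsWithin 0 (Ioi 0)) (nhds y) := by
    have hc : Continuous fun t : ℝ => y + t • e := by fun_prop
    have := hc.tendsto 0
    simp only [zero_smul, add_zero] at this
    exact this.mono_left nhdsWithin_le_nhds
  refine mem_closure_of_tendsto h ?_
  filter_upwards [self_mem_nhdsWithin] with t ht
  have h0 : 0 < ⟪e, e⟫ := real_inner_self_pos.2 he
  change c < ⟪y + t • e, e⟫
  rw [inner_add_left, inner_smul_left, hy]
  have : 0 < t * ⟪e, e⟫ := mul_pos ht h0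
  simpa using this

/-- Disjoint half-planes have opposite normals. -/
theorem eq_neg_of_disjoint {e e' : Plane} (he : ‖e‖ = 1) (he' : ‖e'‖ = 1) {c c' : ℝ}
    (h : ∀ y : Plane, c < ⟪y, e⟫ → ¬ c' < ⟪y, e'⟫) : e' = -e := by
  by_contra hne
  have h1 : ⟪e, e⟫ = 1 := by rw [real_inner_self_eq_norm_sq, he]; norm_num
  have h1' : ⟪e', e'⟫ = 1 := by rw [real_inner_self_eq_norm_sq, he']; norm_num
  have hsum : e + e' ≠ 0 := fun h0 => hne (eq_neg_of_add_eq_zero_right h0)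
  have hpos : 0 < 1 + ⟪e, e'⟫ := by
    have := real_inner_self_pos.2 hsum
    rw [inner_add_add_self, h1, h1', real_inner_comm e e'] at this
    linarith
  set a := 1 + ⟪e, e'⟫
  set t := (|c| + |c'| + 1) / a
  have hta : t * a = |c| + |c'| + 1 := div_mul_cancel₀ _ hpos.ne'
  refine h (t • (e + e')) ?_ ?_
  · rw [inner_smul_left, inner_add_left, h1, real_inner_comm]
    have := le_abs_self c
    have := abs_nonneg c'
    simp only [conj_trivial]
    linarith
  · rw [inner_smul_left, inner_add_left, h1', add_comm]
    have := le_abs_self c'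
    have := abs_nonneg c
    simp only [conj_trivial]
    linarith

namespace Minimizer

variable {F F' F'' : ℝ → ℝ} {c₀ C₀ lam : ℝ} {u W : Plane → ℝ}

theorem eventually_eq_affine (h : Minimizer F F' F'' c₀ C₀ lam u W)
    (hne : (frontier {y | 0 < u y}).Nonempty) {x : Plane} (hx : 0 < u x) :
    ∀ᶠ y in nhds x, 0 < u y ∧ gradient W y = gradient W x ∧
      W y = W x + ⟪y - x, gradient W x⟫ := by
  obtain ⟨r, hr, hball⟩ := Metric.isOpen_iff.1 h.isOpen x hx
  have hxb := mem_ball_self (x := x) hr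
  have hpre := (convex_ball x r).isPreconnected
  have hg : ∀ y ∈ ball x r, gradient W y = gradient W x := fun y hy => by
    refine gradient_eq_iff.2 fun i => ?_
    refine isOpen_ball.is_const_of_fderiv_eq_zero (𝕜 := ℝ) hpre
      ((h.contDiff_p i).differentiable (by simp)).differentiableOn (fun z hz => ?_) hy hxb
    ext v
    rw [fderiv_apply_eq, h.hess_eq_zero hne (hball hz), h.hess_eq_zero hne (hball hz)]
    simp
  filter_upwards [isOpen_ball.mem_nhds hxb] with y hy
  refine ⟨hball hy, hg y hy, ?_⟩
  have hd : ∀ z, HasFDerivAt (fun y => W y - fderiv ℝ W x (y - x))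
      (fderiv ℝ W z - fderiv ℝ W x) z := fun z =>
    (h.W_differentiable z).hasFDerivAt.sub
      ((fderiv ℝ W x).hasFDerivAt.comp z ((hasFDerivAt_id z).sub_const x))
  have := isOpen_ball.is_const_of_fderiv_eq_zero (𝕜 := ℝ) hpre
    (f := fun y => W y - fderiv ℝ W x (y - x))
    (fun z _ => (hd z).differentiableAt.differentiableWithinAt) (fun z hz => ?_) hy hxb
  · simp only [sub_self, map_zero, sub_zero] at this
    rw [← fderiv_eq_inner]
    linarith
  · rw [(hd z).fderiv]
    ext v
    rw [sub_apply, fderiv_eq_inner, fderiv_eq_inner, hg z hz, sub_self]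
    rfl

/-- Around each positivity point, a minimizer with nonempty free boundary is a half-plane
solution. -/
theorem exists_half_plane (h : Minimizer F F' F'' c₀ C₀ lam u W)
    (hne : (frontier {y | 0 < u y}).Nonempty) {x : Plane} (hx : 0 < u x) :
    ‖gradient W x‖ = 1 ∧ ∃ c, c < ⟪x, gradient W x⟫ ∧
      ∀ y, c < ⟪y, gradient W x⟫ → u y = ⟪y, gradient W x⟫ - c ∧ gradient W y = gradient W x := by
  set e := gradient W x with he
  set c := ⟪x, e⟫ - W x with hc
  have hWx := h.W_pos hx
  have hgc := continuous_gradient (smooth_of_le h.smooth)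
  have haff : Continuous fun y : Plane => ⟪y, e⟫ - c := by fun_prop
  set Z : Set Plane := {y | 0 < u y ∧ u y = ⟪y, e⟫ - c ∧ gradient W y = e} with hZ
  have hZo : IsOpen Z := by
    rw [isOpen_iff_mem_nhds]
    rintro y ⟨hy, hyu, hyg⟩
    filter_upwards [h.eventually_eq_affine hne hy] with z ⟨hz, hzg, hzW⟩
    refine ⟨hz, ?_, hzg.trans hyg⟩
    rw [← h.eq_on z hz, hzW, h.eq_on y hy, hyu, hyg, inner_sub_left]
    ring
  have hsub : {y : Plane | c < ⟪y, e⟫} ⊆ Z := by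
    refine (convex_lt_inner e c).isPreconnected.subset_of_closure_inter_subset hZo ⟨x, ?_, ?_⟩ ?_
    · change c < ⟪x, e⟫
      rw [hc]; linarith
    · exact ⟨hx, by rw [← h.eq_on x hx, hc]; ring, rfl⟩
    · rintro y ⟨hyZ, hy⟩
      have hy' : c < ⟪y, e⟫ := hy
      have h1 : u y = ⟪y, e⟫ - c := closure_minimal (t := {y | u y = ⟪y, e⟫ - c})
        (fun z hz => hz.2.1) (isClosed_eq h.lip.continuous haff) hyZ
      have h2 : gradient W y = e := closure_minimal (t := {y | gradient W y = e})
        (fun z hz => hz.2.2) (isClosed_eq hgc continuous_const) hyZ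
      exact ⟨by rw [h1]; linarith, h1, h2⟩
  have he0 : e ≠ 0 := by
    intro h0
    obtain ⟨z, hz⟩ := hne
    have hall : z ∈ {y : Plane | c < ⟪y, e⟫} := by
      change c < ⟪z, e⟫
      rw [hc, h0, inner_zero_right, inner_zero_right]
      linarith
    have := (hsub hall).1
    rw [h.u_eq_zero_of_frontier hz] at this
    exact lt_irrefl 0 this
  have hline : ∀ y, ⟪y, e⟫ = c → u y = 0 := fun y hy => by
    have h1 : u y = ⟪y, e⟫ - c := closure_minimal (t := {y | u y = ⟪y, e⟫ - c})
      (fun z hz => (hsub hz).2.1) (isClosed_eq h.lip.continuous haff) (mem_closure_lt_inner he0 hy)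
    rw [h1, hy, sub_self]
  refine ⟨?_, c, by rw [hc]; linarith, fun y hy => (hsub hy).2⟩
  have hee : 0 < ⟪e, e⟫ := real_inner_self_pos.2 he0
  set y : Plane := (c / ⟪e, e⟫) • e
  have hy : ⟪y, e⟫ = c := by
    rw [inner_smul_left, conj_trivial, div_mul_cancel₀ _ hee.ne']
  have hycl := mem_closure_lt_inner he0 hy
  have hyf : y ∈ frontier {y | 0 < u y} := by
    rw [h.isOpen.frontier_eq]
    exact ⟨closure_mono (fun z hz => (hsub hz).1) hycl, fun h0 => h0.ne' (hline y hy)⟩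
  have hyg : gradient W y = e := closure_minimal (t := {y | gradient W y = e})
    (fun z hz => (hsub hz).2.2) (isClosed_eq hgc continuous_const) hycl
  have h1 : ‖e‖ ^ 2 = 1 := by
    rw [← hyg, norm_gradient_sq]
    exact h.sq_eq_one y hyf
  exact (pow_eq_one_iff_of_nonneg (norm_nonneg _) two_ne_zero).1 h1

/-- A minimizer with nonempty free boundary is either a half-plane solution, or positive on two
opposite half-planes. -/
theorem half_plane_or_two_planes (h : Minimizer F F' F'' c₀ C₀ lam u W)
    (hne : (frontier {y | 0 < u y}).Nonempty) :
    ∃ e : Plane, ‖e‖ = 1 ∧ ∃ c, (∀ x, u x = max (⟪x, e⟫ - c) 0) ∨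
      ∃ c' ≤ c, (∀ x, c < ⟪x, e⟫ → u x = ⟪x, e⟫ - c) ∧ (∀ x, ⟪x, e⟫ < c' → u x = c' - ⟪x, e⟫) ∧
        ∀ x, 0 < u x → c < ⟪x, e⟫ ∨ ⟪x, e⟫ < c' := by
  obtain ⟨x, hx⟩ : ∃ x, 0 < u x := by
    by_contra hno
    have : {y | 0 < u y} = ∅ := by
      ext y
      simpa using not_exists.1 hno y
    simp [this] at hne
  obtain ⟨he, c, -, hH⟩ := h.exists_half_plane hne hx
  have hdisj : ∀ x₁ x₂ c₁ c₂,
      (∀ y, c₁ < ⟪y, gradient W x₁⟫ →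
        u y = ⟪y, gradient W x₁⟫ - c₁ ∧ gradient W y = gradient W x₁) →
      c₂ < ⟪x₂, gradient W x₂⟫ →
      (∀ y, c₂ < ⟪y, gradient W x₂⟫ →
        u y = ⟪y, gradient W x₂⟫ - c₂ ∧ gradient W y = gradient W x₂) →
      ¬ c₁ < ⟪x₂, gradient W x₁⟫ → ∀ y, c₁ < ⟪y, gradient W x₁⟫ → ¬ c₂ < ⟪y, gradient W x₂⟫ := by
    intro x₁ x₂ c₁ c₂ h1 h2 h3 h4 y hy1 hy2
    have e1 := h1 y hy1
    have e2 := h3 y hy2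
    have hg : gradient W x₁ = gradient W x₂ := e1.2.symm.trans e2.2
    have hcc : c₁ = c₂ := by
      have := e1.1.symm.trans e2.1
      rw [hg] at this
      linarith
    rw [hg, hcc] at h4
    exact h4 h2
  refine ⟨gradient W x, he, c, ?_⟩
  by_cases hall : ∀ y, 0 < u y → c < ⟪y, gradient W x⟫
  · refine Or.inl fun y => ?_
    rcases lt_or_ge c ⟪y, gradient W x⟫ with hy | hy
    · rw [(hH y hy).1, max_eq_left (by linarith)]
    · rw [max_eq_right (by linarith)]
      exact le_antisymm (not_lt.1 fun hpos => not_lt.2 hy (hall y hpos)) (h.nonneg y)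
  push Not at hall
  obtain ⟨x', hx', hx'c⟩ := hall
  obtain ⟨he', c', hcx', hH'⟩ := h.exists_half_plane hne hx'
  have hd := hdisj x x' c c' hH hcx' hH' (not_lt.2 hx'c)
  have hee := eq_neg_of_disjoint he he' hd
  have hin : ∀ y : Plane, ⟪y, gradient W x'⟫ = -⟪y, gradient W x⟫ := fun y => by
    rw [hee, inner_neg_right]
  refine Or.inr ⟨-c', ?_, fun y hy => (hH y hy).1, fun y hy => ?_, fun y hy => ?_⟩
  · by_contra hlt
    have hlt : c < -c' := not_le.1 hlt
    obtain ⟨t, ht1, ht2⟩ := exists_between hlt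
    have hs : ⟪gradient W x, gradient W x⟫ = 1 := by
      rw [real_inner_self_eq_norm_sq, he]; norm_num
    have hti : ⟪t • gradient W x, gradient W x⟫ = t := by
      rw [inner_smul_left, hs, conj_trivial, mul_one]
    refine hd (t • gradient W x) (by rw [hti]; exact ht1) ?_
    rw [hin, hti]
    linarith
  · rw [(hH' y (by rw [hin]; linarith)).1, hin]
    ring
  · by_contra hno
    push Not at hno
    obtain ⟨he'', c'', hcx'', hH''⟩ := h.exists_half_plane hne hy
    have h1 := eq_neg_of_disjoint he he''
      (hdisj x y c c'' hH hcx'' hH'' (not_lt.2 hno.1))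
    have h2 := eq_neg_of_disjoint he' he''
      (hdisj x' y c' c'' hH' hcx'' hH'' (by rw [hin]; linarith [hno.2]))
    rw [hee, neg_neg] at h2
    have h3 : gradient W x = 0 := by
      have : gradient W x = -gradient W x := h2.symm.trans h1
      ext i
      have hi := congrArg (fun g : Plane => g i) this
      simp only [PiLp.neg_apply] at hi
      rw [PiLp.zero_apply]
      linarith
    rw [h3, norm_zero] at he
    exact zero_ne_one he

end Minimizer
/-- The area of a strip inside a ball, estimated by disjoint translates. -/
theorem mul_measureReal_strip_le {e : Plane} (he : ‖e‖ = 1) {c c' L R : ℝ} (hR : 0 ≤ R)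
    (hL0 : 0 ≤ L) (hL : c - c' < L) (N : ℕ) :
    N * volume.real ({y : Plane | c' ≤ ⟪y, e⟫ ∧ ⟪y, e⟫ ≤ c} ∩ ball 0 R)
      ≤ Real.pi * (R + N * L) ^ 2 := by
  set T := {y : Plane | c' ≤ ⟪y, e⟫ ∧ ⟪y, e⟫ ≤ c} ∩ ball 0 R with hT
  have hTm : MeasurableSet T := by
    refine MeasurableSet.inter (IsClosed.measurableSet ?_) measurableSet_ball
    have hc : Continuous fun y : Plane => ⟪y, e⟫ := by fun_prop
    exact (isClosed_le continuous_const hc).inter (isClosed_le hc continuous_const)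
  set G : ℕ → Set Plane := fun j => (fun y => y - (j * L) • e) ⁻¹' T with hG
  have hGm : ∀ j, MeasurableSet (G j) := fun j => hTm.preimage (by fun_prop)
  have hGv : ∀ j, volume (G j) = volume T := fun j =>
    (measurePreserving_sub_right volume _).measure_preimage hTm.nullMeasurableSet
  have hin : ∀ (j : ℕ) (y : Plane), ⟪y - (j * L) • e, e⟫ = ⟪y, e⟫ - j * L := fun j y => by
    rw [inner_sub_left, inner_smul_left, real_inner_self_eq_norm_sq, he]
    simp
  have hlt : ∀ i j : ℕ, i < j → Disjoint (G i) (G j) := fun i j hij => by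
    rw [Set.disjoint_left]
    rintro y ⟨⟨-, hy1⟩, -⟩ ⟨⟨hy2, -⟩, -⟩
    rw [hin] at hy1 hy2
    have h1 : (i : ℝ) + 1 ≤ j := by exact_mod_cast hij
    nlinarith
  have hdisj : ∀ i j : ℕ, i ≠ j → Disjoint (G i) (G j) := fun i j hij =>
    (lt_or_gt_of_ne hij).elim (hlt i j) fun h => (hlt j i h).symm
  have hsub : (⋃ j ∈ Finset.range N, G j) ⊆ closedBall 0 (R + N * L) := by
    refine iUnion₂_subset fun j hj y hy => ?_
    have hj' : (j : ℝ) ≤ N := by exact_mod_cast (Finset.mem_range.1 hj).le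
    have h1 : ‖y - (j * L) • e‖ < R := by simpa using hy.2
    have h2 : ‖(j * L) • e‖ ≤ N * L := by
      rw [norm_smul, he, mul_one, Real.norm_of_nonneg (by positivity)]
      gcongr
    rw [mem_closedBall_zero_iff]
    have h3 := norm_add_le (y - (j * L) • e) ((j * L) • e)
    rw [sub_add_cancel] at h3
    linarith
  calc N * volume.real T = ∑ j ∈ Finset.range N, volume.real (G j) := by simp [Measure.real, hGv]
    _ = volume.real (⋃ j ∈ Finset.range N, G j) := by
        refine (measureReal_biUnion_finset (fun i _ j _ hij => hdisj i j hij)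
          (fun j _ => hGm j) (fun j _ => ?_)).symm
        rw [hGv]
        exact ((measure_mono inter_subset_right).trans_lt measure_ball_lt_top).ne
    _ ≤ volume.real (closedBall (0 : Plane) (R + N * L)) :=
        measureReal_mono hsub measure_closedBall_lt_top.ne
    _ = _ := measureReal_closedBall 0 (by positivity)

/-- The energy density of the one-phase functional. -/
noncomputable def density (F : ℝ → ℝ) (lam : ℝ) (v : Plane → ℝ) (x : Plane) : ℝ :=
  F (‖gradient v x‖ ^ 2) + lam ^ 2 * Set.indicator {y | 0 < v y} (fun _ => (1:ℝ)) x

theorem measurable_density {F : ℝ → ℝ} (hF : Continuous F) (lam : ℝ) {v : Plane → ℝ}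
    (hv : Continuous v) : Measurable (density F lam v) := by
  have h1 : Measurable fun x => ‖gradient v x‖ ^ 2 := by
    simp only [norm_gradient_sq]
    exact ((measurable_fderiv_apply_const ℝ v _).pow_const 2).add
      ((measurable_fderiv_apply_const ℝ v _).pow_const 2)
  exact (hF.measurable.comp h1).add
    ((measurable_const.indicator (isOpen_lt continuous_const hv).measurableSet).const_mul _)

/-- A downward paraboloid with slope at most one in the ball of radius `2 * A`, outside of which it
is nonpositive. -/
noncomputable def cap (A : ℝ) (y : Plane) : ℝ := A - (4 * A)⁻¹ * ‖y - 0‖ ^ 2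

theorem contDiff_cap (A : ℝ) : ContDiff ℝ (⊤ : ℕ∞) (cap A) :=
  contDiff_const.sub (contDiff_const.mul (contDiff_norm_sub_sq 0))

theorem cap_pos {A : ℝ} (hA : 0 < A) {y : Plane} : 0 < cap A y ↔ ‖y‖ < 2 * A := by
  have h1 : cap A y = (4 * A)⁻¹ * ((2 * A - ‖y‖) * (2 * A + ‖y‖)) := by
    rw [cap, sub_zero]
    field_simp
    ring
  have h2 : 0 < 2 * A + ‖y‖ := by positivity
  rw [h1, mul_pos_iff_of_pos_left (by positivity), mul_pos_iff_of_pos_right h2, sub_pos]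

theorem sq_cap {A : ℝ} (hA : 0 < A) (y : Plane) : sq (cap A) y = ‖y‖ ^ 2 / (4 * A ^ 2) := by
  have h1 : ∀ i, pd i (cap A) y = - (y i / (2 * A)) := fun i => by
    have hd := (contDiff_norm_sub_sq 0).differentiable (by simp) y
    unfold cap
    rw [pd_sub (differentiableAt_const _) (hd.const_mul _), pd_const, pd_const_mul _ hd,
      pd_norm_sub_sq]
    simp
    field_simp
    ring
  rw [sq, h1, h1, norm_sq_eq]
  field_simp
  ring

namespace Minimizer

variable {F F' F'' : ℝ → ℝ} {c₀ C₀ lam : ℝ} {u W : Plane → ℝ}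

theorem mul_sub_le_F_sub (h : Minimizer F F' F'' c₀ C₀ lam u W) {a b : ℝ} (ha : 0 ≤ a)
    (hab : a ≤ b) : c₀ * (b - a) ≤ F b - F a :=
  (convex_Ici 0).mul_sub_le_image_sub_of_le_deriv h.continuous_F.continuousOn
    (fun t _ => (h.hasDerivAt t).differentiableAt.differentiableWithinAt)
    (fun t ht => by rw [(h.hasDerivAt t).deriv]; exact h.le_deriv t (interior_subset ht))
    a ha b (ha.trans hab) hab

theorem F_sub_le_mul_sub (h : Minimizer F F' F'' c₀ C₀ lam u W) {a b : ℝ} (ha : 0 ≤ a)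
    (hab : a ≤ b) : F b - F a ≤ C₀ * (b - a) :=
  (convex_Ici 0).image_sub_le_mul_sub_of_deriv_le h.continuous_F.continuousOn
    (fun t _ => (h.hasDerivAt t).differentiableAt.differentiableWithinAt)
    (fun t ht => by rw [(h.hasDerivAt t).deriv]; exact h.deriv_le t (interior_subset ht))
    a ha b (ha.trans hab) hab

theorem F_zero_le (h : Minimizer F F' F'' c₀ C₀ lam u W) {t : ℝ} (ht : 0 ≤ t) : F 0 ≤ F t := by
  have := h.mul_sub_le_F_sub le_rfl ht
  have := mul_nonneg h.c₀_pos.le ht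
  linarith

theorem density_eq_of_pos (h : Minimizer F F' F'' c₀ C₀ lam u W)
    (hne : (frontier {y | 0 < u y}).Nonempty) {y : Plane} (hy : 0 < u y) :
    density F lam u y = F 1 + lam ^ 2 := by
  rw [density, density_of_pos F lam hy, pd_congr (h.eventually_eq hy),
    pd_congr (h.eventually_eq hy), ← norm_gradient_sq, (h.exists_half_plane hne hy).1, one_pow]

theorem density_max_of_lt {q : Plane → ℝ} {y : Plane} (h : Minimizer F F' F'' c₀ C₀ lam u W)
    (hq : Continuous q) (hy : u y < q y) :
    density F lam (fun z => max (u z) (q z)) y = F (sq q y) + lam ^ 2 := by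
  have hev : (fun z => max (u z) (q z)) =ᶠ[nhds y] q := by
    filter_upwards [(isOpen_lt h.lip.continuous hq).mem_nhds hy] with z hz
    exact max_eq_right (le_of_lt hz)
  have hpos : 0 < max (u y) (q y) := lt_max_of_lt_right ((h.nonneg y).trans_lt hy)
  rw [density, density_of_pos F lam hpos, pd_congr hev, pd_congr hev, sq]

theorem density_max_le_of_le {q : Plane → ℝ} {y : Plane} (h : Minimizer F F' F'' c₀ C₀ lam u W)
    (hne : (frontier {y | 0 < u y}).Nonempty) (hq : Continuous q) (hy : q y ≤ u y)
    (hpos : 0 < u y) :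
    density F lam (fun z => max (u z) (q z)) y ≤ density F lam u y := by
  rcases hy.lt_or_eq with hy | hy
  · have hev : (fun z => max (u z) (q z)) =ᶠ[nhds y] u := by
      filter_upwards [(isOpen_lt hq h.lip.continuous).mem_nhds hy] with z hz
      exact max_eq_left (le_of_lt hz)
    rw [density, density, density_of_pos F lam (lt_max_of_lt_left hpos),
      density_of_pos F lam hpos, pd_congr hev, pd_congr hev]
  · by_cases hd : DifferentiableAt ℝ (fun z => max (u z) (q z)) y
    · have hud : DifferentiableAt ℝ u y :=
        (h.W_differentiable y).congr_of_eventuallyEq (h.eventually_eq hpos)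
      have hmin : IsLocalMin (fun z => max (u z) (q z) - u z) y :=
        Filter.Eventually.of_forall fun z => by
          simp only [hy, max_self, sub_self]
          exact sub_nonneg.2 (le_max_left _ _)
      have hp : ∀ i, pd i (fun z => max (u z) (q z)) y = pd i u y := fun i => by
        have := pd_sub hd hud i
        rw [pd, hmin.fderiv_eq_zero] at this
        simp only [zero_apply] at this
        linarith
      rw [density, density, density_of_pos F lam (lt_max_of_lt_left hpos),
        density_of_pos F lam hpos, hp, hp]
    · have hp : ∀ i, pd i (fun z => max (u z) (q z)) y = 0 := fun i => by
        rw [pd, fderiv_zero_of_not_differentiableAt hd]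
        simp
      rw [h.density_eq_of_pos hne hpos, density, density_of_pos F lam (lt_max_of_lt_left hpos),
        hp, hp]
      have := h.F_zero_le zero_le_one
      simpa using this

theorem integrableOn_density (h : Minimizer F F' F'' c₀ C₀ lam u W) {v : Plane → ℝ}
    (hv : Continuous v) {R M : ℝ} (hM : ∀ y ∈ ball (0 : Plane) R, density F lam v y ≤ M) :
    IntegrableOn (density F lam v) (ball 0 R) := by
  refine Measure.integrableOn_of_bounded (M := max |F 0| |M|) measure_ball_lt_top.ne
    (measurable_density h.continuous_F lam hv).aestronglyMeasurable ?_
  filter_upwards [ae_restrict_mem measurableSet_ball] with y hy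
  rw [Real.norm_eq_abs]
  refine abs_le_max_abs_abs ?_ (hM y hy)
  have h1 := h.F_zero_le (_root_.sq_nonneg ‖gradient v y‖)
  have h2 : 0 ≤ lam ^ 2 * Set.indicator {y | 0 < v y} (fun _ => (1:ℝ)) y :=
    mul_nonneg (_root_.sq_nonneg _) (indicator_nonneg (fun _ _ => zero_le_one) _)
  rw [density]
  linarith

/-- A minimizer whose zero set lies in a strip `T` cannot lie below the cap in a large ball unless
the area of the strip is comparable to that of the ball. -/
theorem area_le_of_lt_cap (h : Minimizer F F' F'' c₀ C₀ lam u W)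
    (hne : (frontier {y | 0 < u y}).Nonempty) {A : ℝ} (hA : 0 < A) {T : Set Plane}
    (hT : MeasurableSet T) (hzero : ∀ y ∈ ball (0 : Plane) (2 * A), u y = 0 → y ∈ T)
    (hTb : T ⊆ ball 0 (2 * A)) (hcap : ∀ y ∈ closedBall (0 : Plane) (A / 2), u y < cap A y) :
    c₀ / 2 * (Real.pi * (A / 2) ^ 2) ≤ (C₀ + lam ^ 2 + c₀ / 2) * volume.real T := by
  set v : Plane → ℝ := fun z => max (u z) (cap A z) with hv
  set M := C₀ + lam ^ 2 + c₀ / 2 with hM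
  have hc₀ := h.c₀_pos
  have hC₀ := h.C₀_pos
  have hMpos : 0 < M := by positivity
  have hqc : Continuous (cap A) := (contDiff_cap A).continuous
  have hB : closedBall (0 : Plane) (A / 2) ⊆ ball 0 (2 * A) :=
    closedBall_subset_ball (by linarith)
  set k : Plane → ℝ := fun y => (closedBall (0 : Plane) (A / 2)).indicator (fun _ => -(c₀ / 2)) y
    + T.indicator (fun _ => M) y with hk
  have hpt : ∀ y ∈ ball (0 : Plane) (2 * A), density F lam v y ≤ density F lam u y + k y := by
    intro y hy
    have hyn : ‖y‖ < 2 * A := mem_ball_zero_iff.1 hy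
    have hs0 := sq_nonneg (cap A) y
    have hs1 : sq (cap A) y ≤ 1 := by
      rw [sq_cap hA, div_le_one (by positivity)]
      nlinarith [norm_nonneg y]
    have hind : -(c₀ / 2) ≤ (closedBall (0 : Plane) (A / 2)).indicator (fun _ => -(c₀ / 2)) y := by
      by_cases hyb : y ∈ closedBall (0 : Plane) (A / 2)
      · rw [indicator_of_mem hyb]
      · rw [indicator_of_notMem hyb]; linarith
    have hindT : 0 ≤ T.indicator (fun _ => M) y := indicator_nonneg (fun _ _ => hMpos.le) y
    rcases (h.nonneg y).eq_or_lt' with hu0 | hupos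
    · have hlt : u y < cap A y := by rw [hu0]; exact (cap_pos hA).2 hyn
      rw [h.density_max_of_lt hqc hlt, density, density_of_zero F lam h.nonneg hu0]
      simp only [hk, indicator_of_mem (hzero y hy hu0)]
      have := h.F_sub_le_mul_sub le_rfl hs0
      have := mul_le_mul_of_nonneg_left hs1 hC₀.le
      linarith
    by_cases hyb : y ∈ closedBall (0 : Plane) (A / 2)
    · rw [h.density_max_of_lt hqc (hcap y hyb), h.density_eq_of_pos hne hupos]
      simp only [hk, indicator_of_mem hyb]
      have hs2 : sq (cap A) y ≤ 1 / 2 := by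
        rw [sq_cap hA, div_le_iff₀ (by positivity)]
        have := mem_closedBall_zero_iff.1 hyb
        nlinarith [norm_nonneg y]
      have := h.mul_sub_le_F_sub hs0 hs1
      nlinarith
    · simp only [hk, indicator_of_notMem hyb]
      rcases lt_or_ge (u y) (cap A y) with hlt | hge
      · rw [h.density_max_of_lt hqc hlt, h.density_eq_of_pos hne hupos]
        have := h.mul_sub_le_F_sub hs0 hs1
        have := mul_nonneg hc₀.le (sub_nonneg.2 hs1)
        linarith
      · have := h.density_max_le_of_le hne hqc hge hupos
        linarith
  have hvl : LocallyLipschitz v :=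
    lipschitzWith_max.locallyLipschitz.comp
      (h.lip.prodMk (smooth_of_le (contDiff_cap A)).locallyLipschitz)
  have hmin : ∫ x in ball (0 : Plane) (2 * A), density F lam u x
      ≤ ∫ x in ball (0 : Plane) (2 * A), density F lam v x := by
    refine h.minimal (2 * A) (by linarith) v hvl fun x hx => max_eq_left ?_
    have : ¬ 0 < cap A x := fun h0 => hx (mem_ball_zero_iff.2 ((cap_pos hA).1 h0))
    exact (not_lt.1 this).trans (h.nonneg x)
  have hub : ∀ y, density F lam u y ≤ F 1 + lam ^ 2 := fun y => by
    rcases (h.nonneg y).eq_or_lt' with hu0 | hupos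
    · rw [density, density_of_zero F lam h.nonneg hu0]
      have := h.F_zero_le zero_le_one
      have := _root_.sq_nonneg lam
      linarith
    · exact (h.density_eq_of_pos hne hupos).le
  have hiu : IntegrableOn (density F lam u) (ball 0 (2 * A)) :=
    h.integrableOn_density h.lip.continuous fun y _ => hub y
  have hkM : ∀ y, k y ≤ M := fun y => by
    have h1 : (closedBall (0 : Plane) (A / 2)).indicator (fun _ => -(c₀ / 2)) y ≤ 0 :=
      indicator_nonpos (fun _ _ => by linarith) y
    have h2 : T.indicator (fun _ => M) y ≤ M := indicator_le_self' (fun _ _ => hMpos.le) y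
    simp only [hk]
    linarith
  have hiv : IntegrableOn (density F lam v) (ball 0 (2 * A)) :=
    h.integrableOn_density (M := F 1 + lam ^ 2 + M) hvl.continuous fun y hy =>
      (hpt y hy).trans (add_le_add (hub y) (hkM y))
  have hconst : ∀ a : ℝ, IntegrableOn (fun _ : Plane => a) (ball (0 : Plane) (2 * A)) :=
    fun a => integrableOn_const measure_ball_lt_top.ne
  have hi1 : IntegrableOn ((closedBall (0 : Plane) (A / 2)).indicator fun _ => -(c₀ / 2))
      (ball 0 (2 * A)) := (hconst _).indicator measurableSet_closedBall
  have hi2 : IntegrableOn (T.indicator fun _ => M) (ball 0 (2 * A)) := (hconst _).indicator hT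
  have hik : IntegrableOn k (ball 0 (2 * A)) := hi1.add hi2
  have hle := setIntegral_mono_on hiv (hiu.add hik) measurableSet_ball hpt
  have hsum : ∫ x in ball (0 : Plane) (2 * A), k x
      = -(c₀ / 2) * (Real.pi * (A / 2) ^ 2) + M * volume.real T := by
    simp only [hk]
    rw [integral_add hi1 hi2, setIntegral_indicator measurableSet_closedBall,
      setIntegral_indicator hT, inter_eq_right.2 hB, inter_eq_right.2 hTb, setIntegral_const,
      setIntegral_const, measureReal_closedBall 0 (by positivity), smul_eq_mul, smul_eq_mul]
    ring
  have hadd : ∫ x in ball (0 : Plane) (2 * A), (density F lam u + k) x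
      = (∫ x in ball (0 : Plane) (2 * A), density F lam u x)
        + ∫ x in ball (0 : Plane) (2 * A), k x := integral_add hiu hik
  rw [hadd, hsum] at hle
  linarith

/-- A minimizer with nonempty free boundary is a half-plane solution. -/
theorem half_plane (h : Minimizer F F' F'' c₀ C₀ lam u W)
    (hne : (frontier {y | 0 < u y}).Nonempty) :
    ∃ e : Plane, ‖e‖ = 1 ∧ ∃ c, ∀ x, u x = max (⟪x, e⟫ - c) 0 := by
  obtain ⟨e, he, c, hc | ⟨c', hcc, hH, hH', hΩ⟩⟩ := h.half_plane_or_two_planes hne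
  · exact ⟨e, he, c, hc⟩
  exfalso
  have hc₀ := h.c₀_pos
  have hC₀ := h.C₀_pos
  set M := C₀ + lam ^ 2 + c₀ / 2 with hM
  have hMpos : 0 < M := by positivity
  obtain ⟨N, hN⟩ := exists_nat_gt (72 * M / c₀)
  have hNpos : (0 : ℝ) < N := lt_of_le_of_lt (by positivity) hN
  set L := c - c' + 1 with hL
  have hLpos : 0 < L := by linarith
  set A := N * L + 3 * (|c| + |c'|) with hA
  have hAL : N * L ≤ A := by
    have := abs_nonneg c
    have := abs_nonneg c'
    linarith
  have hNL : 0 < N * L := by positivity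
  have hApos : 0 < A := by linarith
  set T := {y : Plane | c' ≤ ⟪y, e⟫ ∧ ⟪y, e⟫ ≤ c} ∩ ball 0 (2 * A) with hT
  have hTm : MeasurableSet T := by
    have hcont : Continuous fun y : Plane => ⟪y, e⟫ := by fun_prop
    exact ((isClosed_le continuous_const hcont).inter
      (isClosed_le hcont continuous_const)).measurableSet.inter measurableSet_ball
  have h1 := h.area_le_of_lt_cap hne hApos hTm (fun y hy hu0 => ⟨⟨?_, ?_⟩, hy⟩) inter_subset_right
    (fun y hy => ?_)
  · have h2 := mul_measureReal_strip_le he (c := c) (c' := c') (R := 2 * A) (L := L)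
      (by linarith) hLpos.le (by linarith) N
    have h3 : Real.pi * (2 * A + N * L) ^ 2 ≤ Real.pi * (3 * A) ^ 2 := by
      have := Real.pi_pos
      gcongr
      linarith
    have h4 : 72 * M < N * c₀ := (div_lt_iff₀ hc₀).1 hN
    have h5 : 0 < Real.pi * A ^ 2 := by positivity
    have h6 : N * (c₀ / 2 * (Real.pi * (A / 2) ^ 2)) ≤ M * (Real.pi * (3 * A) ^ 2) := by
      calc _ ≤ N * (M * volume.real T) := by gcongr
        _ = M * (N * volume.real T) := by ring
        _ ≤ _ := mul_le_mul_of_nonneg_left (h2.trans h3) hMpos.le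
    nlinarith
  · by_contra hlt
    have := hH' y (not_le.1 hlt)
    linarith [not_le.1 hlt]
  · by_contra hlt
    have := hH y (not_le.1 hlt)
    linarith [not_le.1 hlt]
  · have hyn := mem_closedBall_zero_iff.1 hy
    have hcap : A - A / 16 ≤ cap A y := by
      rw [cap, sub_zero]
      have : (4 * A)⁻¹ * ‖y‖ ^ 2 ≤ (4 * A)⁻¹ * (A / 2) ^ 2 := by gcongr
      have e1 : (4 * A)⁻¹ * (A / 2) ^ 2 = A / 16 := by
        field_simp
        ring
      linarith
    have hin : |⟪y, e⟫| ≤ ‖y‖ := by simpa [he] using abs_real_inner_le_norm y e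
    have := abs_le.1 hin
    have := le_abs_self c'
    have := neg_abs_le c
    have := abs_nonneg c
    have := abs_nonneg c'
    rcases (h.nonneg y).eq_or_lt' with hu0 | hupos
    · linarith
    rcases hΩ y hupos with hy1 | hy1
    · rw [hH y hy1]
      linarith
    · rw [hH' y hy1]
      linarith

end Minimizer
/-- A function differentiable on the right half-line, glued to one differentiable everywhere. -/
theorem hasDerivAt_glue {G P G' P' : ℝ → ℝ}
    (hG : ∀ t ∈ Ici (0 : ℝ), HasDerivWithinAt G (G' t) (Ici 0) t)
    (hP : ∀ t, HasDerivAt P (P' t) t) (h0 : P 0 = G 0) (h0' : P' 0 = G' 0) (t : ℝ) :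
    HasDerivAt (fun t => if 0 ≤ t then G t else P t) (if 0 ≤ t then G' t else P' t) t := by
  rcases lt_trichotomy t 0 with ht | rfl | ht
  · rw [if_neg (not_le.2 ht)]
    refine (hP t).congr_of_eventuallyEq ?_
    filter_upwards [Iio_mem_nhds ht] with s hs using if_neg (not_le.2 hs)
  · have h1 : HasDerivWithinAt (fun t => if 0 ≤ t then G t else P t) (G' 0) (Ici 0) 0 :=
      (hG 0 self_mem_Ici).congr (fun s hs => if_pos hs) (if_pos le_rfl)
    have h2 : HasDerivWithinAt (fun t => if 0 ≤ t then G t else P t) (G' 0) (Iic 0) 0 := by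
      rw [← h0']
      refine (hP 0).hasDerivWithinAt.congr (fun s hs => ?_) (by simp [h0])
      rcases (mem_Iic.1 hs).lt_or_eq with hs | rfl
      · exact if_neg (not_le.2 hs)
      · simp [h0]
    have := h2.union h1
    rw [Iic_union_Ici, hasDerivWithinAt_univ] at this
    simpa using this
  · rw [if_pos ht.le]
    refine ((hG t ht.le).hasDerivAt (Ici_mem_nhds ht)).congr_of_eventuallyEq ?_
    filter_upwards [Ioi_mem_nhds ht] with s hs using if_pos (le_of_lt hs)

/-- A twice continuously differentiable function on the right half-line extends to the line. -/
theorem exists_extension {F F' F'' : ℝ → ℝ}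
    (hF : ∀ t ∈ Ici (0 : ℝ), HasDerivWithinAt F (F' t) (Ici 0) t)
    (hF' : ∀ t ∈ Ici (0 : ℝ), HasDerivWithinAt F' (F'' t) (Ici 0) t)
    (hF'' : ContinuousOn F'' (Ici 0)) :
    ∃ G G' G'' : ℝ → ℝ, (∀ t, HasDerivAt G (G' t) t) ∧ (∀ t, HasDerivAt G' (G'' t) t) ∧
      Continuous G'' ∧ ∀ t, 0 ≤ t → G t = F t ∧ G' t = F' t ∧ G'' t = F'' t := by
  refine ⟨fun t => if 0 ≤ t then F t else F 0 + F' 0 * t + F'' 0 / 2 * t ^ 2,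
    fun t => if 0 ≤ t then F' t else F' 0 + F'' 0 * t, fun t => if 0 ≤ t then F'' t else F'' 0,
    hasDerivAt_glue hF (fun t => ?_) (by simp) (by simp),
    hasDerivAt_glue hF' (fun t => ?_) (by simp) rfl, ?_,
    fun t ht => ⟨if_pos ht, if_pos ht, if_pos ht⟩⟩
  · have h1 := (((hasDerivAt_id t).const_mul (F' 0)).const_add (F 0)).add
      ((hasDerivAt_pow 2 t).const_mul (F'' 0 / 2))
    refine h1.congr_deriv ?_
    push_cast
    ring
  · simpa using ((hasDerivAt_id t).const_mul (F'' 0)).const_add (F' 0)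
  · have h1 : (fun t => if 0 ≤ t then F'' t else F'' 0) = fun t => F'' (max t 0) := by
      funext t
      split_ifs with ht
      · rw [max_eq_left ht]
      · rw [max_eq_right (not_le.1 ht).le]
    rw [h1]
    exact hF''.comp_continuous (by fun_prop) fun t => le_max_right t 0

/-- A function smooth on an open set agrees near any closed subset with one smooth on the plane. -/
theorem exists_contDiff_eq_nhdsSet {V K : Set Plane} (hV : IsOpen V) (hK : IsClosed K)
    (hKV : K ⊆ V) {w : Plane → ℝ} (hw : ContDiffOn ℝ (⊤ : ℕ∞) w V) :
    ∃ W : Plane → ℝ, ContDiff ℝ (⊤ : ℕ∞) W ∧ ∀ x ∈ K, W =ᶠ[nhds x] w := by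
  obtain ⟨f, hf0, hf1, -⟩ := exists_contMDiffMap_zero_one_nhds_of_isClosed (n := (⊤ : ℕ∞))
    (modelWithCornersSelf ℝ Plane) hV.isClosed_compl hK (disjoint_compl_left_iff_subset.2 hKV)
  have hf : ContDiff ℝ (⊤ : ℕ∞) f := f.contMDiff.contDiff
  refine ⟨fun x => f x * w x, contDiff_iff_contDiffAt.2 fun x => ?_, fun x hx => ?_⟩
  · by_cases hx : x ∈ V
    · exact hf.contDiffAt.mul (hw.contDiffAt (hV.mem_nhds hx))
    · refine (contDiffAt_const (c := (0 : ℝ))).congr_of_eventuallyEq ?_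
      filter_upwards [hf0.filter_mono (nhds_le_nhdsSet hx)] with y hy
      rw [hy, zero_mul]
  · filter_upwards [hf1.filter_mono (nhds_le_nhdsSet hx)] with y hy
    rw [hy, one_mul]

end OnePhase

/-- In the plane, a nonnegative, locally Lipschitz global minimizer
of `J_F` whose free boundary `Γ = ∂{u>0}` is a nonempty smooth embedded curve
(described locally as a regular level set of a smooth function), with `u` smooth up to
`Γ` from the positive side and `|∇u| = 1` on `Γ`, is a half-plane solution
`u(x) = max(⟨x,e⟩ - c, 0)`; in particular `Γ` is a straight line. -/
theorem smooth_free_boundary_in_plane_is_line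
    (F F' F'' : ℝ → ℝ) (c₀ C₀ : ℝ)
    (hc₀ : 0 < c₀) (hC₀ : c₀ ≤ C₀)
    (hFd : ∀ t ∈ Ici (0:ℝ), HasDerivWithinAt F (F' t) (Ici 0) t)
    (hFd2 : ∀ t ∈ Ici (0:ℝ), HasDerivWithinAt F' (F'' t) (Ici 0) t)
    (hF''cont : ContinuousOn F'' (Ici 0))
    (hstruct1 : ∀ t ∈ Ici (0:ℝ), c₀ ≤ F' t ∧ F' t ≤ C₀)
    (hstruct2 : ∀ t ∈ Ici (0:ℝ), 0 ≤ F'' t ∧ F'' t ≤ C₀ / (1 + t))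
    (lam : ℝ) (hlam : 0 < lam) (hlamsq : lam ^ 2 = 2 * F' 1 - F 1)
    (u : EuclideanSpace ℝ (Fin 2) → ℝ)
    (hupos : ∀ x, 0 ≤ u x) (huLip : LocallyLipschitz u)
    (hmin : ∀ R > (0:ℝ), ∀ v : EuclideanSpace ℝ (Fin 2) → ℝ, LocallyLipschitz v →
      (∀ x ∉ ball (0 : EuclideanSpace ℝ (Fin 2)) R, v x = u x) →
      (∫ x in ball (0 : EuclideanSpace ℝ (Fin 2)) R,
          (F (‖gradient u x‖ ^ 2) + lam ^ 2 * Set.indicator {y | 0 < u y} (fun _ => (1:ℝ)) x)) ≤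
      (∫ x in ball (0 : EuclideanSpace ℝ (Fin 2)) R,
          (F (‖gradient v x‖ ^ 2) + lam ^ 2 * Set.indicator {y | 0 < v y} (fun _ => (1:ℝ)) x)))
    -- the free boundary is nonempty
    (hne : (frontier {y | 0 < u y}).Nonempty)
    -- the free boundary is a smooth embedded curve: locally a regular level set
    (hsmoothΓ : ∀ z ∈ frontier {y | 0 < u y},
      ∃ U : Set (EuclideanSpace ℝ (Fin 2)), IsOpen U ∧ z ∈ U ∧
        ∃ g : EuclideanSpace ℝ (Fin 2) → ℝ, ContDiffOn ℝ (⊤:ℕ∞) g U ∧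
          (∀ y ∈ U, gradient g y ≠ 0) ∧
          frontier {y | 0 < u y} ∩ U = {y ∈ U | g y = 0})
    -- u is smooth up to Γ from the positive side, and |∇u| = 1 on Γ
    (V : Set (EuclideanSpace ℝ (Fin 2))) (hVopen : IsOpen V)
    (hVsub : {y | 0 < u y} ∪ frontier {y | 0 < u y} ⊆ V)
    (w : EuclideanSpace ℝ (Fin 2) → ℝ) (hw : ContDiffOn ℝ (⊤:ℕ∞) w V)
    (hwu : ∀ x ∈ {y | 0 < u y}, w x = u x)
    (hgrad1 : ∀ z ∈ frontier {y | 0 < u y}, ‖gradient w z‖ = 1) :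
    ∃ e : EuclideanSpace ℝ (Fin 2), ‖e‖ = 1 ∧
      ∃ c : ℝ, ∀ x, u x = max (⟪x, e⟫ - c) 0 := by
  have hcl : closure {y | 0 < u y} ⊆ V := fun x hx => hVsub <| by
    rw [closure_eq_self_union_frontier] at hx
    exact hx
  obtain ⟨W, hW, hWw⟩ := OnePhase.exists_contDiff_eq_nhdsSet hVopen isClosed_closure hcl hw
  obtain ⟨G, G', G'', hG, hG', hG'', hGF⟩ := OnePhase.exists_extension hFd hFd2 hF''cont
  have hGsq : ∀ t : ℝ, G (t ^ 2) = F (t ^ 2) := fun t => (hGF _ (sq_nonneg t)).1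
  have h : OnePhase.Minimizer G G' G'' c₀ C₀ lam u W :=
    { c₀_pos := hc₀
      hasDerivAt := hG
      hasDerivAt' := hG'
      continuous'' := hG''
      le_deriv := fun t ht => by rw [(hGF t ht).2.1]; exact (hstruct1 t ht).1
      deriv_le := fun t ht => by rw [(hGF t ht).2.1]; exact (hstruct1 t ht).2
      deriv2_nonneg := fun t ht => by rw [(hGF t ht).2.2]; exact (hstruct2 t ht).1
      deriv2_le := fun t ht => by rw [(hGF t ht).2.2]; exact (hstruct2 t ht).2
      lam_sq := by rw [(hGF 1 zero_le_one).1, (hGF 1 zero_le_one).2.1, hlamsq]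
      nonneg := hupos
      lip := huLip
      minimal := by simpa only [hGsq] using hmin
      smooth := hW
      eq_on := fun x hx => (hWw x (subset_closure hx)).self_of_nhds.trans (hwu x hx)
      sq_eq_one := fun z hz => by
        have hev := hWw z (frontier_subset_closure hz)
        rw [OnePhase.sq, OnePhase.pd_congr hev, OnePhase.pd_congr hev,
          ← OnePhase.norm_gradient_sq, hgrad1 z hz, one_pow] }
  exact h.half_plane hne
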